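/- For every positive integer n, the number of representations of n by x1^2 + x2^2 + 2(x3^2+x4^2+x5^2+x6^2+x7^2) + 4x8^2 equals (16/11)σ_{3;χ8,1}(n) + (2/11)σ_{3;1,χ8}(n/2) + (4/11)a1(n) + (24/11)a2(n) + (48/11)a1(n/2) + (16/11)a2(n/2), with terms of non-integer argument interpreted as 0. -/

import Mathlib

open Complex Real Finset

/-- The Dedekind eta function `η(z) = q^{1/24} ∏ (1 - q^m)`, `q = e^{2πiz}`. -/
noncomputable def dedekindEta (z : ℂ) : ℂ :=
  Complex.exp (Real.pi * Complex.I * z / 12) *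
    ∏' m : ℕ, (1 - Complex.exp (2 * Real.pi * Complex.I * (m + 1) * z))

/-- `repCount a n` is the number of `(x₁,…,x₈) ∈ ℤ⁸` with `∑ aᵢ xᵢ² = n`. -/
noncomputable def repCount (a : Fin 8 → ℕ) (n : ℕ) : ℕ :=
  Nat.card {x : Fin 8 → ℤ // ∑ i, (a i : ℤ) * x i ^ 2 = (n : ℤ)}

/-- `σ_{3;1,χ₈}(n) = ∑_{d ∣ n} χ₈(d) d³`. -/
def sigmaOneChi8 (n : ℕ) : ℤ := ∑ d ∈ n.divisors, ZMod.χ₈ (d : ZMod 8) * (d : ℤ) ^ 3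

/-- `σ_{3;χ₈,1}(n) = ∑_{d ∣ n} χ₈(n/d) d³`. -/
def sigmaChi8One (n : ℕ) : ℤ := ∑ d ∈ n.divisors, ZMod.χ₈ ((n / d : ℕ) : ZMod 8) * (d : ℤ) ^ 3

/-- `f(n/2)` when `2 ∣ n`, and `0` otherwise. -/
def half (f : ℕ → ℤ) (n : ℕ) : ℚ := if 2 ∣ n then (f (n / 2) : ℚ) else 0


namespace RF5

theorem hsc {ι α : Type*} [AddCommMonoid α] [TopologicalSpace α] {f g : ι → α} {a b : α}
    (h : HasSum f a) (hf : ∀ k, g k = f k) (ha : b = a) : HasSum g b := by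
  rw [ha, show g = f from funext hf]; exact h

/-- indicator of positive integers -/
def pos (k : ℤ) : ℝ := if 0 < k then 1 else 0

theorem hasSum_int_ind (h d : ℤ → ℤ → ℝ) (v : ℤ → ℝ) (h0 : HasSum (h 0) (v 0))
    (hd : ∀ n, HasSum (d n) (v (n + 1) - v n)) (hs : ∀ n k, h (n + 1) k = h n k + d n k) (n : ℤ) :
    HasSum (h n) (v n) := by
  induction n using Int.induction_on with
  | zero => exact h0
  | succ i ih =>
    exact hsc (ih.add (hd i)) (fun k => hs _ _) (by ring)
  | pred i ih =>
    have e : -(i:ℤ) - 1 + 1 = -(i:ℤ) := by ring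
    refine hsc (ih.sub (hd (-(i:ℤ) - 1))) (fun k => ?_) (by rw [e]; ring)
    have := hs (-(i:ℤ) - 1) k
    rw [e] at this
    rw [this]; ring

theorem hasSum_pt (m : ℤ) (c : ℝ) : HasSum (fun k : ℤ => if k = m then c else 0) c :=
  hasSum_ite_eq m c

theorem pos_sub_step (k n : ℤ) : pos (k - n) - pos (k - (n + 1)) = if k = n + 1 then 1 else 0 := by
  unfold pos
  split_ifs <;> first | omega | norm_num

theorem hasSum_pos (n : ℤ) : HasSum (fun k : ℤ => pos k - pos (k - n)) (n : ℝ) := by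
  apply hasSum_int_ind (fun n k => pos k - pos (k - n)) (fun n k => if k = n + 1 then 1 else 0)
    (fun n => (n : ℝ))
  · simp [hasSum_zero]
  · intro n
    push_cast
    simpa using hasSum_pt (n + 1) 1
  · intro n k
    have := pos_sub_step k n
    linarith

theorem hasSum_pos1 (n : ℤ) :
    HasSum (fun k : ℤ => (k : ℝ) * (pos k - pos (k - n))) ((n : ℝ) * (n + 1) / 2) := by
  apply hasSum_int_ind (fun n k => (k : ℝ) * (pos k - pos (k - n)))
    (fun n k => if k = n + 1 then ((n : ℝ) + 1) else 0) (fun n => (n : ℝ) * (n + 1) / 2)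
  · simp [hasSum_zero]
  · intro n
    have := hasSum_pt (n + 1) ((n : ℝ) + 1)
    convert this using 1
    push_cast; ring
  · intro n k
    have := pos_sub_step k n
    rw [show pos k - pos (k - (n + 1)) = pos k - pos (k - n) + (pos (k - n) - pos (k - (n + 1))) by ring,
      this]
    split_ifs with h
    · subst h; push_cast; ring
    · ring

theorem hasSum_pos2 (n : ℤ) :
    HasSum (fun k : ℤ => (k : ℝ) * (n - k) * (pos k - pos (k - n))) (((n : ℝ) ^ 3 - n) / 6) := by
  apply hasSum_int_ind (fun n k => (k : ℝ) * (n - k) * (pos k - pos (k - n)))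
    (fun n k => (k : ℝ) * (pos k - pos (k - n))) (fun n => ((n : ℝ) ^ 3 - n) / 6)
  · simp [hasSum_zero]
  · intro n
    convert hasSum_pos1 n using 1
    push_cast; ring
  · intro n k
    have := pos_sub_step k n
    rw [show pos k - pos (k - (n + 1)) = pos k - pos (k - n) + (pos (k - n) - pos (k - (n + 1))) by ring,
      this]
    split_ifs with h
    · subst h; push_cast; ring
    · push_cast; ring

theorem hasSum_pos_odd (n : ℤ) :
    HasSum (fun j : ℤ => pos (2 * j + 1 + n) - pos (2 * j + 1 - n)) (n : ℝ) := by
  apply hasSum_int_ind (fun n j => pos (2 * j + 1 + n) - pos (2 * j + 1 - n))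
    (fun n j => (if 2 * j + 1 + n = 0 then 1 else 0) + (if 2 * j = n then 1 else 0))
    (fun n => (n : ℝ))
  · simp [hasSum_zero]
  · intro n
    rcases Int.even_or_odd' n with ⟨m, rfl | rfl⟩
    · have := hasSum_pt m 1
      convert this using 1
      · funext j
        split_ifs <;> first | omega | norm_num
      · push_cast; ring
    · have := hasSum_pt (-m - 1) 1
      convert this using 1
      · funext j
        split_ifs <;> first | omega | norm_num
      · push_cast; ring
  · intro n k
    unfold pos
    split_ifs <;> first | omega | norm_num

variable {Q : ℝ}

/-- `s(n) = 1/(1-Q^n)` -/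
noncomputable def sQ (Q : ℝ) (n : ℤ) : ℝ := 1 / (1 - Q ^ n)
/-- `t(n) = 1/(1+Q^n)` -/
noncomputable def tQ (Q : ℝ) (n : ℤ) : ℝ := 1 / (1 + Q ^ n)

theorem one_add_ne (h0 : 0 < Q) (n : ℤ) : 1 + Q ^ n ≠ 0 := by positivity

theorem one_sub_ne (h0 : 0 < Q) (h1 : Q < 1) {n : ℤ} (hn : n ≠ 0) : 1 - Q ^ n ≠ 0 := by
  intro h
  have : Q ^ n = 1 := by linarith
  rw [zpow_eq_one_iff_right₀ h0.le h1.ne] at this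
  exact hn this

theorem sQ_neg (h0 : 0 < Q) (h1 : Q < 1) {n : ℤ} (hn : n ≠ 0) : sQ Q (-n) = 1 - sQ Q n := by
  unfold sQ
  have h := one_sub_ne h0 h1 hn
  have h' := one_sub_ne h0 h1 (n := -n) (by omega)
  have hq : Q ^ n ≠ 0 := by positivity
  rw [zpow_neg] at *
  have h'' : Q ^ n - 1 ≠ 0 := by intro h2; apply h; linarith
  field_simp
  ring

theorem tQ_neg (h0 : 0 < Q) (n : ℤ) : tQ Q (-n) = 1 - tQ Q n := by
  unfold tQ
  have h := one_add_ne h0 n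
  have hq : Q ^ n ≠ 0 := by positivity
  have h' : Q ^ n + 1 ≠ 0 := by intro h2; apply h; linarith
  rw [zpow_neg]
  field_simp
  ring

theorem sQ_zero : sQ Q 0 = 0 := by simp [sQ]

theorem sQ_bound (h0 : 0 < Q) (h1 : Q < 1) (n : ℕ) : |sQ Q n| ≤ 1 / (1 - Q) := by
  have : 0 < 1 - Q := by linarith
  rcases Nat.eq_zero_or_pos n with rfl | hn
  · simp [sQ]; linarith
  · unfold sQ
    have hq : Q ^ n ≤ Q := pow_le_of_le_one h0.le h1.le hn.ne'
    rw [zpow_natCast, abs_of_pos (by apply one_div_pos.2; linarith)]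
    apply one_div_le_one_div_of_le <;> linarith

theorem sQ_bound_neg (h0 : 0 < Q) (h1 : Q < 1) (n : ℕ) : |sQ Q (-n)| ≤ 1 / (1 - Q) * Q ^ n := by
  have : 0 < 1 - Q := by linarith
  rcases Nat.eq_zero_or_pos n with rfl | hn
  · simp [sQ]; linarith
  · have hq : Q ^ n ≤ Q := pow_le_of_le_one h0.le h1.le hn.ne'
    have h2 := sQ_bound h0 h1 n
    have : sQ Q (-n) = - (Q ^ n * sQ Q n) := by
      rw [sQ_neg h0 h1 (by positivity)]
      have h3 := one_sub_ne h0 h1 (n := (n:ℤ)) (by positivity)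
      unfold sQ
      rw [zpow_natCast] at *
      field_simp
      ring
    rw [this, abs_neg, abs_mul, abs_of_pos (show 0 < Q ^ n by positivity), mul_comm]
    gcongr

theorem tQ_bound (h0 : 0 < Q) (h1 : Q < 1) (n : ℕ) : |tQ Q n| ≤ 1 / (1 - Q) := by
  have : 0 < 1 - Q := by linarith
  unfold tQ
  have hq : 0 < Q ^ n := by positivity
  rw [zpow_natCast, abs_of_pos (by positivity)]
  apply one_div_le_one_div_of_le <;> linarith

theorem tQ_bound_neg (h0 : 0 < Q) (h1 : Q < 1) (n : ℕ) : |tQ Q (-n)| ≤ 1 / (1 - Q) * Q ^ n := by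
  have : tQ Q (-n) = Q ^ n * tQ Q n := by
    rw [tQ_neg h0]
    have h3 := one_add_ne h0 (n:ℤ)
    unfold tQ
    rw [zpow_natCast] at *
    field_simp
    ring
  rw [this, abs_mul, abs_of_pos (show 0 < Q ^ n by positivity), mul_comm]
  have := tQ_bound h0 h1 n
  gcongr

/-- polynomial bound times one-sided geometric decay -/
def Adm (Q : ℝ) (f : ℤ → ℝ) : Prop :=
  ∃ (C : ℝ) (p : ℕ), (∀ n : ℕ, |f n| ≤ C * (n : ℝ) ^ p + C) ∧
    (∀ n : ℕ, |f (-n)| ≤ (C * (n : ℝ) ^ p + C) * Q ^ n)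

theorem adm_of (f : ℤ → ℝ) (C : ℝ) (hC : 0 ≤ C) (hp : ∀ n : ℕ, |f n| ≤ C)
    (hn : ∀ n : ℕ, |f (-n)| ≤ C * Q ^ n) (h0 : 0 < Q) (p : ℕ) :
    Adm Q (fun n => (n : ℝ) ^ p * f n) := by
  refine ⟨C, p, fun n => ?_, fun n => ?_⟩
  · rw [abs_mul]
    have : |((n : ℤ) : ℝ) ^ p| = (n : ℝ) ^ p := by simp
    rw [this]
    nlinarith [hp n, show 0 ≤ (n : ℝ) ^ p by positivity]
  · rw [abs_mul]
    have : |((-n : ℤ) : ℝ) ^ p| = (n : ℝ) ^ p := by simp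
    rw [this]
    have h1 := hn n
    calc (n : ℝ) ^ p * |f (-n)| ≤ (n : ℝ) ^ p * (C * Q ^ n) := by gcongr
      _ ≤ _ := by
        have : 0 ≤ C * Q ^ n := by positivity
        linarith

theorem adm_s (h0 : 0 < Q) (h1 : Q < 1) (p : ℕ) : Adm Q (fun n => (n : ℝ) ^ p * sQ Q n) :=
  adm_of _ (1 / (1 - Q)) (by apply one_div_nonneg.2; linarith) (sQ_bound h0 h1) (sQ_bound_neg h0 h1) h0 p

theorem adm_t (h0 : 0 < Q) (h1 : Q < 1) (p : ℕ) : Adm Q (fun n => (n : ℝ) ^ p * tQ Q n) :=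
  adm_of _ (1 / (1 - Q)) (by apply one_div_nonneg.2; linarith) (tQ_bound h0 h1) (tQ_bound_neg h0 h1) h0 p

theorem summable_poly_geom {r : ℝ} (h0 : 0 ≤ r) (h1 : r < 1) (C : ℝ) (p : ℕ) :
    Summable (fun n : ℕ => (C * (n : ℝ) ^ p + C) * r ^ n) := by
  have h := summable_pow_mul_geometric_of_norm_lt_one p (r := r) (by rwa [Real.norm_of_nonneg h0])
  have h2 := summable_geometric_of_lt_one h0 h1
  refine ((h.mul_left C).add (h2.mul_left C)).congr fun n => ?_
  ring

theorem Adm.summable {f : ℤ → ℝ} (hf : Adm Q f) (h0 : 0 < Q) {r : ℝ} (hQr : Q < r) (hr : r < 1) :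
    Summable (fun n : ℤ => |f n| * r ^ n) := by
  obtain ⟨C, p, hp, hn⟩ := hf
  have hr0 : 0 < r := h0.trans hQr
  apply Summable.of_nat_of_neg
  · refine Summable.of_nonneg_of_le (fun n => by positivity) (fun n => ?_)
      (summable_poly_geom hr0.le hr C p)
    rw [zpow_natCast]
    gcongr
    exact hp n
  · refine Summable.of_nonneg_of_le (fun n => by positivity) (fun n => ?_)
      (summable_poly_geom (r := Q / r) (by positivity) ((div_lt_one hr0).2 hQr) C p)
    rw [zpow_neg, zpow_natCast, div_pow, div_eq_mul_inv, ← mul_assoc]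
    gcongr
    exact hn n

variable {𝕜 : Type*} [RCLike 𝕜]

theorem Adm.summable' {f : ℤ → ℝ} (hf : Adm Q f) (h0 : 0 < Q) {z : 𝕜} (hQr : Q < ‖z‖) (hr : ‖z‖ < 1) :
    Summable (fun n : ℤ => ‖(f n : 𝕜) * z ^ n‖) := by
  refine (hf.summable h0 hQr hr).congr fun n => ?_
  rw [norm_mul, norm_zpow, RCLike.norm_ofReal]

/-- bilateral series -/
noncomputable def bil (f : ℤ → ℝ) (z : 𝕜) : 𝕜 := ∑' n : ℤ, (f n : 𝕜) * z ^ n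

theorem Adm.hasSum {f : ℤ → ℝ} (hf : Adm Q f) (h0 : 0 < Q) {z : 𝕜} (hQr : Q < ‖z‖) (hr : ‖z‖ < 1) :
    HasSum (fun n : ℤ => (f n : 𝕜) * z ^ n) (bil f z) :=
  (hf.summable' h0 hQr hr).of_norm.hasSum

/-- `(n, k) ↦ (k, n - k)` -/
def convEquiv : ℤ × ℤ ≃ ℤ × ℤ where
  toFun x := (x.2, x.1 - x.2)
  invFun x := (x.1 + x.2, x.1)
  left_inv x := by ext <;> simp
  right_inv x := by ext <;> simp

theorem hasSum_mul_norm {R : Type*} [NormedField R] [CompleteSpace R] {f g : ℤ → R}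
    (hf : Summable fun n => ‖f n‖) (hg : Summable fun n => ‖g n‖) {a b : R}
    (ha : HasSum f a) (hb : HasSum g b) : HasSum (fun x : ℤ × ℤ => f x.1 * g x.2) (a * b) :=
  ha.mul hb (summable_mul_of_summable_norm hf hg)

theorem conv_mul (h0 : 0 < Q) {f g c : ℤ → ℝ} (hf : Adm Q f) (hg : Adm Q g)
    (hc : ∀ n, HasSum (fun k => f k * g (n - k)) (c n))
    {z : 𝕜} (hQr : Q < ‖z‖) (hr : ‖z‖ < 1) :
    HasSum (fun n : ℤ => (c n : 𝕜) * z ^ n) (bil f z * bil g z) := by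
  have hz : z ≠ 0 := norm_pos_iff.1 (h0.trans hQr)
  have hF := hf.summable' h0 hQr hr
  have hG := hg.summable' h0 hQr hr
  have h := hasSum_mul_norm (R := 𝕜) hF hG hF.of_norm.hasSum hG.of_norm.hasSum
  have h2 := (convEquiv.hasSum_iff).2 h
  unfold bil
  refine HasSum.prod_fiberwise h2 fun n => ?_
  have h3 := ((RCLike.hasSum_ofReal 𝕜).2 (hc n)).mul_right (z ^ n)
  refine hsc h3 (fun k => ?_) rfl
  have hzz : z ^ k * z ^ (n - k) = z ^ n := by rw [← zpow_add₀ hz]; congr 1; ring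
  rw [← hzz]
  simp only [Function.comp, convEquiv, Equiv.coe_fn_mk]
  push_cast
  ring

end RF5

namespace RF5
variable {Q : ℝ} {𝕜 : Type*} [RCLike 𝕜]

theorem Adm.summable_conv {f g : ℤ → ℝ} (hf : Adm Q f) (hg : Adm Q g) (h0 : 0 < Q) (h1 : Q < 1)
    (n : ℤ) : Summable (fun k => f k * g (n - k)) := by
  have hr1 : Q < ‖(Q + 1) / 2‖ := by rw [Real.norm_of_nonneg (by linarith)]; linarith
  have hr2 : ‖(Q + 1) / 2‖ < 1 := by rw [Real.norm_of_nonneg (by linarith)]; linarith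
  have hz : (Q + 1) / 2 ≠ 0 := by intro h; linarith
  have hF := hf.summable' (𝕜 := ℝ) h0 hr1 hr2
  have hG := hg.summable' (𝕜 := ℝ) h0 hr1 hr2
  have h := hasSum_mul_norm (R := ℝ) hF hG hF.of_norm.hasSum hG.of_norm.hasSum
  have h2 := ((convEquiv.hasSum_iff).2 h).summable.prod_factor n
  have h3 := h2.mul_right (((Q + 1) / 2) ^ (-n))
  refine h3.congr fun k => ?_
  simp only [Function.comp, convEquiv, Equiv.coe_fn_mk, RCLike.ofReal_real_eq_id, id]
  have hzz : ((Q + 1) / 2) ^ k * ((Q + 1) / 2) ^ (n - k) * ((Q + 1) / 2) ^ (-n) = 1 := by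
    rw [← zpow_add₀ hz, ← zpow_add₀ hz]
    rw [show k + (n - k) + -n = 0 by ring, zpow_zero]
  calc _ = f k * g (n - k) * (((Q + 1) / 2) ^ k * ((Q + 1) / 2) ^ (n - k) * ((Q + 1) / 2) ^ (-n)) := by
        ring
    _ = _ := by rw [hzz, mul_one]

/-- decaying part -/
theorem summable_decay (h0 : 0 < Q) (h1 : Q < 1) (f : ℤ → ℝ) (C : ℝ)
    (hp : ∀ n : ℕ, |f n| ≤ C * Q ^ n) (hn : ∀ n : ℕ, |f (-n)| ≤ C * Q ^ n) (p : ℕ) :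
    Summable (fun k : ℤ => (k : ℝ) ^ p * f k) := by
  have key : Summable (fun n : ℕ => (n : ℝ) ^ p * (C * Q ^ n)) := by
    have h := summable_pow_mul_geometric_of_norm_lt_one p (r := Q) (by rwa [Real.norm_of_nonneg h0.le])
    refine (h.mul_left C).congr fun n => by ring
  apply Summable.of_nat_of_neg
  · apply Summable.of_norm_bounded key
    intro n
    rw [norm_mul, Real.norm_eq_abs, Real.norm_eq_abs]
    have : |((n : ℤ) : ℝ) ^ p| = (n : ℝ) ^ p := by simp
    rw [this]
    exact mul_le_mul_of_nonneg_left (hp n) (by positivity)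
  · apply Summable.of_norm_bounded key
    intro n
    rw [norm_mul, Real.norm_eq_abs, Real.norm_eq_abs]
    have : |((-n : ℤ) : ℝ) ^ p| = (n : ℝ) ^ p := by simp
    rw [this]
    exact mul_le_mul_of_nonneg_left (hn n) (by positivity)

theorem summable_rs (h0 : 0 < Q) (h1 : Q < 1) (p : ℕ) :
    Summable (fun k : ℤ => (k : ℝ) ^ p * (sQ Q k - pos k)) := by
  refine summable_decay h0 h1 _ (1 / (1 - Q)) (fun n => ?_) (fun n => ?_) p
  · rcases Nat.eq_zero_or_pos n with rfl | hn
    · simp [sQ, pos]; linarith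
    · have := sQ_bound_neg h0 h1 n
      rw [sQ_neg h0 h1 (by positivity)] at this
      rw [pos, if_pos (by positivity), abs_sub_comm]
      exact this
  · have := sQ_bound_neg h0 h1 n
    rw [pos, if_neg (by omega), sub_zero]
    exact this

theorem summable_rt (h0 : 0 < Q) (h1 : Q < 1) (p : ℕ) :
    Summable (fun k : ℤ => (k : ℝ) ^ p * (tQ Q k - pos k)) := by
  refine summable_decay h0 h1 _ (1 / (1 - Q)) (fun n => ?_) (fun n => ?_) p
  · rcases Nat.eq_zero_or_pos n with rfl | hn
    · have := tQ_bound_neg h0 h1 0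
      simpa [pos] using this
    · have := tQ_bound_neg h0 h1 n
      rw [tQ_neg h0] at this
      rw [pos, if_pos (by positivity), abs_sub_comm]
      exact this
  · have := tQ_bound_neg h0 h1 n
    rw [pos, if_neg (by omega), sub_zero]
    exact this

theorem hasSum_shift {f : ℤ → ℝ} {a : ℝ} (h : HasSum f a) (n : ℤ) : HasSum (fun k => f (k - n)) a :=
  ((Equiv.subRight n).hasSum_iff).2 h

theorem hasSum_refl {f : ℤ → ℝ} {a : ℝ} (h : HasSum f a) : HasSum (fun k => f (-k)) a :=
  ((Equiv.neg ℤ).hasSum_iff).2 h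

theorem hasSum_t_diff (h0 : 0 < Q) (h1 : Q < 1) (n : ℤ) :
    HasSum (fun k => tQ Q k - tQ Q (k - n)) (n : ℝ) := by
  have h := summable_rt h0 h1 0
  simp only [pow_zero, one_mul] at h
  refine hsc ((h.hasSum.sub (hasSum_shift h.hasSum n)).add (hasSum_pos n)) (fun k => ?_) ?_ <;> ring

/-- `S_p(z) = ∑ n^p z^n / (1 - Q^n)` -/
noncomputable def S (Q : ℝ) (p : ℕ) (z : 𝕜) : 𝕜 := bil (fun n => (n : ℝ) ^ p * sQ Q n) z
/-- `T_p(z) = ∑ n^p z^n / (1 + Q^n)` -/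
noncomputable def T (Q : ℝ) (p : ℕ) (z : 𝕜) : 𝕜 := bil (fun n => (n : ℝ) ^ p * tQ Q n) z

/-- the constant in `T₀² = κ + S₁` -/
noncomputable def kap (Q : ℝ) : ℝ := ∑' k : ℤ, tQ Q k * tQ Q (-k)

theorem t_mul_t (h0 : 0 < Q) (h1 : Q < 1) {n : ℤ} (hn : n ≠ 0) (k : ℤ) :
    tQ Q k * tQ Q (n - k) = sQ Q n * (tQ Q k - tQ Q (k - n)) := by
  have e : tQ Q (k - n) = 1 - tQ Q (n - k) := by rw [← tQ_neg h0]; congr 1; ring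
  rw [e]
  have hn' := one_sub_ne h0 h1 hn
  have h2 := one_add_ne h0 k
  have h3 := one_add_ne h0 (n - k)
  have e2 : Q ^ n = Q ^ k * Q ^ (n - k) := by rw [← zpow_add₀ h0.ne']; congr 1; ring
  unfold sQ tQ
  rw [e2] at hn' ⊢
  field_simp
  ring

theorem s_mul_s (h0 : 0 < Q) (h1 : Q < 1) {n : ℤ} (hn : n ≠ 0) {k : ℤ} (hk : k ≠ 0) (hnk : n - k ≠ 0) :
    sQ Q k * sQ Q (n - k) = sQ Q n * (sQ Q k - sQ Q (k - n)) := by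
  have e : sQ Q (k - n) = 1 - sQ Q (n - k) := by rw [← sQ_neg h0 h1 hnk]; congr 1; ring
  rw [e]
  have hn' := one_sub_ne h0 h1 hn
  have h2 := one_sub_ne h0 h1 hk
  have h3 := one_sub_ne h0 h1 hnk
  have e2 : Q ^ n = Q ^ k * Q ^ (n - k) := by rw [← zpow_add₀ h0.ne']; congr 1; ring
  unfold sQ
  rw [e2] at hn' ⊢
  field_simp
  ring

theorem s_mul_t (h0 : 0 < Q) (h1 : Q < 1) (n : ℤ) {k : ℤ} (hk : k ≠ 0) :
    sQ Q k * tQ Q (n - k) = tQ Q n * (sQ Q k - tQ Q (k - n)) := by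
  have e : tQ Q (k - n) = 1 - tQ Q (n - k) := by rw [← tQ_neg h0]; congr 1; ring
  rw [e]
  have hn' := one_add_ne h0 n
  have h2 := one_sub_ne h0 h1 hk
  have h3 := one_add_ne h0 (n - k)
  have e2 : Q ^ n = Q ^ k * Q ^ (n - k) := by rw [← zpow_add₀ h0.ne']; congr 1; ring
  unfold sQ tQ
  rw [e2] at hn' ⊢
  field_simp
  ring

theorem C1 (h0 : 0 < Q) {z : 𝕜} (hQr : Q < ‖z‖) (hr : ‖z‖ < 1) :
    T Q 0 z ^ 2 = (kap Q : 𝕜) + S Q 1 z := by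
  have h1 : Q < 1 := hQr.trans hr
  have hA := adm_t h0 h1 0
  have hB := adm_s h0 h1 1
  have hc : ∀ n : ℤ, HasSum (fun k : ℤ => ((k : ℝ) ^ 0 * tQ Q k) * (((n - k : ℤ) : ℝ) ^ 0 * tQ Q (n - k)))
      ((n : ℝ) ^ 1 * sQ Q n + if n = 0 then kap Q else 0) := by
    intro n
    by_cases hn : n = 0
    · subst hn
      have := (hA.summable_conv hA h0 h1 0).hasSum
      refine hsc this (fun k => rfl) ?_
      simp [kap]
    · refine hsc ((hasSum_t_diff h0 h1 n).mul_left (sQ Q n)) (fun k => ?_) ?_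
      · rw [← t_mul_t h0 h1 hn]; simp
      · simp [hn]; ring
  have h := conv_mul (𝕜 := 𝕜) h0 hA hA hc hQr hr
  have h' := (hB.hasSum h0 hQr hr).add (hasSum_ite_eq (0 : ℤ) (kap Q : 𝕜))
  rw [pow_two, add_comm]
  refine h.unique (hsc h' (fun n => ?_) rfl)
  by_cases hn : n = 0
  · subst hn; simp
  · simp [hn]

/-- Lambert series `∑ k≥1, k Q^k/(1-Q^k)`, as half of a bilateral sum. -/
noncomputable def lamH (Q : ℝ) : ℝ := (∑' k : ℤ, (k : ℝ) ^ 1 * (sQ Q k - pos k)) / 2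

theorem rs_odd (h0 : 0 < Q) (h1 : Q < 1) (k : ℤ) :
    sQ Q (-k) - pos (-k) = - (sQ Q k - pos k) := by
  rcases lt_trichotomy k 0 with h | h | h
  · rw [sQ_neg h0 h1 (by omega), pos, pos, if_pos (by omega), if_neg (by omega)]; ring
  · subst h; simp [sQ, pos]
  · rw [sQ_neg h0 h1 (by omega), pos, pos, if_neg (by omega), if_pos (by omega)]; ring

theorem hasSum_s2 (h0 : 0 < Q) (h1 : Q < 1) (n : ℤ) :
    HasSum (fun k : ℤ => (k : ℝ) * (n - k) * (sQ Q k - sQ Q (k - n)))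
      (((n : ℝ) ^ 3 - n) / 6 + 4 * n * lamH Q) := by
  have hs1 := (summable_rs h0 h1 1).hasSum
  have hs2 := (summable_rs h0 h1 2).hasSum
  have hz : ∑' k : ℤ, (k : ℝ) ^ 2 * (sQ Q k - pos k) = 0 := by
    have h3 := (hasSum_refl hs2).neg
    have h4 : HasSum (fun k : ℤ => (k : ℝ) ^ 2 * (sQ Q k - pos k))
        (-∑' k : ℤ, (k : ℝ) ^ 2 * (sQ Q k - pos k)) := by
      refine hsc h3 (fun k => ?_) rfl
      rw [rs_odd h0 h1]; push_cast; ring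
    have := hs2.unique h4
    linarith
  rw [hz] at hs2
  have hl : ∑' k : ℤ, (k : ℝ) ^ 1 * (sQ Q k - pos k) = 2 * lamH Q := by unfold lamH; ring
  rw [hl] at hs1
  have hA := (hs1.mul_left (n : ℝ)).sub hs2
  have hB := hasSum_shift ((hs1.mul_left (n : ℝ)).add hs2) n
  refine hsc ((hA.add hB).add (hasSum_pos2 n)) (fun k => ?_) ?_
  · push_cast; ring
  · ring

theorem C2 (h0 : 0 < Q) (h1 : Q < 1) : ∃ c : ℝ, ∀ z : 𝕜, Q < ‖z‖ → ‖z‖ < 1 →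
    S Q 3 z = 6 * S Q 1 z ^ 2 + ((1 - 24 * lamH Q : ℝ) : 𝕜) * S Q 1 z + (c : 𝕜) := by
  have hA := adm_s h0 h1 1
  have hB := adm_s h0 h1 3
  set c0 : ℝ := ∑' k : ℤ, ((k : ℝ) ^ 1 * sQ Q k) * (((0 - k : ℤ) : ℝ) ^ 1 * sQ Q (0 - k)) with hc0
  refine ⟨-6 * c0, fun z hQr hr => ?_⟩
  have hc : ∀ n : ℤ, HasSum (fun k : ℤ => ((k : ℝ) ^ 1 * sQ Q k) * (((n - k : ℤ) : ℝ) ^ 1 * sQ Q (n - k)))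
      (((n : ℝ) ^ 3 * sQ Q n - (1 - 24 * lamH Q) * ((n : ℝ) ^ 1 * sQ Q n)) / 6
        + if n = 0 then c0 else 0) := by
    intro n
    by_cases hn : n = 0
    · subst hn
      have := (hA.summable_conv hA h0 h1 0).hasSum
      refine hsc this (fun k => rfl) ?_
      simp [hc0]
    · refine hsc ((hasSum_s2 h0 h1 n).mul_left (sQ Q n)) (fun k => ?_) ?_
      · by_cases hk : k = 0
        · subst hk; simp
        by_cases hnk : n - k = 0
        · have : (n : ℝ) - k = 0 := by exact_mod_cast hnk
          rw [hnk, this]; simp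
        · have := s_mul_s h0 h1 hn hk hnk
          calc _ = (k : ℝ) * (n - k) * (sQ Q k * sQ Q (n - k)) := by push_cast; ring
            _ = _ := by rw [this]; ring
      · simp [hn]; ring
  have h := conv_mul (𝕜 := 𝕜) h0 hA hA hc hQr hr
  have h' := (((hB.hasSum h0 hQr hr).sub ((hA.hasSum h0 hQr hr).mul_left
    ((1 - 24 * lamH Q : ℝ) : 𝕜))).mul_left (1 / 6 : 𝕜)).add (hasSum_ite_eq (0 : ℤ) (c0 : 𝕜))
  have h2 := h.unique (hsc h' (fun n => by
    by_cases hn : n = 0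
    · subst hn; simp
    · simp only [hn, if_false, add_zero]
      simp [map_ofNat]; ring) rfl)
  unfold S
  push_cast at h2 ⊢
  linear_combination (-6) * h2

theorem hasSum_odd (h0 : 0 < Q) (h1 : Q < 1) (n : ℤ) :
    HasSum (fun j : ℤ => sQ Q (2 * j + 1) - tQ Q (2 * j + 1 - n)) ((n : ℝ) / 2) := by
  have hinj : ∀ m : ℤ, Function.Injective (fun j : ℤ => 2 * j + 1 - m) := by
    intro m a b h; simp only at h; omega
  have hs := summable_rs h0 h1 0
  have ht := summable_rt h0 h1 0
  simp only [pow_zero, one_mul] at hs ht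
  have hs0 := hs.comp_injective (hinj 0)
  have ht1 : ∀ n, Summable (fun j : ℤ => tQ Q (2 * j + 1 - n) - pos (2 * j + 1 - n)) :=
    fun n => ht.comp_injective (hinj n)
  have hsum : Summable (fun j : ℤ => sQ Q (2 * j + 1) - tQ Q (2 * j + 1 - n)) := by
    have hp : Summable (fun j : ℤ => pos (2 * j + 1) - pos (2 * j + 1 - n)) := by
      have h3 := (hasSum_pos n).summable.comp_injective (hinj 0)
      refine h3.congr fun j => ?_
      simp [Function.comp]
    refine ((hs0.sub (ht1 n)).add hp).congr fun j => ?_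
    simp only [Function.comp, sub_zero]; ring
  have hdiff : HasSum (fun j : ℤ => tQ Q (2 * j + 1 + n) - tQ Q (2 * j + 1 - n)) (n : ℝ) := by
    have hA : ∀ n, ∑' j : ℤ, (tQ Q (2 * j + 1 - n) - pos (2 * j + 1 - n))
        = ∑' j : ℤ, (tQ Q (2 * j + 1 - (-n)) - pos (2 * j + 1 - (-n))) + (if Odd n then 0 else 0) := by
      intro n
      rw [← (Equiv.subRight (-n)).tsum_eq]
      simp only [Equiv.subRight_apply, ite_self, add_zero]
      congr 1; funext j
      congr 2 <;> ring
    have hB := ((ht1 (-n)).hasSum.sub (ht1 n).hasSum).add (hasSum_pos_odd n)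
    refine hsc hB (fun j => ?_) ?_
    · rw [sub_neg_eq_add]; ring
    · rw [hA n]; simp
  have hre : HasSum (fun j : ℤ => tQ Q (2 * j + 1 + n) - sQ Q (2 * j + 1))
      (∑' j : ℤ, (sQ Q (2 * j + 1) - tQ Q (2 * j + 1 - n))) := by
    have h3 := ((Equiv.subLeft (-1 : ℤ)).hasSum_iff).2 hsum.hasSum
    refine hsc h3 (fun j => ?_) rfl
    simp only [Function.comp, Equiv.subLeft_apply]
    rw [show 2 * (-1 - j) + 1 = -(2 * j + 1) by ring, show -(2 * j + 1) - n = -(2 * j + 1 + n) by ring,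
      sQ_neg h0 h1 (by omega), tQ_neg h0]
    ring
  have h5 := (hre.add hsum.hasSum).unique (hsc hdiff (fun j => by ring) rfl)
  have h6 : (∑' j : ℤ, (sQ Q (2 * j + 1) - tQ Q (2 * j + 1 - n))) = (n : ℝ) / 2 := by linarith
  rw [← h6]
  exact hsum.hasSum

/-- coefficients `2 s(k)` on odd `k` -/
noncomputable def oQ (Q : ℝ) (k : ℤ) : ℝ := if Odd k then 2 * sQ Q k else 0

theorem adm_o (h0 : 0 < Q) (h1 : Q < 1) : Adm Q (fun n => (n : ℝ) ^ 0 * oQ Q n) := by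
  have hC : 0 ≤ 1 / (1 - Q) := by apply one_div_nonneg.2; linarith
  refine adm_of _ (2 * (1 / (1 - Q))) (by positivity) (fun n => ?_) (fun n => ?_) h0 0
  · have := sQ_bound h0 h1 n
    unfold oQ
    split_ifs
    · rw [abs_mul, abs_two]; linarith
    · simp only [abs_zero]; positivity
  · have := sQ_bound_neg h0 h1 n
    unfold oQ
    split_ifs
    · rw [abs_mul, abs_two]; linarith
    · simp only [abs_zero]; positivity

theorem C4 (h0 : 0 < Q) {z : 𝕜} (hQr : Q < ‖z‖) (hr : ‖z‖ < 1) :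
    T Q 1 z = bil (fun n => (n : ℝ) ^ 0 * oQ Q n) z * T Q 0 z := by
  have h1 : Q < 1 := hQr.trans hr
  have hinj : Function.Injective (fun j : ℤ => 2 * j + 1) := by
    intro a b h; simp only at h; omega
  have hc : ∀ n : ℤ, HasSum (fun k : ℤ => ((k : ℝ) ^ 0 * oQ Q k) * (((n - k : ℤ) : ℝ) ^ 0 * tQ Q (n - k)))
      ((n : ℝ) ^ 1 * tQ Q n) := by
    intro n
    have h3 := (hasSum_odd h0 h1 n).mul_left (2 * tQ Q n)
    have h4 : HasSum ((fun k : ℤ => ((k : ℝ) ^ 0 * oQ Q k) * (((n - k : ℤ) : ℝ) ^ 0 * tQ Q (n - k)))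
      ∘ (fun j : ℤ => 2 * j + 1)) ((n : ℝ) ^ 1 * tQ Q n) := by
      refine hsc h3 (fun j => ?_) (by ring)
      simp only [Function.comp, pow_zero, one_mul]
      rw [oQ, if_pos ⟨j, rfl⟩, mul_assoc, s_mul_t h0 h1 n (by omega)]
      ring
    refine (hinj.hasSum_iff ?_).1 h4
    intro k hk
    have : ¬ Odd k := by
      rintro ⟨j, rfl⟩; exact hk ⟨j, rfl⟩
    simp [oQ, this]
  have h := conv_mul (𝕜 := 𝕜) h0 (adm_o h0 h1) (adm_t h0 h1 0) hc hQr hr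
  exact (adm_t h0 h1 1).hasSum h0 hQr hr |>.unique h

end RF5

namespace RF5
variable {q : ℝ}

theorem hasSum_even_iff {α : Type*} [AddCommMonoid α] [TopologicalSpace α] {f : ℤ → α} {a : α}
    (hf : ∀ k, Odd k → f k = 0) : HasSum (fun j => f (2 * j)) a ↔ HasSum f a := by
  have hinj : Function.Injective (fun j : ℤ => 2 * j) := by
    intro a b h; simp only at h; omega
  refine hinj.hasSum_iff (f := f) ?_
  intro k hk
  apply hf
  rcases Int.even_or_odd' k with ⟨m, rfl | rfl⟩
  · exact absurd ⟨m, rfl⟩ hk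
  · exact ⟨m, rfl⟩

theorem hasSum_odd_iff {α : Type*} [AddCommMonoid α] [TopologicalSpace α] {f : ℤ → α} {a : α}
    (hf : ∀ k, Even k → f k = 0) : HasSum (fun j => f (2 * j + 1)) a ↔ HasSum f a := by
  have hinj : Function.Injective (fun j : ℤ => 2 * j + 1) := by
    intro a b h; simp only at h; omega
  refine hinj.hasSum_iff (f := f) ?_
  intro k hk
  apply hf
  rcases Int.even_or_odd' k with ⟨m, rfl | rfl⟩
  · exact even_two_mul m
  · exact absurd ⟨m, rfl⟩ hk

/-- theta function -/
noncomputable def th (x : ℝ) : ℝ := ∑' n : ℤ, x ^ (n ^ 2)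

/-- odd part of theta -/
noncomputable def tb (x : ℝ) : ℝ := ∑' n : ℤ, x ^ ((2 * n + 1) ^ 2)

theorem hasSum_w (h0 : 0 < q) (h1 : q < 1) : HasSum (fun n : ℤ => q ^ n.natAbs) ((1 + q) / (1 - q)) := by
  have h := hasSum_geometric_of_lt_one h0.le h1
  have h2 := h.mul_left q
  have h3 := HasSum.of_nat_of_neg_add_one (f := fun n : ℤ => q ^ n.natAbs) (m := (1 - q)⁻¹)
    (m' := q * (1 - q)⁻¹) (hsc h (fun k => by simp) rfl) (hsc h2 (fun k => by
      rw [show (-((k : ℤ) + 1)).natAbs = k + 1 by omega, pow_succ, mul_comm]) rfl)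
  refine hsc h3 (fun _ => rfl) ?_
  have : 1 - q ≠ 0 := by linarith
  field_simp

theorem abs_zpow_sq_le {x : ℝ} (h0 : 0 < |x|) (h1 : |x| < 1) (n : ℤ) : |x ^ (n ^ 2)| ≤ |x| ^ n.natAbs := by
  rw [abs_zpow]
  have : (n ^ 2 : ℤ) = ((n.natAbs ^ 2 : ℕ) : ℤ) := by simp
  rw [this, zpow_natCast]
  apply pow_le_pow_of_le_one h0.le h1.le
  rw [pow_two]; exact Nat.le_mul_self _

theorem th_summable {x : ℝ} (h0 : 0 < |x|) (h1 : |x| < 1) : Summable (fun n : ℤ => ‖x ^ (n ^ 2)‖) :=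
  Summable.of_nonneg_of_le (fun _ => norm_nonneg _) (fun n => abs_zpow_sq_le h0 h1 n)
    (hasSum_w h0 h1).summable

theorem th_hasSum {x : ℝ} (h0 : 0 < |x|) (h1 : |x| < 1) : HasSum (fun n : ℤ => x ^ (n ^ 2)) (th x) :=
  (th_summable h0 h1).of_norm.hasSum

theorem th_ge (h0 : 0 < q) (h1 : q < 1) : 1 ≤ th q := by
  have h := th_hasSum (x := q) (by rwa [abs_of_pos h0]) (by rwa [abs_of_pos h0])
  have := le_hasSum h 0 (fun j _ => by positivity)
  simpa using this

theorem th_le (h0 : 0 < q) (h1 : q < 1) : th q ≤ (1 + q) / (1 - q) := by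
  have h := th_hasSum (x := q) (by rwa [abs_of_pos h0]) (by rwa [abs_of_pos h0])
  refine hasSum_le (fun n => ?_) h (hasSum_w h0 h1)
  have := abs_zpow_sq_le (x := q) (by rwa [abs_of_pos h0]) (by rwa [abs_of_pos h0]) n
  rw [abs_of_pos h0] at this
  exact (le_abs_self _).trans this

theorem tb_summable (h0 : 0 < q) (h1 : q < 1) : Summable (fun n : ℤ => q ^ ((2 * n + 1) ^ 2)) := by
  have hinj : Function.Injective (fun j : ℤ => 2 * j + 1) := by
    intro a b h; simp only at h; omega
  exact (th_hasSum (x := q) (by rwa [abs_of_pos h0]) (by rwa [abs_of_pos h0])).summable.comp_injective hinj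

theorem tb_hasSum (h0 : 0 < q) (h1 : q < 1) : HasSum (fun n : ℤ => q ^ ((2 * n + 1) ^ 2)) (tb q) :=
  (tb_summable h0 h1).hasSum

theorem neg_zpow_sq (x : ℝ) (n : ℤ) : (-x) ^ (n ^ 2) = (-1) ^ n * x ^ (n ^ 2) := by
  rw [neg_eq_neg_one_mul, mul_zpow]
  congr 1
  rcases Int.even_or_odd n with h | h
  · rw [h.neg_one_zpow, (h.pow_of_ne_zero two_ne_zero).neg_one_zpow]
  · rw [h.neg_one_zpow, h.pow.neg_one_zpow]

theorem th_neg_hasSum (h0 : 0 < q) (h1 : q < 1) :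
    HasSum (fun n : ℤ => (-1 : ℝ) ^ n * q ^ (n ^ 2)) (th (-q)) := by
  have h := th_hasSum (x := -q) (by rwa [abs_neg, abs_of_pos h0]) (by rwa [abs_neg, abs_of_pos h0])
  exact hsc h (fun n => (neg_zpow_sq q n).symm) rfl

theorem th_pos_hasSum (h0 : 0 < q) (h1 : q < 1) :
    HasSum (fun n : ℤ => q ^ (n ^ 2)) (th q) :=
  th_hasSum (x := q) (by rwa [abs_of_pos h0]) (by rwa [abs_of_pos h0])

theorem th_split (h0 : 0 < q) (h1 : q < 1) : th q = th (q ^ 4) + tb q ∧ th (-q) = th (q ^ 4) - tb q := by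
  have h4 := th_pos_hasSum (q := q ^ 4) (by positivity) (pow_lt_one₀ h0.le h1 (by norm_num))
  have hE : HasSum (fun n : ℤ => if Even n then q ^ (n ^ 2) else 0) (th (q ^ 4)) := by
    rw [← hasSum_even_iff]
    · refine hsc h4 (fun j => ?_) rfl
      rw [if_pos (even_two_mul j), ← zpow_natCast, ← zpow_mul]
      congr 1; push_cast; ring
    · intro k hk
      rw [if_neg (Int.not_even_iff_odd.2 hk)]
  have hO : HasSum (fun n : ℤ => if Odd n then q ^ (n ^ 2) else 0) (tb q) := by
    rw [← hasSum_odd_iff]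
    · refine hsc (tb_hasSum h0 h1) (fun j => ?_) rfl
      rw [if_pos ⟨j, rfl⟩]
    · intro k hk
      rw [if_neg (Int.not_odd_iff_even.2 hk)]
  constructor
  · refine (th_pos_hasSum h0 h1).unique (hsc (hE.add hO) (fun n => ?_) rfl)
    rcases Int.even_or_odd n with h | h
    · rw [if_pos h, if_neg (Int.not_odd_iff_even.2 h), add_zero]
    · rw [if_pos h, if_neg (Int.not_even_iff_odd.2 h), zero_add]
  · refine (th_neg_hasSum h0 h1).unique (hsc (hE.sub hO) (fun n => ?_) rfl)
    rcases Int.even_or_odd n with h | h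
    · rw [if_pos h, if_neg (Int.not_odd_iff_even.2 h), h.neg_one_zpow]; ring
    · rw [if_pos h, if_neg (Int.not_even_iff_odd.2 h), h.neg_one_zpow]; ring

theorem hasSum_diag {f : ℤ × ℤ → ℝ} {a : ℝ}
    (hf : ∀ x, Odd (x.1 + x.2) → f x = 0) : HasSum (fun x : ℤ × ℤ => f (x.1 + x.2, x.1 - x.2)) a ↔ HasSum f a := by
  have hinj : Function.Injective (fun x : ℤ × ℤ => (x.1 + x.2, x.1 - x.2)) := by
    intro a b h
    simp only [Prod.mk.injEq] at h
    ext <;> omega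
  refine hinj.hasSum_iff (f := f) ?_
  intro x hx
  apply hf
  by_contra hne
  rw [Int.not_odd_iff_even] at hne
  obtain ⟨m, hm⟩ := hne
  exact hx ⟨(m, x.1 - m), by ext <;> simp only <;> omega⟩

theorem th_sq (h0 : 0 < q) (h1 : q < 1) : th q ^ 2 + th (-q) ^ 2 = 2 * th (q ^ 2) ^ 2 := by
  have hp := th_pos_hasSum h0 h1
  have hn := th_neg_hasSum h0 h1
  have h2 := th_pos_hasSum (q := q ^ 2) (by positivity) (pow_lt_one₀ h0.le h1 (by norm_num))
  have hpp := hasSum_mul_norm hp.summable.norm hp.summable.norm hp hp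
  have hnn := hasSum_mul_norm hn.summable.norm hn.summable.norm hn hn
  have h22 := hasSum_mul_norm h2.summable.norm h2.summable.norm h2 h2
  have hs := hpp.add hnn
  have hd : HasSum (fun x : ℤ × ℤ => (1 + (-1 : ℝ) ^ (x.1 + x.2)) * q ^ (x.1 ^ 2 + x.2 ^ 2))
      (th q * th q + th (-q) * th (-q)) := by
    refine hsc hs (fun x => ?_) rfl
    rw [zpow_add₀ (by norm_num), zpow_add₀ h0.ne']; ring
  rw [← hasSum_diag] at hd
  · rw [pow_two, pow_two, pow_two (th (q ^ 2))]
    refine hd.unique (hsc (h22.mul_left 2) (fun x => ?_) rfl)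
    simp only
    rw [← zpow_natCast, ← zpow_mul, ← zpow_mul, ← zpow_add₀ h0.ne',
      show x.1 + x.2 + (x.1 - x.2) = 2 * x.1 by ring, (even_two_mul x.1).neg_one_zpow]
    rw [show (x.1 + x.2) ^ 2 + (x.1 - x.2) ^ 2 = (2 : ℕ) * x.1 ^ 2 + (2 : ℕ) * x.2 ^ 2 by push_cast; ring]
    ring
  · intro x hx
    rw [hx.neg_one_zpow]; ring

theorem th_mul_neg (h0 : 0 < q) (h1 : q < 1) : th q * th (-q) = th (-q ^ 2) ^ 2 := by
  have hp := th_pos_hasSum h0 h1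
  have hn := th_neg_hasSum h0 h1
  have h2 := th_neg_hasSum (q := q ^ 2) (by positivity) (pow_lt_one₀ h0.le h1 (by norm_num))
  have hpn := hasSum_mul_norm hp.summable.norm hn.summable.norm hp hn
  have hnp := hasSum_mul_norm hn.summable.norm hp.summable.norm hn hp
  have h22 := hasSum_mul_norm h2.summable.norm h2.summable.norm h2 h2
  have hs := hpn.add hnp
  have hd : HasSum (fun x : ℤ × ℤ => ((-1 : ℝ) ^ x.1 + (-1 : ℝ) ^ x.2) * q ^ (x.1 ^ 2 + x.2 ^ 2))
      (th q * th (-q) + th (-q) * th q) := by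
    refine hsc hs (fun x => ?_) rfl
    rw [zpow_add₀ h0.ne']; ring
  rw [← hasSum_diag] at hd
  · have := hd.unique (hsc (h22.mul_left 2) (fun x => ?_) rfl)
    · linarith
    simp only
    rw [← zpow_natCast, ← zpow_mul, ← zpow_mul]
    have e1 : (-1 : ℝ) ^ (x.1 - x.2) = (-1) ^ x.1 * (-1) ^ x.2 := by
      rw [zpow_sub₀ (by norm_num), div_eq_mul_inv, ← inv_zpow, inv_neg_one]
    rw [show (x.1 + x.2) ^ 2 + (x.1 - x.2) ^ 2 = (2 : ℕ) * x.1 ^ 2 + (2 : ℕ) * x.2 ^ 2 by push_cast; ring,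
      e1, zpow_add₀ (by norm_num), zpow_add₀ h0.ne']
    ring
  · intro x hx
    rcases Int.even_or_odd x.1 with h | h
    · have : Odd x.2 := by
        rcases Int.even_or_odd x.2 with h' | h'
        · exact absurd hx (Int.not_odd_iff_even.2 (h.add h'))
        · exact h'
      rw [h.neg_one_zpow, this.neg_one_zpow]; ring
    · have : Even x.2 := by
        rcases Int.even_or_odd x.2 with h' | h'
        · exact h'
        · exact absurd hx (Int.not_odd_iff_even.2 (h.add_odd h'))
      rw [h.neg_one_zpow, this.neg_one_zpow]; ring

/-- kernel `(-1)^k R^(k²-k)` -/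
noncomputable def fR (R : ℝ) (k : ℤ) : ℝ := (-1) ^ k * R ^ (k ^ 2 - k)

theorem fR_abs {R : ℝ} (h0 : 0 < R) (k : ℤ) : |fR R k| = R ^ (k ^ 2 - k) := by
  rw [fR, abs_mul, abs_zpow, abs_neg, abs_one, one_zpow, one_mul, abs_of_pos (by positivity)]

theorem adm_f {R : ℝ} (h0 : 0 < R) (h1 : R < 1) : Adm (R ^ 2) (fun n => (n : ℝ) ^ 0 * fR R n) := by
  refine adm_of _ 1 zero_le_one (fun n => ?_) (fun n => ?_) (by positivity) 0
  · rw [fR_abs h0]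
    have : (0 : ℤ) ≤ (n : ℤ) ^ 2 - n := by nlinarith [sq_nonneg ((n : ℤ)), Int.le_self_sq (n:ℤ)]
    simpa using zpow_le_zpow_right_of_le_one₀ h0 h1.le this
  · rw [fR_abs h0, one_mul, ← pow_mul, ← zpow_natCast]
    apply zpow_le_zpow_right_of_le_one₀ h0 h1.le
    push_cast
    nlinarith [Int.le_self_sq (n:ℤ)]

end RF5

namespace RF5
variable {q : ℝ}

theorem fR_step {R : ℝ} (h0 : 0 < R) (n k : ℤ) :
    R ^ (2 * n - 2) * fR R (k - 1) = - fR R k * (R ^ 2) ^ (n - k) := by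
  unfold fR
  rw [zpow_sub_one₀ (by norm_num), ← zpow_natCast, ← zpow_mul]
  have : R ^ (2 * n - 2) * R ^ ((k - 1) ^ 2 - (k - 1)) = R ^ (k ^ 2 - k) * R ^ (((2 : ℕ) : ℤ) * (n - k)) := by
    rw [← zpow_add₀ h0.ne', ← zpow_add₀ h0.ne']; congr 1; push_cast; ring
  calc _ = - (-1) ^ k * (R ^ (2 * n - 2) * R ^ ((k - 1) ^ 2 - (k - 1))) := by
        rw [inv_neg_one]; ring
    _ = _ := by rw [this]; ring

theorem fR_anti {R : ℝ} (k : ℤ) : fR R (1 - k) = - fR R k := by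
  unfold fR
  rw [show (1 - k) ^ 2 - (1 - k) = k ^ 2 - k by ring, zpow_sub₀ (by norm_num), zpow_one,
    div_eq_mul_inv, ← inv_zpow, inv_neg_one]
  ring

theorem pow_mul_tQ {Q : ℝ} (h0 : 0 < Q) (n : ℤ) : Q ^ n * tQ Q n = 1 - tQ Q n := by
  have := one_add_ne h0 n
  unfold tQ
  field_simp
  ring

/-- convolution coefficients of `f` and `t` -/
noncomputable def cR (R : ℝ) (n : ℤ) : ℝ := ∑' k : ℤ, fR R k * tQ (R ^ 2) (n - k)

theorem cR_hasSum {R : ℝ} (h0 : 0 < R) (h1 : R < 1) (n : ℤ) :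
    HasSum (fun k : ℤ => fR R k * tQ (R ^ 2) (n - k)) (cR R n) := by
  have hQ0 : 0 < R ^ 2 := by positivity
  have hQ1 : R ^ 2 < 1 := pow_lt_one₀ h0.le h1 (by norm_num)
  have := (adm_f h0 h1).summable_conv (adm_t hQ0 hQ1 0) hQ0 hQ1 n
  simp only [pow_zero, one_mul] at this
  exact this.hasSum

theorem cR_step {R : ℝ} (h0 : 0 < R) (h1 : R < 1) (n : ℤ) : cR R n = R ^ (2 * n - 2) * cR R (n - 1) := by
  have hQ0 : 0 < R ^ 2 := by positivity
  have hA := cR_hasSum h0 h1 n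
  have hB := ((hasSum_shift (cR_hasSum h0 h1 (n - 1)) 1).mul_left (R ^ (2 * n - 2)))
  have hC : HasSum (fun k => fR R k) (cR R n - R ^ (2 * n - 2) * cR R (n - 1)) := by
    refine hsc (hA.sub hB) (fun k => ?_) rfl
    rw [← mul_assoc, fR_step h0, show n - 1 - (k - 1) = n - k by ring, mul_assoc, pow_mul_tQ hQ0]
    ring
  have hD : HasSum (fun k => fR R k) (-(cR R n - R ^ (2 * n - 2) * cR R (n - 1))) := by
    refine hsc ((Equiv.subLeft (1 : ℤ)).hasSum_iff.2 hC).neg (fun k => ?_) rfl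
    simp only [Function.comp, Equiv.subLeft_apply, fR_anti]; ring
  have := hC.unique hD
  linarith

theorem cR_eq {R : ℝ} (h0 : 0 < R) (h1 : R < 1) (n : ℤ) : cR R n = cR R 0 * R ^ (n ^ 2 - n) := by
  induction n using Int.induction_on with
  | zero => simp
  | succ i ih =>
    rw [cR_step h0 h1, show (i : ℤ) + 1 - 1 = i by ring, ih, mul_comm, mul_assoc, ← zpow_add₀ h0.ne']
    congr 2; ring
  | pred i ih =>
    have h := cR_step h0 h1 (-(i : ℤ))
    rw [ih] at h
    have hz : R ^ (2 * (-(i : ℤ)) - 2) ≠ 0 := by positivity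
    apply mul_left_cancel₀ hz
    rw [← h, mul_left_comm, ← zpow_add₀ h0.ne']
    congr 2; ring

theorem C3 {R : ℝ} (h0 : 0 < R) (h1 : R < 1) {z : ℝ} (hz : |z| = R) :
    HasSum (fun n : ℤ => cR R 0 * (R ^ (n ^ 2 - n) * z ^ n))
     (bil (fun n => (n : ℝ) ^ 0 * fR R n) z * T (R ^ 2) 0 z) := by
  have hQ0 : 0 < R ^ 2 := by positivity
  have hQ1 : R ^ 2 < 1 := pow_lt_one₀ h0.le h1 (by norm_num)
  have hn : ‖z‖ = R := hz
  have hc : ∀ n : ℤ, HasSum (fun k : ℤ => ((k : ℝ) ^ 0 * fR R k) * (((n - k : ℤ) : ℝ) ^ 0 * tQ (R ^ 2) (n - k)))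
      (cR R n) := by
    intro n
    simpa using cR_hasSum h0 h1 n
  have := conv_mul (𝕜 := ℝ) hQ0 (adm_f h0 h1) (adm_t hQ0 hQ1 0) hc (z := z)
    (by rw [hn]; nlinarith) (by rw [hn]; exact h1)
  refine hsc this (fun n => ?_) rfl
  rw [cR_eq h0 h1 n]; simp only [RCLike.ofReal_real_eq_id, id]; ring

theorem bil_f_pos {R : ℝ} (h0 : 0 < R) : bil (fun n => (n : ℝ) ^ 0 * fR R n) R = th (-R) := by
  unfold bil th
  congr 1; funext n
  rw [neg_zpow_sq]
  simp only [pow_zero, one_mul, fR, RCLike.ofReal_real_eq_id, id]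
  rw [mul_assoc, ← zpow_add₀ h0.ne']; congr 2; ring

theorem bil_f_neg {R : ℝ} (h0 : 0 < R) : bil (fun n => (n : ℝ) ^ 0 * fR R n) (-R) = th R := by
  unfold bil th
  congr 1; funext n
  simp only [pow_zero, one_mul, fR, RCLike.ofReal_real_eq_id, id]
  rw [neg_eq_neg_one_mul R, mul_zpow]
  calc _ = ((-1) ^ n * (-1) ^ n) * (R ^ (n ^ 2 - n) * R ^ n) := by ring
    _ = _ := by
      rw [← mul_zpow, ← zpow_add₀ h0.ne']; norm_num

theorem C3pos {R : ℝ} (h0 : 0 < R) (h1 : R < 1) : th (-R) * T (R ^ 2) 0 R = cR R 0 * th R := by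
  have h := C3 h0 h1 (z := R) (abs_of_pos h0)
  rw [bil_f_pos h0] at h
  refine h.unique (hsc ((th_pos_hasSum h0 h1).mul_left (cR R 0)) (fun n => ?_) rfl)
  rw [← zpow_add₀ h0.ne']; congr 2; ring

theorem C3neg {R : ℝ} (h0 : 0 < R) (h1 : R < 1) : th R * T (R ^ 2) 0 (-R) = cR R 0 * th (-R) := by
  have h := C3 h0 h1 (z := -R) (by rw [abs_neg, abs_of_pos h0])
  rw [bil_f_neg h0] at h
  refine h.unique (hsc ((th_neg_hasSum h0 h1).mul_left (cR R 0)) (fun n => ?_) rfl)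
  rw [neg_eq_neg_one_mul, mul_zpow]
  rw [mul_left_comm (R ^ (n ^ 2 - n)) _ _, ← zpow_add₀ h0.ne']; congr 3; ring

theorem T_hasSum {Q : ℝ} (h0 : 0 < Q) (p : ℕ) {z : ℝ} (hz : Q < |z|) (hz1 : |z| < 1) :
    HasSum (fun n : ℤ => (n : ℝ) ^ p * tQ Q n * z ^ n) (T Q p z) := by
  have := (adm_t h0 (hz.trans hz1) p).hasSum (𝕜 := ℝ) h0 hz hz1
  unfold T; simpa using this

theorem S_hasSum {Q : ℝ} (h0 : 0 < Q) (p : ℕ) {z : ℝ} (hz : Q < |z|) (hz1 : |z| < 1) :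
    HasSum (fun n : ℤ => (n : ℝ) ^ p * sQ Q n * z ^ n) (S Q p z) := by
  have := (adm_s h0 (hz.trans hz1) p).hasSum (𝕜 := ℝ) h0 hz hz1
  unfold S; simpa using this

theorem F_double (h0 : 0 < q) (h1 : q < 1) :
    T (q ^ 2) 0 q + T (q ^ 2) 0 (-q) = 2 * T ((q ^ 2) ^ 2) 0 (q ^ 2) := by
  have hq2 : q ^ 2 < q := by nlinarith
  have hA := T_hasSum (Q := q ^ 2) (by positivity) 0 (z := q) (by rwa [abs_of_pos h0]) (by rwa [abs_of_pos h0])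
  have hB := T_hasSum (Q := q ^ 2) (by positivity) 0 (z := -q) (by rwa [abs_neg, abs_of_pos h0])
    (by rwa [abs_neg, abs_of_pos h0])
  have hC := T_hasSum (Q := (q ^ 2) ^ 2) (by positivity) 0 (z := q ^ 2)
    (by rw [abs_of_pos (by positivity)]; nlinarith [pow_pos h0 2, pow_lt_one₀ h0.le h1 (n := 2) (by norm_num)])
    (by rw [abs_of_pos (by positivity)]; exact pow_lt_one₀ h0.le h1 (by norm_num))
  have h := hA.add hB
  rw [← hasSum_even_iff] at h
  · refine h.unique (hsc (hC.mul_left 2) (fun n => ?_) rfl)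
    rw [(even_two_mul n).neg_zpow]
    simp only [pow_zero, one_mul, tQ]
    rw [show (q ^ 2) ^ (2 * n) = ((q ^ 2) ^ 2) ^ n by rw [← zpow_natCast (q ^ 2) 2, ← zpow_mul]; norm_num,
      show q ^ (2 * n) = (q ^ 2) ^ n by rw [← zpow_natCast q 2, ← zpow_mul]; norm_num]
    ring
  · intro k hk
    rw [hk.neg_zpow]; ring

theorem F_term (h0 : 0 < q) (h1 : q < 1) (n : ℤ) : tQ (q ^ 2) n * q ^ n ≤ q ^ n.natAbs := by
  have hx : 0 < q ^ n := by positivity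
  have e : (q ^ 2) ^ n = (q ^ n) ^ 2 := by rw [← zpow_natCast, ← zpow_natCast, ← zpow_mul, ← zpow_mul, mul_comm]
  unfold tQ
  rw [e, one_div_mul_eq_div, div_le_iff₀ (by positivity)]
  rcases le_total 0 n with h | h
  · have : q ^ n = q ^ n.natAbs := by
      rw [← zpow_natCast]; congr 1; omega
    rw [← this]
    nlinarith [pow_pos hx 3]
  · have : q ^ n * q ^ n.natAbs = 1 := by
      rw [← zpow_natCast, ← zpow_add₀ h0.ne']
      rw [show n + (n.natAbs : ℤ) = 0 by omega, zpow_zero]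
    have h3 : 0 < q ^ n.natAbs := by positivity
    nlinarith [sq_nonneg (q ^ n)]

theorem F_bounds (h0 : 0 < q) (h1 : q < 1) :
    1 ≤ 2 * T (q ^ 2) 0 q ∧ 2 * T (q ^ 2) 0 q ≤ 2 * ((1 + q) / (1 - q)) - 1 := by
  have hq2 : q ^ 2 < q := by nlinarith
  have hA := T_hasSum (Q := q ^ 2) (by positivity) 0 (z := q) (by rwa [abs_of_pos h0]) (by rwa [abs_of_pos h0])
  constructor
  · have := le_hasSum hA 0 (fun j _ => by unfold tQ; positivity)
    simp [tQ] at this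
    linarith
  · have hw := (hasSum_w h0 h1).sub (hasSum_ite_eq (0 : ℤ) (1 / 2 : ℝ))
    have := hasSum_le (fun n => ?_) hA hw
    · linarith
    by_cases hn : n = 0
    · subst hn; simp [tQ]; norm_num
    · simp only [hn, if_false, sub_zero, pow_zero, one_mul]
      exact F_term h0 h1 n

theorem tendsto_q (h0 : 0 < q) (h1 : q < 1) :
    Filter.Tendsto (fun k : ℕ => q ^ (2 ^ k)) Filter.atTop (nhds 0) :=
  (tendsto_pow_atTop_nhds_zero_of_lt_one h0.le h1).comp
    (tendsto_pow_atTop_atTop_of_one_lt (by norm_num))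

theorem tendsto_w (h0 : 0 < q) (h1 : q < 1) :
    Filter.Tendsto (fun k : ℕ => (1 + q ^ (2 ^ k)) / (1 - q ^ (2 ^ k))) Filter.atTop (nhds 1) := by
  have h := tendsto_q h0 h1
  have h2 := ((h.const_add 1).div (h.const_sub 1) (by norm_num))
  simp only [add_zero, sub_zero, div_one] at h2
  exact h2

theorem qk_lt (h0 : 0 < q) (h1 : q < 1) (k : ℕ) : q ^ (2 ^ k) < 1 :=
  pow_lt_one₀ h0.le h1 (by positivity)

theorem th_neg_ge (h0 : 0 < q) (h1 : q < 1) : 2 - (1 + q) / (1 - q) ≤ th (-q) := by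
  have hw := (hasSum_ite_eq (0 : ℤ) (2 : ℝ)).sub (hasSum_w h0 h1)
  refine hasSum_le (fun n => ?_) hw (th_neg_hasSum h0 h1)
  by_cases hn : n = 0
  · subst hn; simp; norm_num
  · simp only [hn, if_false, zero_sub]
    have := abs_zpow_sq_le (x := -q) (by rwa [abs_neg, abs_of_pos h0]) (by rwa [abs_neg, abs_of_pos h0]) n
    rw [abs_neg, abs_of_pos h0, neg_zpow_sq] at this
    exact (abs_le.1 this).1

theorem th_neg_ne (h0 : 0 < q) (h1 : q < 1) : th (-q) ≠ 0 := by
  intro h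
  have hk : ∀ k : ℕ, th (-q ^ (2 ^ k)) = 0 := by
    intro k
    induction k with
    | zero => simpa using h
    | succ k ih =>
      have := th_mul_neg (q := q ^ (2 ^ k)) (by positivity) (qk_lt h0 h1 k)
      rw [ih, mul_zero, ← pow_mul, ← pow_succ] at this
      exact pow_eq_zero_iff (two_ne_zero) |>.1 this.symm
  obtain ⟨k, hk2⟩ := ((tendsto_w h0 h1).eventually (gt_mem_nhds (show (1 : ℝ) < 2 by norm_num))).exists
  have := th_neg_ge (q := q ^ (2 ^ k)) (by positivity) (qk_lt h0 h1 k)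
  rw [hk] at this
  linarith

/-- the ratio, constant one -/
noncomputable def rat (q : ℝ) : ℝ := 2 * T (q ^ 2) 0 q / th q ^ 2

theorem rat_step (h0 : 0 < q) (h1 : q < 1) : rat (q ^ 2) = rat q := by
  have h2 := C3pos h0 h1
  have h3 := C3neg h0 h1
  have h4 : th q ≠ 0 := by have := th_ge h0 h1; linarith
  have h4' : th (q ^ 2) ≠ 0 := by
    have := th_ge (q := q ^ 2) (by positivity) (pow_lt_one₀ h0.le h1 (by norm_num)); linarith
  have h5 := th_neg_ne h0 h1
  have hd := F_double h0 h1
  have hs := th_sq h0 h1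
  unfold rat
  rw [div_eq_div_iff (by positivity) (by positivity)]
  apply mul_left_cancel₀ h5
  apply mul_left_cancel₀ h4
  linear_combination (-th q * th (-q) * th q ^ 2) * hd + th q ^ 3 * h2 + th (-q) * th q ^ 2 * h3
    - 2 * th (q ^ 2) ^ 2 * th q * h2 + (cR q 0 * th q ^ 2) * hs

theorem rat_eq (h0 : 0 < q) (h1 : q < 1) : rat q = 1 := by
  have hk : ∀ k : ℕ, rat (q ^ (2 ^ k)) = rat q := by
    intro k
    induction k with
    | zero => simp
    | succ k ih =>
      rw [pow_succ, pow_mul, rat_step (by positivity) (qk_lt h0 h1 k), ih]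
  have hw := tendsto_w h0 h1
  have hup : ∀ k : ℕ, rat q ≤ 2 * ((1 + q ^ (2 ^ k)) / (1 - q ^ (2 ^ k))) - 1 := by
    intro k
    rw [← hk k]
    have hq := qk_lt h0 h1 k
    have hb := F_bounds (q := q ^ (2 ^ k)) (by positivity) hq
    have ht := th_ge (q := q ^ (2 ^ k)) (by positivity) hq
    unfold rat
    refine (div_le_self (by linarith) ?_).trans hb.2
    nlinarith
  have hlo : ∀ k : ℕ, 1 / ((1 + q ^ (2 ^ k)) / (1 - q ^ (2 ^ k))) ^ 2 ≤ rat q := by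
    intro k
    rw [← hk k]
    have hq := qk_lt h0 h1 k
    have hb := F_bounds (q := q ^ (2 ^ k)) (by positivity) hq
    have ht := th_ge (q := q ^ (2 ^ k)) (by positivity) hq
    have ht' := th_le (q := q ^ (2 ^ k)) (by positivity) hq
    unfold rat
    apply div_le_div₀ (by linarith) hb.1 (by positivity)
    gcongr
  apply le_antisymm
  · have := ge_of_tendsto' ((hw.const_mul 2).sub_const 1) hup
    linarith
  · have := le_of_tendsto' ((tendsto_const_nhds (x := (1 : ℝ))).div (hw.pow 2) (by norm_num)) hlo
    simpa using this

/-- two squares -/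
theorem two_sq (h0 : 0 < q) (h1 : q < 1) : 2 * T (q ^ 2) 0 q = th q ^ 2 := by
  have h := rat_eq h0 h1
  have h4 : th q ≠ 0 := by have := th_ge h0 h1; linarith
  unfold rat at h
  rwa [div_eq_one_iff_eq (by positivity)] at h

theorem two_sq_neg (h0 : 0 < q) (h1 : q < 1) : 2 * T (q ^ 2) 0 (-q) = th (-q) ^ 2 := by
  have h2 := C3pos h0 h1
  have h3 := C3neg h0 h1
  have h := two_sq h0 h1
  have h4 : th q ≠ 0 := by have := th_ge h0 h1; linarith
  apply mul_left_cancel₀ h4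
  apply mul_left_cancel₀ h4
  linear_combination 2 * th q * h3 - 2 * th (-q) * h2 + th (-q) ^ 2 * h

end RF5

namespace RF5
variable {q : ℝ}

theorem lambert_summable (h0 : 0 < q) (h1 : q < 1) {α β : ℕ → ℝ} {p : ℕ}
    (hα : ∀ n, |α n| ≤ (n : ℝ) ^ p) (hβ : ∀ n, |β n| ≤ (n : ℝ) ^ p) :
    Summable (fun x : ℕ × ℕ => α (x.1 + 1) * β (x.2 + 1) * q ^ ((x.1 + 1) * (x.2 + 1))) := by
  have hs : Summable (fun n : ℕ => ((n + 1 : ℕ) : ℝ) ^ p * q ^ n) := by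
    have h := summable_pow_mul_geometric_of_norm_lt_one p (r := q) (by rwa [Real.norm_of_nonneg h0.le])
    have h2 := ((summable_nat_add_iff 1).2 h).mul_left q⁻¹
    refine h2.congr fun n => ?_
    rw [pow_succ]; field_simp
  have hm := summable_mul_of_summable_norm hs.norm hs.norm
  refine Summable.of_norm_bounded hm fun x => ?_
  rw [norm_mul, norm_mul, Real.norm_eq_abs, Real.norm_eq_abs, Real.norm_of_nonneg (by positivity)]
  have hq : q ^ ((x.1 + 1) * (x.2 + 1)) ≤ q ^ (x.1 + x.2) := by
    apply pow_le_pow_of_le_one h0.le h1.le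
    nlinarith [Nat.zero_le (x.1 * x.2)]
  calc _ ≤ ((x.1 + 1 : ℕ) : ℝ) ^ p * ((x.2 + 1 : ℕ) : ℝ) ^ p * q ^ (x.1 + x.2) := by
        gcongr
        · exact hα _
        · exact hβ _
    _ = _ := by rw [pow_add]; ring

theorem lambert (h0 : 0 < q) (h1 : q < 1) {α β : ℕ → ℝ} {A B : ℝ → ℝ} (p : ℕ)
    (hα : ∀ n, |α n| ≤ (n : ℝ) ^ p) (hβ : ∀ n, |β n| ≤ (n : ℝ) ^ p)
    (hA : ∀ x, 0 < x → x < 1 → HasSum (fun n => α (n + 1) * x ^ (n + 1)) (A x))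
    (hB : ∀ x, 0 < x → x < 1 → HasSum (fun n => β (n + 1) * x ^ (n + 1)) (B x)) :
    ∃ s, HasSum (fun x : ℕ × ℕ => α (x.1 + 1) * β (x.2 + 1) * q ^ ((x.1 + 1) * (x.2 + 1))) s ∧
      HasSum (fun n => α (n + 1) * B (q ^ (n + 1))) s ∧
      HasSum (fun n => β (n + 1) * A (q ^ (n + 1))) s := by
  have hs := (lambert_summable h0 h1 hα hβ).hasSum
  refine ⟨_, hs, ?_, ?_⟩
  · refine hs.prod_fiberwise fun m => ?_
    have := (hB (q ^ (m + 1)) (by positivity) (pow_lt_one₀ h0.le h1 (by omega))).mul_left (α (m + 1))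
    refine hsc this (fun n => ?_) rfl
    simp only [pow_mul]; ring
  · have hs' := (Equiv.prodComm ℕ ℕ).hasSum_iff.2 hs
    refine hs'.prod_fiberwise fun m => ?_
    have := (hA (q ^ (m + 1)) (by positivity) (pow_lt_one₀ h0.le h1 (by omega))).mul_left (β (m + 1))
    refine hsc this (fun n => ?_) rfl
    simp only [Function.comp, Equiv.prodComm_apply, Prod.swap]
    rw [mul_comm (n + 1), pow_mul]; ring

theorem hasSum_one {x : ℝ} (h0 : 0 < x) (h1 : x < 1) :
    HasSum (fun n : ℕ => (1 : ℝ) * x ^ (n + 1)) (x / (1 - x)) :=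
  hsc ((hasSum_geometric_of_lt_one h0.le h1).mul_left x) (fun n => by ring) (by rw [div_eq_mul_inv])

theorem hasSum_idn {x : ℝ} (h0 : 0 < x) (h1 : x < 1) :
    HasSum (fun n : ℕ => ((n + 1 : ℕ) : ℝ) * x ^ (n + 1)) (x / (1 - x) ^ 2) := by
  have h := hasSum_coe_mul_geometric_of_norm_lt_one (r := x) (by rwa [Real.norm_of_nonneg h0.le])
  rw [← hasSum_nat_add_iff' 1] at h
  simpa using h

/-- from sums over `n+1` to sums over `n` -/
theorem hasSum_succ {f : ℕ → ℝ} {a : ℝ} (hf : f 0 = 0) (h : HasSum (fun n => f (n + 1)) a) : HasSum f a := by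
  rw [← hasSum_nat_add_iff' 1]
  simpa [hf] using h

theorem hasSum_of_succ {f : ℕ → ℝ} {a : ℝ} (hf : f 0 = 0) (h : HasSum f a) : HasSum (fun n => f (n + 1)) a := by
  rw [← hasSum_nat_add_iff' 1] at h
  simpa [hf] using h

/-- Lambert series -/
noncomputable def Lam (Q : ℝ) : ℝ := ∑' n : ℕ, (n : ℝ) * (Q ^ n / (1 - Q ^ n))

theorem Lam_both (h0 : 0 < q) (h1 : q < 1) : HasSum (fun n : ℕ => (n : ℝ) * (q ^ n / (1 - q ^ n))) (Lam q) ∧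
    HasSum (fun n : ℕ => q ^ n / (1 - q ^ n) ^ 2) (Lam q) := by
  obtain ⟨s, -, h2, h3⟩ := lambert h0 h1 (α := fun n => (n : ℝ)) (β := fun n => if n = 0 then 0 else 1)
    (A := fun x => x / (1 - x) ^ 2) (B := fun x => x / (1 - x)) 1 (fun n => by simp)
    (fun n => by
      by_cases hn : n = 0
      · simp [hn]
      · have : (1 : ℝ) ≤ n := by exact_mod_cast Nat.one_le_iff_ne_zero.2 hn
        simpa [hn] using this)
    (fun x hx0 hx1 => hasSum_idn hx0 hx1) (fun x hx0 hx1 => by simpa using hasSum_one hx0 hx1)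
  have h2' : HasSum (fun n : ℕ => (n : ℝ) * (q ^ n / (1 - q ^ n))) s :=
    hasSum_succ (by simp) h2
  have h3' : HasSum (fun n : ℕ => q ^ n / (1 - q ^ n) ^ 2) s := by
    refine hasSum_succ (by simp) ?_
    simpa using h3
  have : s = Lam q := h2'.tsum_eq.symm
  rw [← this]
  exact ⟨h2', h3'⟩

theorem lamH_eq (h0 : 0 < q) (h1 : q < 1) : lamH q = Lam q := by
  have h := (summable_rs h0 h1 1).hasSum.nat_add_neg
  have h2 := (Lam_both h0 h1).1.mul_left 2
  have := h.unique (hsc h2 (fun n => ?_) rfl)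
  · rw [Int.cast_zero, zero_pow one_ne_zero, zero_mul, add_zero] at this
    unfold lamH
    linarith
  · by_cases hn : n = 0
    · subst hn; simp
    have h3 := rs_odd h0 h1 (n : ℤ)
    rw [h3]
    have h4 := one_sub_ne h0 h1 (n := (n : ℤ)) (by exact_mod_cast hn)
    have : sQ q n - pos n = q ^ n / (1 - q ^ n) := by
      rw [pos, if_pos (by omega), sQ]
      rw [zpow_natCast] at *
      field_simp
      ring
    rw [this]; push_cast; ring

theorem kap_eq (h0 : 0 < q) (h1 : q < 1) : kap q = 1 / 4 + 2 * (Lam q - 4 * Lam (q ^ 2)) := by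
  have hq2 : q ^ 2 < 1 := pow_lt_one₀ h0.le h1 (by norm_num)
  have hs := (adm_t h0 h1 0).summable_conv (adm_t h0 h1 0) h0 h1 0
  have hk : HasSum (fun k : ℤ => tQ q k * tQ q (-k)) (kap q) := by
    simp only [pow_zero, one_mul, zero_sub] at hs
    exact hs.hasSum
  have h := hk.nat_add_neg
  have h2 := (((Lam_both h0 h1).2.sub ((Lam_both (q := q ^ 2) (by positivity) hq2).2.mul_left 4)).mul_left 2).add
    (hasSum_ite_eq (0 : ℕ) (1 / 2 : ℝ))
  have := h.unique (hsc h2 (fun n => ?_) rfl)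
  · simp [tQ] at this
    linarith
  · by_cases hn : n = 0
    · subst hn; simp [tQ]; norm_num
    · simp only [hn, if_false, add_zero, neg_neg]
      have h4 := one_sub_ne h0 h1 (n := (n : ℤ)) (by exact_mod_cast hn)
      have h5 := one_add_ne h0 (n : ℤ)
      rw [tQ_neg h0]
      unfold tQ
      rw [← pow_mul, mul_comm 2 n, pow_mul]
      rw [zpow_natCast] at *
      have h6 : 1 - (q ^ n) ^ 2 ≠ 0 := by
        rw [show 1 - (q ^ n) ^ 2 = (1 - q ^ n) * (1 + q ^ n) by ring]
        exact mul_ne_zero h4 h5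
      have h7 : q ^ n + 1 ≠ 0 := by rwa [add_comm]
      rw [show 1 - (q ^ n) ^ 2 = (1 - q ^ n) * (1 + q ^ n) by ring]
      field_simp
      ring

/-- `S₁` as a one-sided sum -/
theorem S1_one_sided (h0 : 0 < q) {z : ℝ} (hz : q < |z|) (hz1 : |z| < 1) (p : ℕ) (hp : Odd p) :
    HasSum (fun n : ℕ => (n : ℝ) ^ p * ((z ^ n + (q / z) ^ n) / (1 - q ^ n))) (S q p z) := by
  have h1 := hz.trans hz1
  have hz0 : z ≠ 0 := by intro h; rw [h] at hz; simp at hz; linarith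
  have h := (S_hasSum h0 p hz hz1).nat_add_neg
  refine hsc h (fun n => ?_) (by simp [sQ_zero])
  by_cases hn : n = 0
  · subst hn; simp [sQ]
  have h4 := one_sub_ne h0 h1 (n := (n : ℤ)) (by exact_mod_cast hn)
  rw [sQ_neg h0 h1 (by exact_mod_cast hn)]
  have e : (((-(n : ℤ)) : ℤ) : ℝ) ^ p = - (n : ℝ) ^ p := by push_cast; rw [hp.neg_pow]
  rw [e]
  unfold sQ
  rw [zpow_neg, zpow_natCast, div_pow]
  rw [zpow_natCast] at *
  push_cast
  field_simp
  ring

theorem pow_ne_one {x : ℝ} (h0 : 0 < x) (h1 : x < 1) {n : ℕ} (hn : n ≠ 0) : 1 - x ^ n ≠ 0 := by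
  have := pow_lt_one₀ h0.le h1 hn
  linarith

theorem D_hasSum (h0 : 0 < q) (h1 : q < 1) :
    HasSum (fun n : ℕ => (n : ℝ) * (q ^ n / (1 - q ^ (2 * n)))) (Lam q - Lam (q ^ 2)) := by
  have hq2 : q ^ 2 < 1 := pow_lt_one₀ h0.le h1 (by norm_num)
  have h := (Lam_both h0 h1).1.sub (Lam_both (q := q ^ 2) (by positivity) hq2).1
  refine hsc h (fun n => ?_) rfl
  by_cases hn : n = 0
  · subst hn; simp
  have h3 := pow_ne_one h0 h1 hn
  have h5 : 1 + q ^ n ≠ 0 := by positivity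
  rw [← pow_mul, mul_comm 2 n, pow_mul, show 1 - (q ^ n) ^ 2 = (1 - q ^ n) * (1 + q ^ n) by ring]
  field_simp
  ring

theorem one_sub_fac (x : ℝ) : 1 - x ^ 2 = (1 - x) * (1 + x) := by ring

theorem S1_q2 (h0 : 0 < q) (h1 : q < 1) : S (q ^ 2) 1 q = 2 * (Lam q - Lam (q ^ 2)) := by
  have hq2 : q ^ 2 < q := by nlinarith
  have h := S1_one_sided (q := q ^ 2) (z := q) (by positivity) (by rwa [abs_of_pos h0]) (by rwa [abs_of_pos h0]) 1
    odd_one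
  refine h.unique (hsc ((D_hasSum h0 h1).mul_left 2) (fun n => ?_) rfl)
  rw [show q ^ 2 / q = q by field_simp, ← pow_mul]; ring

theorem S1_q2neg (h0 : 0 < q) (h1 : q < 1) :
    S (q ^ 2) 1 (-q) = 2 * (-Lam q + 5 * Lam (q ^ 2) - 4 * Lam (q ^ 4)) := by
  have hq2 : q ^ 2 < q := by nlinarith
  have hq21 : q ^ 2 < 1 := by linarith
  have h := S1_one_sided (q := q ^ 2) (z := -q) (by positivity) (by rwa [abs_neg, abs_of_pos h0])
    (by rwa [abs_neg, abs_of_pos h0]) 1 odd_one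
  have hD := (D_hasSum h0 h1).mul_left (-2)
  have hD2 := (D_hasSum (q := q ^ 2) (by positivity) hq21).mul_left 8
  have hinj : Function.Injective (fun j : ℕ => 2 * j) := by
    intro a b h; simp only at h; omega
  have hE : HasSum (fun n : ℕ => if Even n then 4 * ((n : ℝ) * (q ^ n / (1 - q ^ (2 * n)))) else 0)
      (8 * (Lam (q ^ 2) - Lam ((q ^ 2) ^ 2))) := by
    refine (hinj.hasSum_iff ?_).1 (hsc hD2 (fun n => ?_) rfl)
    · intro k hk
      rw [if_neg]
      rintro ⟨m, rfl⟩
      exact hk ⟨m, by simp only; ring⟩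
    · simp only [Function.comp, even_two_mul, if_true]
      rw [← pow_mul, ← pow_mul]
      push_cast; ring
  have := h.unique (hsc (hD.add hE) (fun n => ?_) rfl)
  · rw [this, ← pow_mul]; norm_num; ring
  · rw [show q ^ 2 / (-q) = -q by field_simp, ← pow_mul]
    rcases Nat.even_or_odd n with h | h
    · rw [if_pos h, h.neg_pow]; ring
    · rw [if_neg (Nat.not_even_iff_odd.2 h), h.neg_pow]; ring

theorem S1_q4 (h0 : 0 < q) (h1 : q < 1) : S (q ^ 4) 1 q = Lam q - Lam (q ^ 2) := by
  have hq4 : q ^ 4 < q := by nlinarith [pow_lt_one₀ h0.le h1 (n := 3) (by norm_num)]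
  have h := S1_one_sided (q := q ^ 4) (z := q) (by positivity) (by rwa [abs_of_pos h0]) (by rwa [abs_of_pos h0]) 1
    odd_one
  refine h.unique (hsc ((D_hasSum h0 h1)) (fun n => ?_) rfl)
  by_cases hn : n = 0
  · subst hn; simp
  have h3 := pow_ne_one h0 h1 (n := 2 * n) (by omega)
  have h5 : 1 + q ^ (2 * n) ≠ 0 := by positivity
  rw [show q ^ 4 / q = q ^ 3 by field_simp]
  have e : 1 - (q ^ 4) ^ n = (1 - q ^ (2 * n)) * (1 + q ^ (2 * n)) := by ring
  rw [e, pow_one]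
  field_simp
  ring

theorem S1_q8 (h0 : 0 < q) (h1 : q < 1) : S (q ^ 8) 1 q + S (q ^ 8) 1 (q ^ 3) = Lam q - Lam (q ^ 2) := by
  have hq8 : q ^ 8 < q := by nlinarith [pow_lt_one₀ h0.le h1 (n := 7) (by norm_num)]
  have hq3 : q ^ 3 < 1 := pow_lt_one₀ h0.le h1 (by norm_num)
  have hq83 : q ^ 8 < q ^ 3 := by nlinarith [pow_lt_one₀ h0.le h1 (n := 5) (by norm_num), pow_pos h0 3]
  have hq30 : 0 < q ^ 3 := by positivity
  have h := S1_one_sided (q := q ^ 8) (z := q) (by positivity) (by rwa [abs_of_pos h0]) (by rwa [abs_of_pos h0]) 1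
    odd_one
  have h' := S1_one_sided (q := q ^ 8) (z := q ^ 3) (by positivity) (by rwa [abs_of_pos hq30])
    (by rwa [abs_of_pos hq30]) 1 odd_one
  refine (h.add h').unique (hsc ((D_hasSum h0 h1)) (fun n => ?_) rfl)
  by_cases hn : n = 0
  · subst hn; simp
  have h3 := pow_ne_one h0 h1 (n := 2 * n) (by omega)
  have h5 : 1 + q ^ (2 * n) ≠ 0 := by positivity
  have h6 : 1 + q ^ (4 * n) ≠ 0 := by positivity
  rw [show q ^ 8 / q = q ^ 7 by field_simp, show q ^ 8 / q ^ 3 = q ^ 5 by field_simp]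
  have e : 1 - (q ^ 8) ^ n = (1 - q ^ (2 * n)) * (1 + q ^ (2 * n)) * (1 + q ^ (4 * n)) := by ring
  rw [e, pow_one]
  field_simp
  ring

theorem four_sq (h0 : 0 < q) (h1 : q < 1) : th q ^ 4 = 1 + 8 * Lam q - 32 * Lam (q ^ 4) := by
  have hq2 : q ^ 2 < q := by nlinarith
  have h := C1 (𝕜 := ℝ) (Q := q ^ 2) (z := q) (by positivity) (by rwa [Real.norm_of_nonneg h0.le])
    (by rwa [Real.norm_of_nonneg h0.le])
  rw [S1_q2 h0 h1, kap_eq (by positivity) (by linarith), ← pow_mul] at h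
  have h2 := two_sq h0 h1
  simp only [RCLike.ofReal_real_eq_id, id] at h
  norm_num at h
  have : th q ^ 4 = 4 * T (q ^ 2) 0 q ^ 2 := by
    rw [show th q ^ 4 = (th q ^ 2) ^ 2 by ring, ← h2]; ring
  rw [this, h]; ring

theorem four_sq_neg (h0 : 0 < q) (h1 : q < 1) :
    th (-q) ^ 4 = 1 - 8 * Lam q + 48 * Lam (q ^ 2) - 64 * Lam (q ^ 4) := by
  have hq2 : q ^ 2 < q := by nlinarith
  have hn : ‖-q‖ = q := by rw [norm_neg, Real.norm_of_nonneg h0.le]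
  have h := C1 (𝕜 := ℝ) (Q := q ^ 2) (z := -q) (by positivity) (by rwa [hn]) (by rwa [hn])
  rw [S1_q2neg h0 h1, kap_eq (by positivity) (by linarith), ← pow_mul] at h
  have h2 := two_sq_neg h0 h1
  simp only [RCLike.ofReal_real_eq_id, id] at h
  norm_num at h
  have : th (-q) ^ 4 = 4 * T (q ^ 2) 0 (-q) ^ 2 := by
    rw [show th (-q) ^ 4 = (th (-q) ^ 2) ^ 2 by ring, ← h2]; ring
  rw [this, h]; ring

end RF5

namespace RF5
variable {q : ℝ}

theorem V_eq (h0 : 0 < q) (h1 : q < 1) :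
    1 + 24 * Lam q - 48 * Lam (q ^ 2) = 2 * th q ^ 4 - th (-q) ^ 4 := by
  rw [four_sq h0 h1, four_sq_neg h0 h1]; ring

theorem th_p (h0 : 0 < q) (h1 : q < 1) : th q = th (q ^ 4) + tb q := (th_split h0 h1).1
theorem th_n (h0 : 0 < q) (h1 : q < 1) : th (-q) = th (q ^ 4) - tb q := (th_split h0 h1).2

theorem th2_sq (h0 : 0 < q) (h1 : q < 1) : th (q ^ 2) ^ 2 = th (q ^ 4) ^ 2 + tb q ^ 2 := by
  have h := th_sq h0 h1
  rw [th_p h0 h1, th_n h0 h1] at h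
  linarith

theorem th2n_sq (h0 : 0 < q) (h1 : q < 1) : th (-q ^ 2) ^ 2 = th (q ^ 4) ^ 2 - tb q ^ 2 := by
  have h := th_mul_neg h0 h1
  rw [th_p h0 h1, th_n h0 h1] at h
  linarith

theorem th4n (h0 : 0 < q) (h1 : q < 1) : th (-q ^ 4) ^ 4 = th (q ^ 4) ^ 4 - tb q ^ 4 := by
  have h := th_mul_neg (q := q ^ 2) (by positivity) (pow_lt_one₀ h0.le h1 (by norm_num))
  rw [← pow_mul] at h
  norm_num at h
  have h2 := th2_sq h0 h1
  have h3 := th2n_sq h0 h1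
  calc th (-q ^ 4) ^ 4 = (th (-q ^ 4) ^ 2) ^ 2 := by ring
    _ = th (q ^ 2) ^ 2 * th (-q ^ 2) ^ 2 := by rw [← h]; ring
    _ = _ := by rw [h2, h3]; ring

theorem V4_eq (h0 : 0 < q) (h1 : q < 1) :
    1 + 24 * Lam (q ^ 4) - 48 * Lam (q ^ 8) = th (q ^ 4) ^ 4 + tb q ^ 4 := by
  have h := V_eq (q := q ^ 4) (by positivity) (pow_lt_one₀ h0.le h1 (by norm_num))
  rw [← pow_mul] at h
  norm_num at h
  rw [h, th4n h0 h1]; ring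

theorem q4_lt (h0 : 0 < q) (h1 : q < 1) : q ^ 4 < q := by
  nlinarith [pow_lt_one₀ h0.le h1 (n := 3) (by norm_num)]

theorem q8_lt (h0 : 0 < q) (h1 : q < 1) : q ^ 8 < q := by
  nlinarith [pow_lt_one₀ h0.le h1 (n := 7) (by norm_num)]

theorem q83_lt (h0 : 0 < q) (h1 : q < 1) : q ^ 8 < q ^ 3 := by
  nlinarith [pow_lt_one₀ h0.le h1 (n := 5) (by norm_num), pow_pos h0 3]

theorem th2_four (h0 : 0 < q) (h1 : q < 1) :
    (th (q ^ 4) ^ 2 + tb q ^ 2) ^ 2 = 1 + 8 * Lam (q ^ 2) - 32 * Lam (q ^ 8) := by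
  have h8 := four_sq (q := q ^ 2) (by positivity) (pow_lt_one₀ h0.le h1 (by norm_num))
  rw [← pow_mul] at h8
  norm_num at h8
  have h2 := th2_sq h0 h1
  rw [← h2, ← h8]; ring

theorem phiphi2 (h0 : 0 < q) (h1 : q < 1) : 2 * T (q ^ 4) 0 q = th q * th (q ^ 2) := by
  have hq4 := q4_lt h0 h1
  have h := C1 (𝕜 := ℝ) (Q := q ^ 4) (z := q) (by positivity) (by rwa [Real.norm_of_nonneg h0.le])
    (by rwa [Real.norm_of_nonneg h0.le])
  rw [S1_q4 h0 h1, kap_eq (by positivity) (by linarith), ← pow_mul] at h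
  simp only [RCLike.ofReal_real_eq_id, id] at h
  norm_num at h
  have hT : 0 ≤ T (q ^ 4) 0 q :=
    (T_hasSum (Q := q ^ 4) (by positivity) 0 (z := q) (by rwa [abs_of_pos h0]) (by rwa [abs_of_pos h0])).nonneg
      (fun n => by unfold tQ; positivity)
  have hq2 : q ^ 2 < 1 := pow_lt_one₀ h0.le h1 (by norm_num)
  have hp := th_ge h0 h1
  have hp2 := th_ge (q := q ^ 2) (by positivity) hq2
  have e1 := four_sq h0 h1
  have e2 := th2_four h0 h1
  have e3 := V4_eq h0 h1
  have e4 := th2_sq h0 h1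
  have e5 := th_p h0 h1
  refine (pow_left_inj₀ (by positivity) (by positivity) two_ne_zero).1 ?_
  rw [mul_pow, h, mul_pow, e4, e5]
  rw [e5] at e1
  linear_combination (-1 / 2) * e1 + (1 / 2) * e2 + e3

theorem bil_o (h0 : 0 < q) (h1 : q < 1) :
    bil (fun n => (n : ℝ) ^ 0 * oQ (q ^ 4) n) q = th (q ^ 4) * tb q := by
  have hq4 := q4_lt h0 h1
  have hq2 : q ^ 2 < q := by nlinarith
  have h := (adm_o (Q := q ^ 4) (by positivity) (by linarith)).hasSum (𝕜 := ℝ) (z := q) (by positivity)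
    (by rwa [Real.norm_of_nonneg h0.le]) (by rwa [Real.norm_of_nonneg h0.le])
  have h2 := h.add (hasSum_refl h)
  have hA := T_hasSum (Q := q ^ 2) (by positivity) 0 (z := q) (by rwa [abs_of_pos h0]) (by rwa [abs_of_pos h0])
  have hB := T_hasSum (Q := q ^ 2) (by positivity) 0 (z := -q) (by rwa [abs_neg, abs_of_pos h0])
    (by rwa [abs_neg, abs_of_pos h0])
  have := h2.unique (hsc (hA.sub hB) (fun n => ?_) rfl)
  · have ha := two_sq h0 h1
    have hb := two_sq_neg h0 h1
    rw [th_p h0 h1] at ha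
    rw [th_n h0 h1] at hb
    linear_combination this / 2 + ha / 4 - hb / 4
  · simp only [pow_zero, one_mul, RCLike.ofReal_real_eq_id, id, oQ]
    rcases Int.even_or_odd n with hn | hn
    · rw [if_neg (Int.not_odd_iff_even.2 hn), if_neg (Int.not_odd_iff_even.2 (by simpa using hn)), hn.neg_zpow]
      ring
    · rw [if_pos hn, if_pos (by simpa using hn), hn.neg_zpow]
      have hn0 : n ≠ 0 := by rintro rfl; simp at hn
      rw [sQ_neg (by positivity) (by linarith) hn0]
      have h3 := one_sub_ne h0 h1 hn0
      have hx : 0 < q ^ n := by positivity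
      unfold sQ tQ
      rw [show (q ^ 4) ^ n = (q ^ n) ^ 4 by rw [← zpow_natCast, ← zpow_natCast, ← zpow_mul, ← zpow_mul, mul_comm],
        show (q ^ 2) ^ n = (q ^ n) ^ 2 by rw [← zpow_natCast, ← zpow_natCast, ← zpow_mul, ← zpow_mul, mul_comm],
        zpow_neg]
      generalize q ^ n = x at *
      have h5 : 1 + x ≠ 0 := by positivity
      have h6 : 1 + x ^ 2 ≠ 0 := by positivity
      rw [show 1 - x ^ 4 = (1 - x) * (1 + x) * (1 + x ^ 2) by ring]
      field_simp
      ring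

theorem h_eq (h0 : 0 < q) (h1 : q < 1) :
    T (q ^ 4) 1 q = th (q ^ 4) * tb q * (th q * th (q ^ 2)) / 2 := by
  have hq4 := q4_lt h0 h1
  have h := C4 (𝕜 := ℝ) (Q := q ^ 4) (z := q) (by positivity)
    (by rwa [Real.norm_of_nonneg h0.le]) (by rwa [Real.norm_of_nonneg h0.le])
  rw [h, bil_o h0 h1, ← phiphi2 h0 h1]; ring

theorem S_diff (h0 : 0 < q) (h1 : q < 1) (p : ℕ) (hp : Odd p) :
    HasSum (fun n : ℕ => (n : ℝ) ^ p * ((q ^ n - q ^ (3 * n)) / (1 + q ^ (4 * n))))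
      (S (q ^ 8) p q - S (q ^ 8) p (q ^ 3)) := by
  have hq8 := q8_lt h0 h1
  have hq3 : q ^ 3 < 1 := pow_lt_one₀ h0.le h1 (by norm_num)
  have hq83 := q83_lt h0 h1
  have hq30 : 0 < q ^ 3 := by positivity
  have h := S1_one_sided (q := q ^ 8) (z := q) (by positivity) (by rwa [abs_of_pos h0]) (by rwa [abs_of_pos h0]) p hp
  have h' := S1_one_sided (q := q ^ 8) (z := q ^ 3) (by positivity) (by rwa [abs_of_pos hq30])
    (by rwa [abs_of_pos hq30]) p hp
  refine hsc (h.sub h') (fun n => ?_) rfl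
  by_cases hn : n = 0
  · subst hn; simp
  have h3 := pow_ne_one h0 h1 (n := 4 * n) (by omega)
  have h6 : 1 + q ^ (4 * n) ≠ 0 := by positivity
  rw [show q ^ 8 / q = q ^ 7 by field_simp, show q ^ 8 / q ^ 3 = q ^ 5 by field_simp]
  have e : 1 - (q ^ 8) ^ n = (1 - q ^ (4 * n)) * (1 + q ^ (4 * n)) := by ring
  rw [e]
  field_simp
  ring

theorem T1_one_sided (h0 : 0 < q) (h1 : q < 1) :
    T (q ^ 4) 1 q = S (q ^ 8) 1 q - S (q ^ 8) 1 (q ^ 3) := by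
  have hq4 := q4_lt h0 h1
  have h := (T_hasSum (Q := q ^ 4) (by positivity) 1 (z := q) (by rwa [abs_of_pos h0])
    (by rwa [abs_of_pos h0])).nat_add_neg
  have := h.unique (hsc (S_diff h0 h1 1 odd_one) (fun n => ?_) rfl)
  · simpa using this
  · rw [tQ_neg (by positivity)]
    unfold tQ
    rw [zpow_neg, zpow_natCast, zpow_natCast, ← pow_mul]
    have h6 : 1 + q ^ (4 * n) ≠ 0 := by positivity
    push_cast
    field_simp
    ring

/-- The series `H`. -/
theorem H_hasSum (h0 : 0 < q) (h1 : q < 1) :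
    HasSum (fun n : ℕ => (n : ℝ) ^ 3 * ((q ^ n - q ^ (3 * n)) / (1 + q ^ (4 * n))))
      (th (q ^ 4) * tb q * (th q * th (q ^ 2)) / 2 *
        (3 / 4 * (th (q ^ 4) ^ 2 + tb q ^ 2) ^ 2 + 1 / 2 * (th (q ^ 4) + tb q) ^ 4
          - 1 / 4 * (th (q ^ 4) - tb q) ^ 4)) := by
  have hq8 := q8_lt h0 h1
  have hq3 : q ^ 3 < 1 := pow_lt_one₀ h0.le h1 (by norm_num)
  have hq83 := q83_lt h0 h1
  have hq30 : 0 < q ^ 3 := by positivity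
  refine hsc (S_diff h0 h1 3 (by decide)) (fun n => rfl) ?_
  obtain ⟨c, hc⟩ := C2 (𝕜 := ℝ) (Q := q ^ 8) (by positivity) (by linarith)
  have e1 := hc q (by rwa [Real.norm_of_nonneg h0.le]) (by rwa [Real.norm_of_nonneg h0.le])
  have e2 := hc (q ^ 3) (by rwa [Real.norm_of_nonneg hq30.le]) (by rwa [Real.norm_of_nonneg hq30.le])
  have e3 := T1_one_sided h0 h1
  rw [h_eq h0 h1] at e3
  have e4 := S1_q8 h0 h1
  have e5 := V_eq h0 h1
  have e6 := th2_four h0 h1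
  rw [th_n h0 h1, th_p h0 h1] at e5
  rw [lamH_eq (by positivity) (by linarith)] at e1 e2
  simp only [RCLike.ofReal_real_eq_id, id] at e1 e2
  rw [e1, e2, e3]
  have e7 : 3 / 4 * (th (q ^ 4) ^ 2 + tb q ^ 2) ^ 2 + 1 / 2 * (th (q ^ 4) + tb q) ^ 4
          - 1 / 4 * (th (q ^ 4) - tb q) ^ 4 = 6 * (S (q ^ 8) 1 q + S (q ^ 8) 1 (q ^ 3)) + 1 - 24 * Lam (q ^ 8) := by
    rw [e4]
    linear_combination (3 / 4) * e6 - (1 / 4) * e5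
  rw [e7]
  ring

end RF5

namespace RF5
variable {q : ℝ}

/-- residue class indicator mod 8 -/
def rc (j n : ℕ) : ℝ := if n % 8 = j then 1 else 0

theorem rc_hasSum {x : ℝ} (h0 : 0 < x) (h1 : x < 1) {j : ℕ} (hj : j < 8) :
    HasSum (fun n : ℕ => rc j n * x ^ n) (x ^ j / (1 - x ^ 8)) := by
  have hinj : Function.Injective (fun k : ℕ => 8 * k + j) := by
    intro a b h; simp only at h; omega
  have hg := (hasSum_geometric_of_lt_one (r := x ^ 8) (by positivity)
    (pow_lt_one₀ h0.le h1 (by norm_num))).mul_left (x ^ j)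
  rw [← div_eq_mul_inv] at hg
  refine (hinj.hasSum_iff ?_).1 (hsc hg (fun k => ?_) rfl)
  · intro n hn
    rw [rc, if_neg, zero_mul]
    intro h
    exact hn ⟨n / 8, by simp only; omega⟩
  · simp only [Function.comp, rc]
    rw [if_pos (by omega), pow_add, pow_mul]; ring

/-- the character `(8/·)` -/
def c8 (n : ℕ) : ℝ := rc 1 n - rc 3 n - rc 5 n + rc 7 n
/-- the character `(-8/·)` -/
def d8 (n : ℕ) : ℝ := rc 1 n + rc 3 n - rc 5 n - rc 7 n
/-- the character `(-4/·)` -/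
def d4 (n : ℕ) : ℝ := rc 1 n - rc 3 n + rc 5 n - rc 7 n

theorem rc_cases (n : ℕ) : ∃ k j, n = 8 * k + j ∧ j < 8 ∧ ∀ i, rc i n = rc i j := by
  refine ⟨n / 8, n % 8, by omega, by omega, fun i => ?_⟩
  simp [rc]

theorem abs_le_pow_of {f : ℕ → ℝ} (hf0 : f 0 = 0) (hf : ∀ n, |f n| ≤ 1) (n p : ℕ) : |f n| ≤ (n : ℝ) ^ p := by
  rcases Nat.eq_zero_or_pos n with rfl | h
  · rw [hf0, abs_zero]; positivity
  · exact (hf n).trans (one_le_pow₀ (by exact_mod_cast h))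

theorem chars_le (n : ℕ) : |c8 n| ≤ 1 ∧ |d8 n| ≤ 1 ∧ |d4 n| ≤ 1 := by
  obtain ⟨k, j, rfl, hj, h⟩ := rc_cases n
  unfold c8 d8 d4
  simp only [h]
  interval_cases j <;> simp [rc]

theorem c8_zero : c8 0 = 0 := by simp [c8, rc]
theorem d8_zero : d8 0 = 0 := by simp [d8, rc]
theorem d4_zero : d4 0 = 0 := by simp [d4, rc]

theorem c8_hasSum {x : ℝ} (h0 : 0 < x) (h1 : x < 1) :
    HasSum (fun n : ℕ => c8 (n + 1) * x ^ (n + 1)) ((x - x ^ 3) / (1 + x ^ 4)) := by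
  refine hasSum_of_succ (f := fun n => c8 n * x ^ n) (by simp [c8_zero]) ?_
  refine hsc ((((rc_hasSum h0 h1 (j := 1) (by norm_num)).sub (rc_hasSum h0 h1 (j := 3) (by norm_num))).sub
    (rc_hasSum h0 h1 (j := 5) (by norm_num))).add (rc_hasSum h0 h1 (j := 7) (by norm_num)))
    (fun n => by unfold c8; ring) ?_
  have h3 := pow_ne_one h0 h1 (n := 4) (by norm_num)
  rw [show 1 - x ^ 8 = (1 - x ^ 4) * (1 + x ^ 4) by ring]
  field_simp
  ring

theorem d8_hasSum {x : ℝ} (h0 : 0 < x) (h1 : x < 1) :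
    HasSum (fun n : ℕ => d8 (n + 1) * x ^ (n + 1)) ((x + x ^ 3) / (1 + x ^ 4)) := by
  refine hasSum_of_succ (f := fun n => d8 n * x ^ n) (by simp [d8_zero]) ?_
  refine hsc ((((rc_hasSum h0 h1 (j := 1) (by norm_num)).add (rc_hasSum h0 h1 (j := 3) (by norm_num))).sub
    (rc_hasSum h0 h1 (j := 5) (by norm_num))).sub (rc_hasSum h0 h1 (j := 7) (by norm_num)))
    (fun n => by unfold d8; ring) ?_
  have h3 := pow_ne_one h0 h1 (n := 4) (by norm_num)
  rw [show 1 - x ^ 8 = (1 - x ^ 4) * (1 + x ^ 4) by ring]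
  field_simp
  ring

theorem d4_hasSum {x : ℝ} (h0 : 0 < x) (h1 : x < 1) :
    HasSum (fun n : ℕ => d4 (n + 1) * x ^ (n + 1)) (x / (1 + x ^ 2)) := by
  refine hasSum_of_succ (f := fun n => d4 n * x ^ n) (by simp [d4_zero]) ?_
  refine hsc ((((rc_hasSum h0 h1 (j := 1) (by norm_num)).sub (rc_hasSum h0 h1 (j := 3) (by norm_num))).add
    (rc_hasSum h0 h1 (j := 5) (by norm_num))).sub (rc_hasSum h0 h1 (j := 7) (by norm_num)))
    (fun n => by unfold d4; ring) ?_
  have h3 := pow_ne_one h0 h1 (n := 2) (by norm_num)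
  rw [show 1 - x ^ 8 = (1 - x ^ 2) * (1 + x ^ 2) * (1 + x ^ 4) by ring]
  field_simp
  ring

theorem one_bound (n : ℕ) : |(if n = 0 then (0 : ℝ) else 1)| ≤ (n : ℝ) ^ 1 := by
  by_cases hn : n = 0
  · simp [hn]
  · have : (1 : ℝ) ≤ n := by exact_mod_cast Nat.one_le_iff_ne_zero.2 hn
    simpa [hn] using this

theorem B8_hasSum (h0 : 0 < q) (h1 : q < 1) :
    HasSum (fun n : ℕ => d8 n * (q ^ n / (1 - q ^ n))) ((th q * th (q ^ 2) - 1) / 2) := by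
  obtain ⟨s, -, h2, h3⟩ := lambert h0 h1 (α := d8) (β := fun n => if n = 0 then 0 else 1)
    (A := fun x => (x + x ^ 3) / (1 + x ^ 4)) (B := fun x => x / (1 - x)) 1
    (fun n => abs_le_pow_of d8_zero (fun n => (chars_le n).2.1) n 1) one_bound
    (fun x hx0 hx1 => d8_hasSum hx0 hx1) (fun x hx0 hx1 => by simpa using hasSum_one hx0 hx1)
  have hq4 := q4_lt h0 h1
  have h := (T_hasSum (Q := q ^ 4) (by positivity) 0 (z := q) (by rwa [abs_of_pos h0])
    (by rwa [abs_of_pos h0])).nat_add_neg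
  rw [← hasSum_nat_add_iff' 1] at h
  have := h.unique (hsc h3 (fun n => ?_) rfl)
  · have e := phiphi2 h0 h1
    simp [tQ] at this
    have hs : s = (th q * th (q ^ 2) - 1) / 2 := by rw [← e, ← this]; ring
    rw [← hs]
    exact hasSum_succ (by simp) h2
  · rw [tQ_neg (by positivity)]
    unfold tQ
    rw [zpow_neg, zpow_natCast, zpow_natCast, ← pow_mul, mul_comm 4, pow_mul]
    have h6 : 0 < q ^ (n + 1) := by positivity
    simp only [Nat.succ_ne_zero, if_false, pow_zero, one_mul]
    generalize q ^ (n + 1) = x at *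
    have h6 : 1 + x ^ 4 ≠ 0 := by positivity
    field_simp
    ring

theorem B4_hasSum (h0 : 0 < q) (h1 : q < 1) :
    HasSum (fun n : ℕ => d4 n * (q ^ n / (1 - q ^ n))) ((th q ^ 2 - 1) / 4) := by
  obtain ⟨s, -, h2, h3⟩ := lambert h0 h1 (α := d4) (β := fun n => if n = 0 then 0 else 1)
    (A := fun x => x / (1 + x ^ 2)) (B := fun x => x / (1 - x)) 1
    (fun n => abs_le_pow_of d4_zero (fun n => (chars_le n).2.2) n 1) one_bound
    (fun x hx0 hx1 => d4_hasSum hx0 hx1) (fun x hx0 hx1 => by simpa using hasSum_one hx0 hx1)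
  have hq2 : q ^ 2 < q := by nlinarith
  have h := (T_hasSum (Q := q ^ 2) (by positivity) 0 (z := q) (by rwa [abs_of_pos h0])
    (by rwa [abs_of_pos h0])).nat_add_neg
  rw [← hasSum_nat_add_iff' 1] at h
  have := h.unique (hsc (h3.mul_left 2) (fun n => ?_) rfl)
  · have e := two_sq h0 h1
    simp [tQ] at this
    have hs : s = (th q ^ 2 - 1) / 4 := by rw [← e]; linarith
    rw [← hs]
    exact hasSum_succ (by simp) h2
  · rw [tQ_neg (by positivity)]
    unfold tQ
    rw [zpow_neg, zpow_natCast, zpow_natCast, ← pow_mul, mul_comm 2, pow_mul]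
    have h6 : 0 < q ^ (n + 1) := by positivity
    simp only [Nat.succ_ne_zero, if_false, pow_zero, one_mul]
    generalize q ^ (n + 1) = x at *
    have h6 : 1 + x ^ 2 ≠ 0 := by positivity
    field_simp
    ring

theorem plus_split {x : ℝ} (h0 : 0 < x) (h1 : x < 1) {n : ℕ} (hn : n ≠ 0) :
    x ^ n / (1 + x ^ n) = x ^ n / (1 - x ^ n) - 2 * ((x ^ 2) ^ n / (1 - (x ^ 2) ^ n)) := by
  have h3 := pow_ne_one h0 h1 hn
  rw [show (x ^ 2) ^ n = (x ^ n) ^ 2 by ring]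
  have h6 : 0 < x ^ n := by positivity
  generalize x ^ n = y at *
  have : 1 + y ≠ 0 := by positivity
  rw [show 1 - y ^ 2 = (1 - y) * (1 + y) by ring]
  field_simp
  ring

theorem B8p_hasSum (h0 : 0 < q) (h1 : q < 1) :
    HasSum (fun n : ℕ => d8 n * (q ^ n / (1 + q ^ n))) (1 / 2 - th (q ^ 2) * (th (q ^ 4) - tb q) / 2) := by
  have hq2 : q ^ 2 < 1 := pow_lt_one₀ h0.le h1 (by norm_num)
  have h := (B8_hasSum h0 h1).sub ((B8_hasSum (q := q ^ 2) (by positivity) hq2).mul_left 2)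
  refine hsc h (fun n => ?_) ?_
  · by_cases hn : n = 0
    · subst hn; simp [d8_zero]
    · rw [plus_split h0 h1 hn]; ring
  · rw [← pow_mul, th_p h0 h1]; norm_num; ring

/-- `s(n) = χ₄(n/2)` -/
def s8 (n : ℕ) : ℝ := rc 2 n - rc 6 n

theorem s8_odd {k : ℕ} (hk : Odd k) : s8 k = 0 := by
  obtain ⟨m, rfl⟩ := hk
  unfold s8 rc
  rw [if_neg (by omega), if_neg (by omega)]; ring

theorem s8_two (k : ℕ) : s8 (2 * k) = d4 k := by
  unfold s8 d4 rc
  split_ifs <;> first | omega | norm_num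

theorem B4p_hasSum (h0 : 0 < q) (h1 : q < 1) :
    HasSum (fun n : ℕ => s8 n * (q ^ n / (1 + q ^ n))) (1 / 4 - (th (q ^ 4) ^ 2 - tb q ^ 2) / 4) := by
  have hq2 : q ^ 2 < 1 := pow_lt_one₀ h0.le h1 (by norm_num)
  have hq4 : q ^ 4 < 1 := pow_lt_one₀ h0.le h1 (by norm_num)
  have h := (B4_hasSum (q := q ^ 2) (by positivity) hq2).sub
    ((B4_hasSum (q := (q ^ 2) ^ 2) (by positivity) (pow_lt_one₀ (by positivity) hq2 (by norm_num))).mul_left 2)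
  have hinj : Function.Injective (fun j : ℕ => 2 * j) := by
    intro a b h; simp only at h; omega
  refine (hinj.hasSum_iff ?_).1 (hsc h (fun n => ?_) ?_)
  · intro k hk
    rw [s8_odd, zero_mul]
    rcases Nat.even_or_odd' k with ⟨m, rfl | rfl⟩
    · exact absurd ⟨m, rfl⟩ hk
    · exact ⟨m, rfl⟩
  · simp only [Function.comp, s8_two]
    by_cases hn : n = 0
    · subst hn; simp [d4_zero]
    · rw [pow_mul, plus_split (by positivity) hq2 hn]; ring
  · rw [← pow_mul, th2_sq h0 h1]; norm_num; ring

end RF5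

namespace RF5
variable {Q : ℝ}

/-- one-sided symmetric series -/
noncomputable def cs (ε : ℂ) (a : ℕ → ℝ) (z : ℂ) : ℂ := ∑' n : ℕ, (a n : ℂ) * (z ^ n + ε * (z⁻¹) ^ n)

/-- coefficient decay -/
def Dec (Q : ℝ) (a : ℕ → ℝ) : Prop := ∃ (C : ℝ) (p : ℕ), ∀ n, |a n| ≤ C * (n : ℝ) ^ p * Q ^ n

theorem dec_s (h0 : 0 < Q) (h1 : Q < 1) (p : ℕ) : Dec Q (fun n => (n : ℝ) ^ p * (Q ^ n / (1 - Q ^ n))) := by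
  refine ⟨1 / (1 - Q), p, fun n => ?_⟩
  have hb := sQ_bound h0 h1 n
  unfold sQ at hb
  rw [zpow_natCast] at hb
  rw [abs_mul, abs_of_nonneg (show (0 : ℝ) ≤ (n : ℝ) ^ p by positivity),
    show Q ^ n / (1 - Q ^ n) = Q ^ n * (1 / (1 - Q ^ n)) by ring, abs_mul, abs_of_pos (show 0 < Q ^ n by positivity)]
  calc _ ≤ (n : ℝ) ^ p * (Q ^ n * (1 / (1 - Q))) := by gcongr
    _ = _ := by ring

theorem dec_t (h0 : 0 < Q) (h1 : Q < 1) : Dec Q (fun n => (Q ^ n / (1 + Q ^ n))) := by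
  refine ⟨1 / (1 - Q), 0, fun n => ?_⟩
  have hb := tQ_bound h0 h1 n
  unfold tQ at hb
  rw [zpow_natCast] at hb
  show |Q ^ n / (1 + Q ^ n)| ≤ _
  rw [show Q ^ n / (1 + Q ^ n) = Q ^ n * (1 / (1 + Q ^ n)) by ring, abs_mul, abs_of_pos (show 0 < Q ^ n by positivity)]
  calc _ ≤ (Q ^ n * (1 / (1 - Q))) := by gcongr
    _ = _ := by ring

theorem cs_bound {a : ℕ → ℝ} {C ρ : ℝ} {p : ℕ} (ha : ∀ n, |a n| ≤ C * (n : ℝ) ^ p * Q ^ n)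
    {ε : ℂ} (hε : ‖ε‖ = 1)
    {z : ℂ} (hρ : 0 < ρ) (hz : ρ ≤ ‖z‖) (hz1 : ‖z‖ ≤ 1) (n : ℕ) :
    ‖(a n : ℂ) * (z ^ n + ε * (z⁻¹) ^ n)‖ ≤ 2 * C * ((n : ℝ) ^ p * (Q / ρ) ^ n) := by
  rw [norm_mul, Complex.norm_real, Real.norm_eq_abs]
  have hr1 : ρ ≤ 1 := hz.trans hz1
  have h2 : ‖z ^ n + ε * (z⁻¹) ^ n‖ ≤ 2 * (ρ⁻¹) ^ n := by
    refine (norm_add_le _ _).trans ?_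
    rw [norm_mul, hε, one_mul, norm_pow, norm_pow, norm_inv]
    have e1 : ‖z‖ ^ n ≤ 1 := pow_le_one₀ (norm_nonneg _) hz1
    have e2 : 1 ≤ (ρ⁻¹) ^ n := one_le_pow₀ ((one_le_inv₀ hρ).2 hr1)
    have e3 : (‖z‖⁻¹) ^ n ≤ (ρ⁻¹) ^ n := by gcongr
    linarith
  calc _ ≤ (C * (n : ℝ) ^ p * Q ^ n) * (2 * (ρ⁻¹) ^ n) :=
        mul_le_mul (ha n) h2 (norm_nonneg _) ((abs_nonneg _).trans (ha n))
    _ = _ := by rw [div_eq_mul_inv, mul_pow]; ring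

theorem cs_bound_summable (h0 : 0 < Q) {ρ : ℝ} (hρ : Q < ρ) (C : ℝ) (p : ℕ) :
    Summable (fun n : ℕ => 2 * C * ((n : ℝ) ^ p * (Q / ρ) ^ n)) := by
  have hρ0 : 0 < ρ := h0.trans hρ
  have h : Summable (fun n : ℕ => ((n : ℝ) ^ p * (Q / ρ) ^ n)) := by
    refine summable_pow_mul_geometric_of_norm_lt_one (R := ℝ) p (r := Q / ρ) ?_
    rw [Real.norm_of_nonneg (by positivity)]
    exact (div_lt_one hρ0).2 hρ
  exact h.mul_left (2 * C)

theorem cs_hasSum (h0 : 0 < Q) {a : ℕ → ℝ} (ha : Dec Q a) {ε : ℂ} (hε : ‖ε‖ = 1) {z : ℂ}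
    (hz : Q < ‖z‖) (hz1 : ‖z‖ ≤ 1) :
    HasSum (fun n : ℕ => (a n : ℂ) * (z ^ n + ε * (z⁻¹) ^ n)) (cs ε a z) := by
  obtain ⟨C, p, h⟩ := ha
  exact (Summable.of_norm_bounded (cs_bound_summable h0 hz C p)
    (fun n => cs_bound h hε (h0.trans hz) le_rfl hz1 n)).hasSum

theorem cs_tendsto (h0 : 0 < Q) (h1 : Q < 1) {a : ℕ → ℝ} (ha : Dec Q a) {ε : ℂ} (hε : ‖ε‖ = 1) {ζ : ℂ}
    (hζ : ‖ζ‖ = 1) :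
    Filter.Tendsto (fun r : ℝ => cs ε a (r * ζ)) (nhdsWithin 1 (Set.Iio 1)) (nhds (cs ε a ζ)) := by
  obtain ⟨C, p, h⟩ := ha
  have hζ0 : ζ ≠ 0 := by intro h; rw [h] at hζ; simp at hζ
  refine tendsto_tsum_of_dominated_convergence
    (bound := fun n : ℕ => 2 * C * ((n : ℝ) ^ p * (Q / ((Q + 1) / 2)) ^ n))
    (cs_bound_summable h0 (by linarith) C p) ?_ ?_
  · intro n
    have hc : ContinuousAt (fun r : ℝ => (a n : ℂ) * (((r : ℂ) * ζ) ^ n + ε * (((r : ℂ) * ζ)⁻¹) ^ n)) 1 := by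
      have : ((1 : ℝ) : ℂ) * ζ ≠ 0 := by simpa using hζ0
      fun_prop (disch := assumption)
    have := hc.tendsto.mono_left (nhdsWithin_le_nhds (s := Set.Iio 1))
    simpa using this
  · have : Set.Ioo ((Q + 1) / 2) 1 ∈ nhdsWithin (1 : ℝ) (Set.Iio 1) := Ioo_mem_nhdsLT (by linarith)
    filter_upwards [this] with r hr n
    have hn : ‖(r : ℂ) * ζ‖ = r := by
      rw [norm_mul, hζ, mul_one, Complex.norm_real, Real.norm_of_nonneg]; linarith [hr.1]
    exact cs_bound h hε (by linarith) (by rw [hn]; exact hr.1.le) (by rw [hn]; exact hr.2.le) n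

theorem choose3 (n : ℕ) : ((n + 3).choose 3 : ℂ) = (n + 1) * (n + 2) * (n + 3) / 6 := by
  induction n with
  | zero => norm_num
  | succ n ih =>
    rw [show n + 1 + 3 = (n + 3) + 1 by ring, Nat.choose_succ_succ' (n + 3) 2, Nat.cast_add, ih,
      Nat.cast_choose_two]
    push_cast; ring

theorem hasSum_cube {z : ℂ} (hz : ‖z‖ < 1) :
    HasSum (fun n : ℕ => (n : ℂ) ^ 3 * z ^ n) (z * (1 + 4 * z + z ^ 2) / (1 - z) ^ 4) := by
  have h3 := (hasSum_choose_mul_geometric_of_norm_lt_one 3 hz).mul_left 6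
  have h2 := (hasSum_choose_mul_geometric_of_norm_lt_one 2 hz).mul_left 12
  have h1 := (hasSum_choose_mul_geometric_of_norm_lt_one 1 hz).mul_left 7
  have h0 := hasSum_geometric_of_norm_lt_one hz
  have hne : 1 - z ≠ 0 := by
    intro h
    have : z = 1 := by linear_combination -h
    rw [this] at hz; simp at hz
  refine hsc (((h3.sub h2).add h1).sub h0) (fun n => ?_) ?_
  · rw [choose3, Nat.cast_choose_two, Nat.choose_one_right]
    push_cast; ring
  · field_simp
    ring

theorem S_cs (h0 : 0 < Q) {z : ℂ} (hz : Q < ‖z‖) (hz1 : ‖z‖ < 1) (p : ℕ) (hp : Odd p) {w : ℂ}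
    (hw : HasSum (fun n : ℕ => (n : ℂ) ^ p * z ^ n) w) :
    S Q p z = w + cs 1 (fun n => (n : ℝ) ^ p * (Q ^ n / (1 - Q ^ n))) z := by
  have h1 := hz.trans hz1
  have h := ((adm_s h0 h1 p).hasSum (𝕜 := ℂ) h0 hz hz1).nat_add_neg
  have h2 := hw.add (cs_hasSum h0 (dec_s h0 h1 p) (ε := 1) (by simp) hz hz1.le)
  have := h.unique (hsc h2 (fun n => ?_) rfl)
  · rw [← this]; simp [S, sQ_zero]
  · by_cases hn : n = 0
    · have hp0 : p ≠ 0 := by rintro rfl; simp at hp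
      subst hn; simp [sQ, hp0]
    have e : (((-(n : ℤ)) : ℤ) : ℝ) ^ p = - (n : ℝ) ^ p := by push_cast; rw [hp.neg_pow]
    have h4 := one_sub_ne h0 h1 (n := (n : ℤ)) (by exact_mod_cast hn)
    have e2 : sQ Q n = 1 + Q ^ n / (1 - Q ^ n) := by
      unfold sQ
      rw [zpow_natCast] at *
      field_simp
      ring
    rw [sQ_neg h0 h1 (by exact_mod_cast hn), e, e2, zpow_neg, zpow_natCast, inv_pow]
    simp only [RCLike.ofReal_mul, RCLike.ofReal_add, RCLike.ofReal_sub, RCLike.ofReal_neg, RCLike.ofReal_one,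
      Complex.coe_algebraMap, RCLike.ofReal_pow]
    push_cast
    ring_nf

theorem T_cs (h0 : 0 < Q) {z : ℂ} (hz : Q < ‖z‖) (hz1 : ‖z‖ < 1) :
    T Q 0 z = (1 + z) / (1 - z) / 2 - cs (-1) (fun n => Q ^ n / (1 + Q ^ n)) z := by
  have h1 := hz.trans hz1
  have hne : 1 - z ≠ 0 := by
    intro h
    have : z = 1 := by linear_combination -h
    rw [this] at hz1; simp at hz1
  have h := ((adm_t h0 h1 0).hasSum (𝕜 := ℂ) h0 hz hz1).nat_add_neg
  have h2 := (hasSum_geometric_of_norm_lt_one hz1).sub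
    (cs_hasSum h0 (dec_t h0 h1) (ε := -1) (by simp) hz hz1.le)
  have := h.unique (hsc h2 (fun n => ?_) rfl)
  · have e : T Q 0 z = (1 - z)⁻¹ - cs (-1) (fun n => Q ^ n / (1 + Q ^ n)) z - 1 / 2 := by
      rw [← this]; simp [T, tQ]; norm_num
    rw [e]; field_simp; ring
  · have e2 : tQ Q n = 1 - Q ^ n / (1 + Q ^ n) := by
      have := one_add_ne h0 (n : ℤ)
      unfold tQ
      rw [zpow_natCast] at *
      field_simp
      ring
    rw [tQ_neg h0, e2, zpow_neg, zpow_natCast, inv_pow]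
    simp
    ring

/-- The identities on the unit circle. -/
theorem unit_circle (h0 : 0 < Q) (h1 : Q < 1) : ∃ c k : ℂ, ∀ ζ : ℂ, ‖ζ‖ = 1 → ζ ≠ 1 →
    ((1 + ζ) / (1 - ζ) / 2 - cs (-1) (fun n => Q ^ n / (1 + Q ^ n)) ζ) ^ 2 =
      k + (ζ / (1 - ζ) ^ 2 + cs 1 (fun n => (n : ℝ) ^ 1 * (Q ^ n / (1 - Q ^ n))) ζ) ∧
    ζ * (1 + 4 * ζ + ζ ^ 2) / (1 - ζ) ^ 4 + cs 1 (fun n => (n : ℝ) ^ 3 * (Q ^ n / (1 - Q ^ n))) ζ =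
      6 * (ζ / (1 - ζ) ^ 2 + cs 1 (fun n => (n : ℝ) ^ 1 * (Q ^ n / (1 - Q ^ n))) ζ) ^ 2
      + ((1 - 24 * Lam Q : ℝ) : ℂ) * (ζ / (1 - ζ) ^ 2 + cs 1 (fun n => (n : ℝ) ^ 1 * (Q ^ n / (1 - Q ^ n))) ζ)
      + c := by
  obtain ⟨c, hc⟩ := C2 (𝕜 := ℂ) h0 h1
  refine ⟨c, (kap Q : ℂ), fun ζ hζ hne => ?_⟩
  have hne' : 1 - ((1 : ℝ) : ℂ) * ζ ≠ 0 := by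
    rw [Complex.ofReal_one, one_mul]
    exact sub_ne_zero.2 hne.symm
  have t1 := cs_tendsto h0 h1 (dec_s h0 h1 1) (ε := 1) (by simp) hζ
  have t3 := cs_tendsto h0 h1 (dec_s h0 h1 3) (ε := 1) (by simp) hζ
  have tt := cs_tendsto h0 h1 (dec_t h0 h1) (ε := -1) (by simp) hζ
  have a1 : Filter.Tendsto (fun r : ℝ => (r * ζ) / (1 - r * ζ) ^ 2) (nhdsWithin 1 (Set.Iio 1))
      (nhds (ζ / (1 - ζ) ^ 2)) := by
    have hc : ContinuousAt (fun r : ℝ => ((r : ℂ) * ζ) / (1 - r * ζ) ^ 2) 1 := by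
      have := pow_ne_zero 2 hne'
      fun_prop (disch := assumption)
    simpa using hc.tendsto.mono_left (nhdsWithin_le_nhds (s := Set.Iio 1))
  have a3 : Filter.Tendsto (fun r : ℝ => (r * ζ) * (1 + 4 * (r * ζ) + (r * ζ) ^ 2) / (1 - r * ζ) ^ 4)
      (nhdsWithin 1 (Set.Iio 1)) (nhds (ζ * (1 + 4 * ζ + ζ ^ 2) / (1 - ζ) ^ 4)) := by
    have hc : ContinuousAt (fun r : ℝ => ((r : ℂ) * ζ) * (1 + 4 * (r * ζ) + (r * ζ) ^ 2) / (1 - r * ζ) ^ 4) 1 := by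
      have := pow_ne_zero 4 hne'
      fun_prop (disch := assumption)
    simpa using hc.tendsto.mono_left (nhdsWithin_le_nhds (s := Set.Iio 1))
  have a0 : Filter.Tendsto (fun r : ℝ => (1 + r * ζ) / (1 - r * ζ) / 2) (nhdsWithin 1 (Set.Iio 1))
      (nhds ((1 + ζ) / (1 - ζ) / 2)) := by
    have hc : ContinuousAt (fun r : ℝ => (1 + (r : ℂ) * ζ) / (1 - r * ζ) / 2) 1 := by
      fun_prop (disch := assumption)
    simpa using hc.tendsto.mono_left (nhdsWithin_le_nhds (s := Set.Iio 1))
  have hmem : Set.Ioo Q 1 ∈ nhdsWithin (1 : ℝ) (Set.Iio 1) := Ioo_mem_nhdsLT (by linarith)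
  have hn : ∀ r ∈ Set.Ioo Q 1, ‖(r : ℂ) * ζ‖ = r := by
    intro r hr
    rw [norm_mul, hζ, mul_one, Complex.norm_real, Real.norm_of_nonneg]; linarith [hr.1]
  constructor
  · refine tendsto_nhds_unique_of_eventuallyEq ((a0.sub tt).pow 2) ((a1.add t1).const_add _) ?_
    filter_upwards [hmem] with r hr
    have e := hn r hr
    have hz : Q < ‖(r : ℂ) * ζ‖ := by rw [e]; exact hr.1
    have hz1 : ‖(r : ℂ) * ζ‖ < 1 := by rw [e]; exact hr.2
    have := C1 (𝕜 := ℂ) h0 hz hz1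
    rw [T_cs h0 hz hz1, S_cs h0 hz hz1 1 odd_one
      (by simpa using hasSum_coe_mul_geometric_of_norm_lt_one hz1)] at this
    exact this
  · refine tendsto_nhds_unique_of_eventuallyEq (a3.add t3)
      (((((a1.add t1).pow 2).const_mul 6).add ((a1.add t1).const_mul _)).add_const _) ?_
    filter_upwards [hmem] with r hr
    have e := hn r hr
    have hz : Q < ‖(r : ℂ) * ζ‖ := by rw [e]; exact hr.1
    have hz1 : ‖(r : ℂ) * ζ‖ < 1 := by rw [e]; exact hr.2
    have := hc _ hz hz1
    rw [S_cs h0 hz hz1 3 (by decide) (hasSum_cube hz1), S_cs h0 hz hz1 1 odd_one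
      (by simpa using hasSum_coe_mul_geometric_of_norm_lt_one hz1), lamH_eq h0 h1] at this
    exact this

end RF5

namespace RF5
variable {q : ℝ}

section root
variable {r i : ℂ}

theorem root_inv (hr : r ^ 2 = 2) (hi : i ^ 2 = -1) : (r / 2 * (1 + i))⁻¹ = r / 2 * (1 - i) := by
  refine inv_eq_of_mul_eq_one_right ?_
  linear_combination (1 - i ^ 2) / 4 * hr - 1 / 2 * hi

theorem root_sq (hr : r ^ 2 = 2) (hi : i ^ 2 = -1) : (r / 2 * (1 + i)) ^ 2 = i := by
  linear_combination (1 + i) ^ 2 / 4 * hr + 1 / 2 * hi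

theorem root_pow8 (hr : r ^ 2 = 2) (hi : i ^ 2 = -1) : (r / 2 * (1 + i)) ^ 8 = 1 := by
  rw [show (r / 2 * (1 + i)) ^ 8 = (((r / 2 * (1 + i)) ^ 2) ^ 2) ^ 2 by ring, root_sq hr hi, hi]; ring

theorem root_table (hr : r ^ 2 = 2) (hi : i ^ 2 = -1) (n : ℕ) :
    (r / 2 * (1 + i)) ^ n = r * (c8 n : ℂ) / 2 + (rc 0 n - rc 4 n : ℝ) + i * (r * (d8 n : ℂ) / 2 + (s8 n : ℂ)) := by
  obtain ⟨k, j, rfl, hj, h⟩ := rc_cases n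
  unfold c8 d8 s8
  simp only [h]
  rw [pow_add, pow_mul, root_pow8 hr hi, one_pow, one_mul]
  have e2 := root_sq hr hi
  have e4 : (r / 2 * (1 + i)) ^ 4 = -1 := by
    rw [show (r / 2 * (1 + i)) ^ 4 = (((r / 2 * (1 + i)) ^ 2) ^ 2) by ring, root_sq hr hi, hi]
  interval_cases j
  · simp [rc]
  · simp [rc]; ring
  · rw [e2]; simp [rc]
  · rw [pow_succ, e2]; simp [rc]; linear_combination r / 2 * hi
  · rw [e4]; simp [rc]
  · rw [pow_succ, e4]; simp [rc]; ring
  · rw [show 6 = 4 + 2 by rfl, pow_add, e4, e2]; simp [rc]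
  · rw [show 7 = 4 + 2 + 1 by rfl, pow_succ, pow_add, e4, e2]; simp [rc]; linear_combination -r / 2 * hi

theorem rootinv_table (hr : r ^ 2 = 2) (hi : i ^ 2 = -1) (n : ℕ) :
    ((r / 2 * (1 + i))⁻¹) ^ n = r * (c8 n : ℂ) / 2 + (rc 0 n - rc 4 n : ℝ) - i * (r * (d8 n : ℂ) / 2 + (s8 n : ℂ)) := by
  have := root_table (i := -i) hr (by linear_combination hi) n
  rw [root_inv hr hi, show r / 2 * (1 - i) = r / 2 * (1 + -i) by ring, this]; ring

end root

theorem cs_one_eval {a : ℕ → ℝ} {X Y : ℝ} {r i : ℂ} (hr : r ^ 2 = 2) (hi : i ^ 2 = -1)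
    (hX : HasSum (fun n => c8 n * a n) X) (hY : HasSum (fun n => (rc 0 n - rc 4 n) * a n) Y) :
    cs 1 a (r / 2 * (1 + i)) = r * X + 2 * Y := by
  have h1 := ((Complex.hasSum_ofReal.2 hX).mul_left r).add ((Complex.hasSum_ofReal.2 hY).mul_left 2)
  refine HasSum.tsum_eq (hsc h1 (fun n => ?_) rfl)
  rw [root_table hr hi, rootinv_table hr hi]
  push_cast; ring

theorem cs_neg_eval {a : ℕ → ℝ} {X Y : ℝ} {r i : ℂ} (hr : r ^ 2 = 2) (hi : i ^ 2 = -1)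
    (hX : HasSum (fun n => d8 n * a n) X) (hY : HasSum (fun n => s8 n * a n) Y) :
    cs (-1) a (r / 2 * (1 + i)) = i * (r * X + 2 * Y) := by
  have h1 := (((Complex.hasSum_ofReal.2 hX).mul_left r).add ((Complex.hasSum_ofReal.2 hY).mul_left 2)).mul_left i
  refine HasSum.tsum_eq (hsc h1 (fun n => ?_) rfl)
  rw [root_table hr hi, rootinv_table hr hi]
  push_cast; ring

theorem dec_summable (h0 : 0 < q) (h1 : q < 1) {a : ℕ → ℝ} (ha : Dec q a) {f : ℕ → ℝ} (hf : ∀ n, |f n| ≤ 1) :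
    Summable (fun n => f n * a n) := by
  obtain ⟨C, p, h⟩ := ha
  have hs := (summable_pow_mul_geometric_of_norm_lt_one (R := ℝ) p (r := q)
    (by rwa [Real.norm_of_nonneg h0.le])).mul_left C
  refine Summable.of_norm_bounded hs (fun n => ?_)
  rw [Real.norm_eq_abs, abs_mul]
  calc _ ≤ 1 * |a n| := by gcongr; exact hf n
    _ ≤ _ := by rw [one_mul, ← mul_assoc]; exact h n

theorem mult_sum (h0 : 0 < q) (h1 : q < 1) {m : ℕ} (hm : 0 < m) :
    HasSum (fun n : ℕ => (if m ∣ n then (1 : ℝ) else 0) * ((n : ℝ) ^ 1 * (q ^ n / (1 - q ^ n)))) (m * Lam (q ^ m)) := by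
  have h := ((Lam_both (q := q ^ m) (by positivity) (pow_lt_one₀ h0.le h1 hm.ne')).1).mul_left (m : ℝ)
  have hinj : Function.Injective (fun k : ℕ => m * k) := by
    intro a b h; exact Nat.eq_of_mul_eq_mul_left hm h
  refine (hinj.hasSum_iff ?_).1 (hsc h (fun k => ?_) rfl)
  · intro n hn
    rw [if_neg, zero_mul]
    rintro ⟨k, rfl⟩
    exact hn ⟨k, rfl⟩
  · simp only [Function.comp]
    rw [if_pos (Dvd.intro _ rfl), pow_mul]; push_cast; ring

theorem c_sum (h0 : 0 < q) (h1 : q < 1) :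
    HasSum (fun n : ℕ => (rc 0 n - rc 4 n) * ((n : ℝ) ^ 1 * (q ^ n / (1 - q ^ n))))
      (16 * Lam (q ^ 8) - 4 * Lam (q ^ 4)) := by
  refine hsc (((mult_sum h0 h1 (m := 8) (by norm_num)).mul_left 2).sub
    (mult_sum h0 h1 (m := 4) (by norm_num))) (fun n => ?_) (by push_cast; ring)
  have : rc 0 n - rc 4 n = 2 * (if 8 ∣ n then (1 : ℝ) else 0) - (if 4 ∣ n then (1 : ℝ) else 0) := by
    unfold rc
    split_ifs <;> first | omega | norm_num
  rw [this]; ring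

theorem c_le (n : ℕ) : |rc 0 n - rc 4 n| ≤ 1 := by
  obtain ⟨k, j, rfl, hj, h⟩ := rc_cases n
  simp only [h]
  interval_cases j <;> simp [rc]

/-- The Eisenstein series with character in closed form. -/
theorem G_hasSum (h0 : 0 < q) (h1 : q < 1) :
    HasSum (fun n : ℕ => c8 n * ((n : ℝ) ^ 3 * (q ^ n / (1 - q ^ n))))
     (-11 / 2 + th (q ^ 2) * (th (q ^ 4) - tb q) * (th (q ^ 4) ^ 2 - tb q ^ 2) / 2 *
      (2 * (th (q ^ 4) + tb q) ^ 4 - (th (q ^ 4) - tb q) ^ 4 + 6 * (th (q ^ 4) ^ 2 + tb q ^ 2) ^ 2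
        + 4 * (th (q ^ 4) ^ 4 + tb q ^ 4))) := by
  have hX1 := (dec_summable h0 h1 (dec_s h0 h1 1) (fun n => (chars_le n).1)).hasSum
  have hX3 := (dec_summable h0 h1 (dec_s h0 h1 3) (fun n => (chars_le n).1)).hasSum
  have hY3 := (dec_summable h0 h1 (dec_s h0 h1 3) c_le).hasSum
  set X1 := ∑' n : ℕ, c8 n * ((n : ℝ) ^ 1 * (q ^ n / (1 - q ^ n))) with hX1d
  set X3 := ∑' n : ℕ, c8 n * ((n : ℝ) ^ 3 * (q ^ n / (1 - q ^ n))) with hX3d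
  set Y3 := ∑' n : ℕ, (rc 0 n - rc 4 n) * ((n : ℝ) ^ 3 * (q ^ n / (1 - q ^ n))) with hY3d
  have hY1 := c_sum h0 h1
  have hD := B8p_hasSum h0 h1
  have hE := B4p_hasSum h0 h1
  set Y1 := 16 * Lam (q ^ 8) - 4 * Lam (q ^ 4) with hY1d
  set u := th (q ^ 2) * (th (q ^ 4) - tb q) / 2 with hu
  set v := (th (q ^ 4) ^ 2 - tb q ^ 2) / 2 with hv
  obtain ⟨c, k, H⟩ := unit_circle h0 h1
  have main : ∀ r i : ℂ, r ^ 2 = 2 → i ^ 2 = -1 →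
      (i * (r * u + v)) ^ 2 = k + (-1 - r / 2 + (r * X1 + 2 * Y1)) ∧
      8 + 11 / 2 * r + (r * X3 + 2 * Y3) = 6 * (-1 - r / 2 + (r * X1 + 2 * Y1)) ^ 2
        + ((1 - 24 * Lam q : ℝ) : ℂ) * (-1 - r / 2 + (r * X1 + 2 * Y1)) + c := by
    intro r i hr hi
    have hn : ‖r / 2 * (1 + i)‖ = 1 := norm_eq_one_of_pow_eq_one (root_pow8 hr hi) (by norm_num)
    have hne : r / 2 * (1 + i) ≠ 1 := by
      intro h
      have := root_sq hr hi
      rw [h] at this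
      rw [← this] at hi
      norm_num at hi
    obtain ⟨H1, H2⟩ := H _ hn hne
    have hsub : 1 - r / 2 * (1 + i) ≠ 0 := sub_ne_zero.2 hne.symm
    have k1 : (1 + r / 2 * (1 + i)) / (1 - r / 2 * (1 + i)) / 2 = i * (r + 1) / 2 := by
      rw [div_div, div_eq_div_iff (by simpa using hsub) (by norm_num)]
      linear_combination (i + i ^ 2) * hr + (r + 2) * hi
    have k2 : (r / 2 * (1 + i)) / (1 - r / 2 * (1 + i)) ^ 2 = -1 - r / 2 := by
      rw [div_eq_iff (pow_ne_zero 2 hsub)]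
      rw [show (1 - r / 2 * (1 + i)) ^ 2 = 1 - r * (1 + i) + (r / 2 * (1 + i)) ^ 2 by ring, root_sq hr hi]
      linear_combination -(1 + i) / 2 * hr
    have k3 : r / 2 * (1 + i) * (1 + 4 * (r / 2 * (1 + i)) + (r / 2 * (1 + i)) ^ 2) / (1 - r / 2 * (1 + i)) ^ 4
        = 8 + 11 / 2 * r := by
      rw [show r / 2 * (1 + i) * (1 + 4 * (r / 2 * (1 + i)) + (r / 2 * (1 + i)) ^ 2) / (1 - r / 2 * (1 + i)) ^ 4 =
        (r / 2 * (1 + i)) / (1 - r / 2 * (1 + i)) ^ 2 +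
          6 * ((r / 2 * (1 + i)) / (1 - r / 2 * (1 + i)) ^ 2) ^ 2 by field_simp; ring, k2]
      linear_combination 3 / 2 * hr
    rw [k1, k2, cs_one_eval hr hi hX1 hY1, cs_neg_eval hr hi hD hE] at H1
    rw [k2, k3, cs_one_eval hr hi hX1 hY1, cs_one_eval hr hi hX3 hY3] at H2
    refine ⟨?_, H2⟩
    rw [← H1]
    push_cast [hu, hv]
    ring
  set r : ℂ := ((Real.sqrt 2 : ℝ) : ℂ) with hrd
  have hr : r ^ 2 = 2 := by
    rw [hrd, ← Complex.ofReal_pow, Real.sq_sqrt (by norm_num)]; norm_num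
  have hr0 : r ≠ 0 := by intro h; rw [h] at hr; norm_num at hr
  obtain ⟨p1, p2⟩ := main r I hr (by simp)
  obtain ⟨m1, m2⟩ := main (-r) (-I) (by rw [neg_sq]; exact hr) (by simp)
  have f1 : (X1 : ℂ) = 1 / 2 - 2 * u * v := by
    apply mul_left_cancel₀ hr0
    rw [mul_pow, I_sq] at p1
    rw [mul_pow, neg_sq, I_sq] at m1
    linear_combination (m1 - p1) / 2
  have f2 : (X3 : ℂ) = -11 / 2 + u * v * (22 + 48 * Lam q - 48 * Y1) := by
    apply mul_left_cancel₀ hr0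
    rw [f1] at p2 m2
    push_cast at p2 m2
    linear_combination (p2 - m2) / 2
  have f3 : X3 = -11 / 2 + u * v * (22 + 48 * Lam q - 48 * Y1) := by exact_mod_cast f2
  have e1 := V_eq h0 h1
  have e2 := th2_four h0 h1
  have e3 := V4_eq h0 h1
  rw [th_p h0 h1, th_n h0 h1] at e1
  refine hsc hX3 (fun n => rfl) ?_
  rw [f3, ← e1, e2, ← e3, hu, hv, hY1d]
  ring

/-- The version at `q ^ 2`, in terms of the parameters at `q`. -/
theorem G2_hasSum (h0 : 0 < q) (h1 : q < 1) :
    HasSum (fun n : ℕ => c8 n * ((n : ℝ) ^ 3 * ((q ^ 2) ^ n / (1 - (q ^ 2) ^ n))))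
     (-11 / 2 + th (q ^ 4) * th (q ^ 2) * (th (q ^ 4) ^ 2 - tb q ^ 2) / 2 *
      (11 * th (q ^ 4) ^ 4 + 6 * th (q ^ 4) ^ 2 * tb q ^ 2 - tb q ^ 4)) := by
  have hq2 : q ^ 2 < 1 := pow_lt_one₀ h0.le h1 (by norm_num)
  have hq20 : 0 < q ^ 2 := by positivity
  refine hsc (G_hasSum hq20 hq2) (fun n => rfl) ?_
  have e1 := th_p hq20 hq2
  have e2 := th_n hq20 hq2
  have e3 := th2_sq hq20 hq2
  have e4 := th2_sq h0 h1
  have e5 := th2n_sq h0 h1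
  simp only [← pow_mul] at *
  norm_num at *
  generalize th (q ^ 8) = A at *
  generalize tb (q ^ 2) = B at *
  generalize th (q ^ 4) = a at *
  generalize tb q = b at *
  generalize th (q ^ 2) = f at *
  generalize th (-q ^ 2) = g at *
  have k1 : (A - B) * (A ^ 2 - B ^ 2) = f * (a ^ 2 - b ^ 2) := by
    rw [show (A - B) * (A ^ 2 - B ^ 2) = (A + B) * (A - B) ^ 2 by ring, ← e1, ← e2, e5]
  have k2 : A * B = b ^ 2 / 2 := by
    rw [show A * B = ((A + B) ^ 2 - (A - B) ^ 2) / 4 by ring, ← e1, ← e2, e4, e5]; ring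
  have k3 : (A + B) ^ 4 = (a ^ 2 + b ^ 2) ^ 2 := by rw [← e1, ← e4]; ring
  have k4 : (A - B) ^ 4 = (a ^ 2 - b ^ 2) ^ 2 := by rw [← e2, ← e5]; ring
  have k5 : A ^ 4 + B ^ 4 = a ^ 4 - b ^ 4 / 2 := by
    rw [show A ^ 4 + B ^ 4 = (A ^ 2 + B ^ 2) ^ 2 - 2 * (A * B) ^ 2 by ring, k2, ← e3]; ring
  rw [mul_assoc a (A - B), k1, k3, k4, k5, ← e3]
  ring

end RF5

namespace RF5
variable {q : ℝ}

/-- finite Pochhammer product -/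
noncomputable def pP (x : ℝ) (n : ℕ) : ℝ := ∏ k ∈ range n, (1 - x ^ (k + 1))

/-- Euler product -/
noncomputable def eP (x : ℝ) : ℝ := ∏' m : ℕ, (1 - x ^ (m + 1))

theorem pP_succ (x : ℝ) (n : ℕ) : pP x (n + 1) = pP x n * (1 - x ^ (n + 1)) := by
  unfold pP; rw [prod_range_succ]

theorem pP_pos {x : ℝ} (h0 : 0 < x) (h1 : x < 1) (n : ℕ) : 0 < pP x n := by
  unfold pP
  exact prod_pos fun k _ => by
    have : x ^ (k + 1) < 1 := pow_lt_one₀ h0.le h1 (Nat.succ_ne_zero k)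
    linarith

theorem pP_anti {x : ℝ} (h0 : 0 < x) (h1 : x < 1) : Antitone (pP x) := by
  refine antitone_nat_of_succ_le fun n => ?_
  rw [pP_succ]
  have := pP_pos h0 h1 n
  have h2 : 0 < x ^ (n + 1) := by positivity
  nlinarith

theorem pP_tendsto {x : ℝ} (h0 : 0 < x) (h1 : x < 1) : Filter.Tendsto (pP x) Filter.atTop (nhds (eP x)) := by
  have hs : Summable (fun n : ℕ => ‖-x ^ (n + 1)‖) := by
    refine ((summable_nat_add_iff 1).mpr (summable_geometric_of_lt_one h0.le h1)).congr (fun n => ?_)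
    rw [norm_neg, Real.norm_of_nonneg (by positivity)]
  have := (multipliable_one_add_of_summable hs).hasProd.tendsto_prod_nat
  simp only [← sub_eq_add_neg] at this
  exact this

theorem eP_ne {x : ℝ} (h0 : 0 < x) (h1 : x < 1) : eP x ≠ 0 := by
  have hs : Summable (fun n : ℕ => ‖-x ^ (n + 1)‖) := by
    refine ((summable_nat_add_iff 1).mpr (summable_geometric_of_lt_one h0.le h1)).congr (fun n => ?_)
    rw [norm_neg, Real.norm_of_nonneg (by positivity)]
  have := tprod_one_add_ne_zero_of_summable (f := fun n : ℕ => -x ^ (n + 1)) (fun n => by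
    have := pow_lt_one₀ h0.le h1 (Nat.succ_ne_zero n)
    rw [Nat.succ_eq_add_one] at this
    intro h; linarith) hs
  simp only [← sub_eq_add_neg] at this
  exact this

theorem eP_pos {x : ℝ} (h0 : 0 < x) (h1 : x < 1) : 0 < eP x :=
  lt_of_le_of_ne (ge_of_tendsto' (pP_tendsto h0 h1) fun n => (pP_pos h0 h1 n).le) (eP_ne h0 h1).symm

theorem eP_le {x : ℝ} (h0 : 0 < x) (h1 : x < 1) (n : ℕ) : eP x ≤ pP x n :=
  (pP_anti h0 h1).le_of_tendsto (pP_tendsto h0 h1) n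

/-- inverse Pochhammer on the integers -/
noncomputable def iP (x : ℝ) (m : ℤ) : ℝ := if 0 ≤ m then (pP x m.toNat)⁻¹ else 0

theorem iP_step {x : ℝ} (h0 : 0 < x) (h1 : x < 1) (m : ℤ) : iP x (m - 1) = (1 - x ^ m) * iP x m := by
  rcases lt_trichotomy m 0 with h | rfl | h
  · rw [iP, iP, if_neg (by omega), if_neg (by omega), mul_zero]
  · simp [iP]
  · obtain ⟨k, rfl⟩ : ∃ k : ℕ, m = k + 1 := ⟨(m - 1).toNat, by omega⟩
    rw [iP, iP, if_pos (by omega), if_pos (by omega)]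
    rw [show ((k : ℤ) + 1 - 1).toNat = k by omega, show ((k : ℤ) + 1).toNat = k + 1 by omega, pP_succ]
    have h2 := (pP_pos h0 h1 k).ne'
    have h3 : 1 - x ^ (k + 1) ≠ 0 := by
      have := pow_lt_one₀ h0.le h1 (Nat.succ_ne_zero k)
      rw [Nat.succ_eq_add_one] at this
      intro h; linarith
    have : x ^ ((k : ℤ) + 1) = x ^ (k + 1) := by rw [← zpow_natCast]; push_cast; rfl
    rw [this]
    field_simp

theorem iP_nonneg {x : ℝ} (h0 : 0 < x) (h1 : x < 1) (m : ℤ) : 0 ≤ iP x m := by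
  unfold iP; split_ifs
  · exact inv_nonneg.2 (pP_pos h0 h1 _).le
  · exact le_rfl

theorem iP_le {x : ℝ} (h0 : 0 < x) (h1 : x < 1) (m : ℤ) : iP x m ≤ (eP x)⁻¹ := by
  unfold iP; split_ifs
  · exact inv_anti₀ (eP_pos h0 h1) (eP_le h0 h1 _)
  · exact inv_nonneg.2 (eP_pos h0 h1).le

/-- symmetric Gaussian binomial -/
noncomputable def gB (x : ℝ) (n : ℕ) (j : ℤ) : ℝ := pP x (2 * n) * (iP x (n - j) * iP x (n + j))

theorem gB_step {x : ℝ} (h0 : 0 < x) (h1 : x < 1) (n : ℕ) (j : ℤ) :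
    gB x (n + 1) j = (1 + x ^ (2 * n + 1)) * gB x n j + x ^ ((n : ℤ) + 1 - j) * gB x n (j - 1)
      + x ^ ((n : ℤ) + 1 + j) * gB x n (j + 1) := by
  unfold gB
  rw [show 2 * (n + 1) = 2 * n + 1 + 1 by ring, pP_succ, pP_succ]
  have e1 : iP x (n - j) = (1 - x ^ ((n : ℤ) + 1 - j)) * iP x (n + 1 - j) := by
    rw [← iP_step h0 h1]; congr 1; ring
  have e2 : iP x (n + j) = (1 - x ^ ((n : ℤ) + 1 + j)) * iP x (n + 1 + j) := by
    rw [← iP_step h0 h1]; congr 1; ring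
  have e3 : iP x (n - (j - 1)) = iP x (n + 1 - j) := by congr 1; ring
  have e4 : iP x (n + (j + 1)) = iP x (n + 1 + j) := by congr 1; ring
  have e5 : iP x (n + (j - 1)) = (1 - x ^ ((n : ℤ) + 1 + j) / x) * iP x (n + j) := by
    rw [show (n : ℤ) + (j - 1) = n + j - 1 by ring, iP_step h0 h1, div_eq_mul_inv, ← zpow_sub_one₀ h0.ne']
    congr 3; ring
  have e6 : iP x (n - (j + 1)) = (1 - x ^ ((n : ℤ) + 1 - j) / x) * iP x (n - j) := by
    rw [show (n : ℤ) - (j + 1) = n - j - 1 by ring, iP_step h0 h1, div_eq_mul_inv, ← zpow_sub_one₀ h0.ne']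
    congr 3; ring
  have e7 : x ^ (2 * n + 1 + 1) = x ^ ((n : ℤ) + 1 - j) * x ^ ((n : ℤ) + 1 + j) := by
    rw [← zpow_add₀ h0.ne', ← zpow_natCast]; congr 1; push_cast; ring
  have e8 : x ^ (2 * n + 1) = x ^ ((n : ℤ) + 1 - j) * x ^ ((n : ℤ) + 1 + j) / x := by
    rw [← e7, pow_succ x (2 * n + 1), mul_div_cancel_right₀ _ h0.ne']
  push_cast
  rw [e3, e4, e5, e6, e1, e2, e7, e8]
  generalize x ^ ((n : ℤ) + 1 - j) = X
  generalize x ^ ((n : ℤ) + 1 + j) = Y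
  field_simp
  ring

theorem jtp_finite (h0 : 0 < q) (h1 : q < 1) {z : ℝ} (hz : z ≠ 0) (n : ℕ) :
    HasSum (fun j : ℤ => gB (q ^ 2) n j * (q ^ (j ^ 2) * z ^ j))
      (∏ k ∈ range n, ((1 + z * q ^ (2 * k + 1)) * (1 + z⁻¹ * q ^ (2 * k + 1)))) := by
  have hQ0 : 0 < q ^ 2 := by positivity
  have hQ1 : q ^ 2 < 1 := pow_lt_one₀ h0.le h1 (by norm_num)
  induction n with
  | zero =>
    have := hasSum_ite_eq (0 : ℤ) (1 : ℝ)
    refine hsc this (fun j => ?_) (by simp)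
    split_ifs with h
    · subst h; simp [gB, iP, pP]
    · have : iP (q ^ 2) ((0 : ℕ) - j) * iP (q ^ 2) ((0 : ℕ) + j) = 0 := by
        unfold iP
        rcases lt_or_gt_of_ne h with h | h
        · rw [if_neg (c := 0 ≤ ((0 : ℕ) : ℤ) + j) (by push_cast; omega), mul_zero]
        · rw [if_neg (by push_cast; omega), zero_mul]
      rw [gB, this]; ring
  | succ n ih =>
    have s1 := (ih.mul_left (1 + (q ^ 2) ^ (2 * n + 1)))
    have s2 := ((hasSum_shift ih 1).mul_left (q ^ (2 * n + 1) * z))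
    have s3 := ((hasSum_shift ih (-1)).mul_left (q ^ (2 * n + 1) * z⁻¹))
    refine hsc ((s1.add s2).add s3) (fun j => ?_) ?_
    · simp only [sub_neg_eq_add]
      rw [gB_step hQ0 hQ1]
      have f1 : q ^ ((j - 1) ^ 2) = q ^ (j ^ 2) * q ^ (1 - 2 * j) := by
        rw [← zpow_add₀ h0.ne']; congr 1; ring
      have f2 : q ^ ((j + 1) ^ 2) = q ^ (j ^ 2) * q ^ (1 + 2 * j) := by
        rw [← zpow_add₀ h0.ne']; congr 1; ring
      have f3 : (q ^ 2) ^ ((n : ℤ) + 1 - j) = q ^ (2 * n + 1) * q ^ (1 - 2 * j) := by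
        rw [← zpow_natCast, ← zpow_natCast, ← zpow_mul, ← zpow_add₀ h0.ne']; congr 1; push_cast; ring
      have f4 : (q ^ 2) ^ ((n : ℤ) + 1 + j) = q ^ (2 * n + 1) * q ^ (1 + 2 * j) := by
        rw [← zpow_natCast, ← zpow_natCast, ← zpow_mul, ← zpow_add₀ h0.ne']; congr 1; push_cast; ring
      rw [f1, f2, f3, f4, zpow_sub_one₀ hz, zpow_add_one₀ hz]
      field_simp
    · rw [prod_range_succ]
      field_simp
      ring

theorem toNat_tendsto (j : ℤ) : Filter.Tendsto (fun n : ℕ => ((n : ℤ) + j).toNat) Filter.atTop Filter.atTop := by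
  refine Filter.tendsto_atTop_atTop.2 fun b => ⟨b + j.natAbs, fun n hn => by omega⟩

theorem iP_tendsto {x : ℝ} (h0 : 0 < x) (h1 : x < 1) (j : ℤ) :
    Filter.Tendsto (fun n : ℕ => iP x (n + j)) Filter.atTop (nhds (eP x)⁻¹) := by
  have h := (((pP_tendsto h0 h1).comp (toNat_tendsto j))).inv₀ (eP_ne h0 h1)
  refine h.congr' ?_
  filter_upwards [Filter.eventually_ge_atTop j.natAbs] with n hn
  rw [iP, if_pos (by omega)]; rfl

theorem jtp (h0 : 0 < q) (h1 : q < 1) {z : ℝ} (hz : z ≠ 0) {s : ℝ}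
    (hs : Summable (fun j : ℤ => ‖q ^ (j ^ 2) * z ^ j‖))
    (hp : Filter.Tendsto (fun n => ∏ k ∈ range n, ((1 + z * q ^ (2 * k + 1)) * (1 + z⁻¹ * q ^ (2 * k + 1))))
      Filter.atTop (nhds s)) :
    HasSum (fun j : ℤ => q ^ (j ^ 2) * z ^ j) (eP (q ^ 2) * s) := by
  have hQ0 : 0 < q ^ 2 := by positivity
  have hQ1 : q ^ 2 < 1 := pow_lt_one₀ h0.le h1 (by norm_num)
  have hE := eP_pos hQ0 hQ1
  have hd : Filter.Tendsto (fun n : ℕ => ∑' j : ℤ, gB (q ^ 2) n j * (q ^ (j ^ 2) * z ^ j)) Filter.atTop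
      (nhds (∑' j : ℤ, (eP (q ^ 2))⁻¹ * (q ^ (j ^ 2) * z ^ j))) := by
    refine tendsto_tsum_of_dominated_convergence
      (bound := fun j : ℤ => ((eP (q ^ 2))⁻¹) ^ 2 * ‖q ^ (j ^ 2) * z ^ j‖) (hs.mul_left _) ?_ ?_
    · intro j
      refine Filter.Tendsto.mul_const _ ?_
      have t1 : Filter.Tendsto (fun n : ℕ => pP (q ^ 2) (2 * n)) Filter.atTop (nhds (eP (q ^ 2))) :=
        (pP_tendsto hQ0 hQ1).comp (Filter.tendsto_atTop_atTop.2 fun b => ⟨b, fun n hn => by omega⟩)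
      have t2 := t1.mul ((iP_tendsto hQ0 hQ1 (-j)).mul (iP_tendsto hQ0 hQ1 j))
      rw [mul_inv_cancel_left₀ hE.ne'] at t2
      exact t2
    · refine Filter.Eventually.of_forall fun n j => ?_
      rw [norm_mul]
      refine mul_le_mul_of_nonneg_right ?_ (norm_nonneg _)
      have a1 := iP_nonneg hQ0 hQ1 (n - j)
      have a2 := iP_nonneg hQ0 hQ1 (n + j)
      have b1 := iP_le hQ0 hQ1 (n - j)
      have b2 := iP_le hQ0 hQ1 (n + j)
      have c1 := (pP_pos hQ0 hQ1 (2 * n)).le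
      have c2 : pP (q ^ 2) (2 * n) ≤ 1 := by
        have := pP_anti hQ0 hQ1 (Nat.zero_le (2 * n)); simpa [pP] using this
      rw [gB, Real.norm_of_nonneg (by positivity)]
      calc _ ≤ 1 * ((eP (q ^ 2))⁻¹ * (eP (q ^ 2))⁻¹) := by gcongr
        _ = _ := by ring
  have h2 : (fun n : ℕ => ∑' j : ℤ, gB (q ^ 2) n j * (q ^ (j ^ 2) * z ^ j)) =
      fun n => ∏ k ∈ range n, ((1 + z * q ^ (2 * k + 1)) * (1 + z⁻¹ * q ^ (2 * k + 1))) :=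
    funext fun n => (jtp_finite h0 h1 hz n).tsum_eq
  rw [h2, tsum_mul_left] at hd
  have := tendsto_nhds_unique hd hp
  rw [← this, mul_inv_cancel_left₀ hE.ne']
  exact hs.of_norm.hasSum

/-- odd product -/
theorem odd_prod_tendsto (h0 : 0 < q) (h1 : q < 1) :
    Filter.Tendsto (fun n => ∏ k ∈ range n, (1 - q ^ (2 * k + 1))) Filter.atTop (nhds (eP q / eP (q ^ 2))) := by
  have hQ0 : 0 < q ^ 2 := by positivity
  have hQ1 : q ^ 2 < 1 := pow_lt_one₀ h0.le h1 (by norm_num)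
  have t1 : Filter.Tendsto (fun n : ℕ => pP q (2 * n)) Filter.atTop (nhds (eP q)) :=
    (pP_tendsto h0 h1).comp (Filter.tendsto_atTop_atTop.2 fun b => ⟨b, fun n hn => by omega⟩)
  refine (t1.div (pP_tendsto hQ0 hQ1) (eP_ne hQ0 hQ1)).congr fun n => ?_
  simp only [Pi.div_apply]
  rw [div_eq_iff (pP_pos hQ0 hQ1 n).ne']
  induction n with
  | zero => simp [pP]
  | succ n ih =>
    rw [show 2 * (n + 1) = 2 * n + 1 + 1 by ring, pP_succ, pP_succ, ih, pP_succ, prod_range_succ, ← pow_mul]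
    ring

theorem plus_prod_tendsto (h0 : 0 < q) (h1 : q < 1) :
    Filter.Tendsto (fun n => ∏ k ∈ range n, (1 + q ^ (k + 1))) Filter.atTop (nhds (eP (q ^ 2) / eP q)) := by
  have hQ0 : 0 < q ^ 2 := by positivity
  have hQ1 : q ^ 2 < 1 := pow_lt_one₀ h0.le h1 (by norm_num)
  refine ((pP_tendsto hQ0 hQ1).div (pP_tendsto h0 h1) (eP_ne h0 h1)).congr fun n => ?_
  simp only [Pi.div_apply]
  rw [div_eq_iff (pP_pos h0 h1 n).ne']
  induction n with
  | zero => simp [pP]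
  | succ n ih =>
    rw [pP_succ, pP_succ, ih, prod_range_succ, ← pow_mul]
    ring

theorem th_neg_prod (h0 : 0 < q) (h1 : q < 1) : th (-q) = eP q ^ 2 / eP (q ^ 2) := by
  have hQ0 : 0 < q ^ 2 := by positivity
  have hQ1 : q ^ 2 < 1 := pow_lt_one₀ h0.le h1 (by norm_num)
  have hE := eP_pos hQ0 hQ1
  have hn := th_neg_hasSum h0 h1
  have h := jtp h0 h1 (z := -1) (by norm_num) (s := (eP q / eP (q ^ 2)) ^ 2)
    (by refine hn.summable.norm.congr fun j => ?_
        rw [mul_comm]) (by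
      refine ((odd_prod_tendsto h0 h1).pow 2).congr fun n => ?_
      rw [← prod_pow]
      refine prod_congr rfl fun k _ => ?_
      norm_num
      ring)
  refine hn.unique (hsc h (fun j => by ring) ?_)
  field_simp

theorem tb_prod (h0 : 0 < q) (h1 : q < 1) : tb q = 2 * q * eP (q ^ 16) ^ 2 / eP (q ^ 8) := by
  have h80 : 0 < q ^ 8 := by positivity
  have h81 : q ^ 8 < 1 := pow_lt_one₀ h0.le h1 (by norm_num)
  have h40 : 0 < q ^ 4 := by positivity
  have h41 : q ^ 4 < 1 := pow_lt_one₀ h0.le h1 (by norm_num)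
  have hE := eP_pos h80 h81
  have hn := (tb_hasSum h0 h1).mul_left q⁻¹
  have key : ∀ j : ℤ, (q ^ 4) ^ (j ^ 2) * (q ^ 4) ^ j = q⁻¹ * q ^ ((2 * j + 1) ^ 2) := by
    intro j
    rw [← zpow_neg_one, ← zpow_add₀ h0.ne', ← zpow_add₀ h40.ne', ← zpow_natCast, ← zpow_mul]
    congr 1; push_cast; ring
  have tp := plus_prod_tendsto h80 h81
  have tz : Filter.Tendsto (fun n : ℕ => 2 / (1 + (q ^ 8) ^ n)) Filter.atTop (nhds (2 / (1 + 0))) :=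
    (tendsto_const_nhds).div ((tendsto_pow_atTop_nhds_zero_of_lt_one h80.le h81).const_add 1) (by norm_num)
  have h := jtp h40 h41 (z := q ^ 4) (by positivity) (s := (eP ((q ^ 8) ^ 2) / eP (q ^ 8)) ^ 2 * (2 / (1 + 0)))
    (by refine hn.summable.norm.congr fun j => ?_
        rw [key]) (by
      refine ((tp.pow 2).mul tz).congr fun n => ?_
      induction n with
      | zero => norm_num
      | succ n ih =>
        rw [prod_range_succ _ n, prod_range_succ _ n, ← ih]
        have : (0 : ℝ) < 1 + (q ^ 8) ^ n := by positivity
        have : (0 : ℝ) < 1 + (q ^ 8) ^ (n + 1) := by positivity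
        have e1 : q ^ 4 * (q ^ 4) ^ (2 * n + 1) = (q ^ 8) ^ (n + 1) := by ring
        have e2 : (q ^ 4)⁻¹ * (q ^ 4) ^ (2 * n + 1) = (q ^ 8) ^ n := by
          rw [pow_succ (q ^ 4)]; field_simp; ring
        rw [e1, e2]
        field_simp)
  have := hn.unique (hsc h (fun j => (key j).symm) rfl)
  rw [← pow_mul, ← pow_mul] at this
  norm_num at this
  have e : tb q = q * (q⁻¹ * tb q) := by field_simp
  rw [e, this]
  field_simp

end RF5

namespace RF5
variable {q : ℝ}


theorem pk (h0 : 0 < q) (h1 : q < 1) {k : ℕ} (hk : k ≠ 0) : 0 < q ^ k ∧ q ^ k < 1 :=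
  ⟨by positivity, pow_lt_one₀ h0.le h1 hk⟩

theorem th_prod (h0 : 0 < q) (h1 : q < 1) :
    th q = eP (q ^ 2) ^ 5 / (eP (q ^ 4) ^ 2 * eP q ^ 2) := by
  have h2 := pk h0 h1 (k := 2) (by norm_num)
  have h4 := pk h0 h1 (k := 4) (by norm_num)
  have e1 := eP_pos h0 h1
  have e2 := eP_pos h2.1 h2.2
  have e4 := eP_pos h4.1 h4.2
  have h := th_mul_neg h0 h1
  have hh := th_neg_prod h2.1 h2.2
  rw [← pow_mul] at hh
  norm_num at hh
  rw [th_neg_prod h0 h1, hh] at h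
  have e : th q = th q * (eP q ^ 2 / eP (q ^ 2)) * (eP (q ^ 2) / eP q ^ 2) := by field_simp
  rw [e, h]
  field_simp

/-- eta quotients as real functions -/
noncomputable def eQ1 (x : ℝ) : ℝ := x * eP (x ^ 2) ^ 11 * eP (x ^ 8) ^ 2 / (eP x ^ 2 * eP (x ^ 4) ^ 3)
/-- eta quotients as real functions -/
noncomputable def eQ2 (x : ℝ) : ℝ := x * eP x ^ 2 * eP (x ^ 4) ^ 11 / (eP (x ^ 2) ^ 3 * eP (x ^ 8) ^ 2)

theorem eQ_pos (h0 : 0 < q) (h1 : q < 1) : 0 < eQ1 q ∧ 0 < eQ2 q := by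
  have h2 := pk h0 h1 (k := 2) (by norm_num)
  have h4 := pk h0 h1 (k := 4) (by norm_num)
  have h8 := pk h0 h1 (k := 8) (by norm_num)
  have e1 := eP_pos h0 h1
  have e2 := eP_pos h2.1 h2.2
  have e4 := eP_pos h4.1 h4.2
  have e8 := eP_pos h8.1 h8.2
  unfold eQ1 eQ2
  constructor <;> positivity

theorem eQ_theta (h0 : 0 < q) (h1 : q < 1) :
    eQ1 q = 1 / 2 * (th (q ^ 4) * th (q ^ 2)) * (tb q * (th (q ^ 4) + tb q) * (th (q ^ 4) ^ 2 - tb q ^ 2) ^ 2) ∧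
    eQ2 q = 1 / 2 * (th (q ^ 4) * th (q ^ 2)) * (tb q * (th (q ^ 4) - tb q) * (th (q ^ 4) ^ 4 - tb q ^ 4)) ∧
    eQ1 (q ^ 2) = 1 / 4 * (th (q ^ 4) * th (q ^ 2)) * (tb q ^ 2 * (th (q ^ 4) ^ 4 - tb q ^ 4)) ∧
    eQ2 (q ^ 2) = 1 / 4 * (th (q ^ 4) * th (q ^ 2)) *
      (th (q ^ 4) ^ 2 * tb q ^ 2 * (th (q ^ 4) ^ 2 - tb q ^ 2)) := by
  have h2 := pk h0 h1 (k := 2) (by norm_num)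
  have h4 := pk h0 h1 (k := 4) (by norm_num)
  have h8 := pk h0 h1 (k := 8) (by norm_num)
  have h16 := pk h0 h1 (k := 16) (by norm_num)
  have e1 := eP_pos h0 h1
  have e2 := eP_pos h2.1 h2.2
  have e4 := eP_pos h4.1 h4.2
  have e8 := eP_pos h8.1 h8.2
  have e16 := eP_pos h16.1 h16.2
  have f4 : th (q ^ 4) ^ 4 - tb q ^ 4 = (th (-q ^ 2) ^ 2) * (th (q ^ 2) ^ 2) := by
    rw [th2n_sq h0 h1, th2_sq h0 h1]; ring
  have t2 := th_neg_prod h2.1 h2.2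
  have u2 := th_prod h2.1 h2.2
  have u4 := th_prod h4.1 h4.2
  have t1 := th_neg_prod h0 h1
  have u1 := th_prod h0 h1
  have ub := tb_prod h0 h1
  rw [← th2n_sq h0 h1, f4, ← th_p h0 h1, ← th_n h0 h1]
  unfold eQ1 eQ2
  simp only [← pow_mul] at *
  norm_num at *
  rw [u1, t1, t2, u2, u4, ub]
  generalize eP q = E1 at *
  generalize eP (q ^ 2) = E2 at *
  generalize eP (q ^ 4) = E4 at *
  generalize eP (q ^ 8) = E8 at *
  generalize eP (q ^ 16) = E16 at *
  refine ⟨?_, ?_, ?_, ?_⟩ <;> field_simp <;> ring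

theorem eP_cast {x : ℝ} (h0 : 0 < x) (h1 : x < 1) : ((eP x : ℝ) : ℂ) = ∏' m : ℕ, (1 - (x : ℂ) ^ (m + 1)) := by
  have hs : Summable (fun n : ℕ => ‖-x ^ (n + 1)‖) := by
    refine ((summable_nat_add_iff 1).mpr (summable_geometric_of_lt_one h0.le h1)).congr (fun n => ?_)
    rw [norm_neg, Real.norm_of_nonneg (by positivity)]
  have h := (multipliable_one_add_of_summable hs).hasProd
  simp only [← sub_eq_add_neg] at h
  have h2 := (h.map Complex.ofRealHom Complex.continuous_ofReal).tprod_eq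
  rw [show ((eP x : ℝ) : ℂ) = Complex.ofRealHom (∏' m : ℕ, (1 - x ^ (m + 1))) from rfl, ← h2]
  congr 1
  funext m
  simp

theorem eta_value (h0 : 0 < q) (h1 : q < 1) : ∃ (z : ℂ) (w : ℝ), 0 < z.im ∧ 0 < w ∧ w ^ 24 = q ∧
    Complex.exp (2 * Real.pi * Complex.I * z) = q ∧
    ∀ k : ℕ, k ≠ 0 → dedekindEta (k * z) = ((w ^ k * eP (q ^ k) : ℝ) : ℂ) := by
  have hlog : Real.log q < 0 := Real.log_neg h0 h1
  set t : ℝ := - Real.log q / (2 * Real.pi) with ht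
  have hpi := Real.pi_pos
  have htpos : 0 < t := by rw [ht]; apply div_pos <;> linarith
  have hq : Complex.exp (2 * Real.pi * Complex.I * (Complex.I * t)) = q := by
    rw [show (2 * Real.pi * Complex.I * (Complex.I * t) : ℂ) = ((Real.log q : ℝ) : ℂ) by
      rw [show (2 * Real.pi * Complex.I * (Complex.I * t) : ℂ) = (Complex.I * Complex.I) * (2 * Real.pi * t) by ring,
        Complex.I_mul_I]
      rw [ht]; push_cast
      have : (Real.pi : ℂ) ≠ 0 := by exact_mod_cast hpi.ne'
      field_simp]
    rw [← Complex.ofReal_exp, Real.exp_log h0]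
  refine ⟨Complex.I * t, Real.exp (Real.log q / 24), by simpa using htpos, Real.exp_pos _, ?_, hq, ?_⟩
  · rw [← Real.exp_nat_mul, show ((24 : ℕ) : ℝ) * (Real.log q / 24) = Real.log q by push_cast; ring, Real.exp_log h0]
  · intro k hk
    unfold dedekindEta
    obtain ⟨hk0, hk1⟩ := pk h0 h1 hk
    rw [Complex.ofReal_mul, eP_cast hk0 hk1]
    congr 1
    · rw [← Real.exp_nat_mul, Complex.ofReal_exp]
      congr 1
      rw [show (Real.pi * Complex.I * (k * (Complex.I * t)) / 12 : ℂ)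
        = (Complex.I * Complex.I) * (Real.pi * t * k / 12) by ring, Complex.I_mul_I]
      rw [ht]; push_cast
      have : (Real.pi : ℂ) ≠ 0 := by exact_mod_cast hpi.ne'
      field_simp
      ring
    · congr 1
      funext m
      rw [Complex.ofReal_pow, ← hq, ← pow_mul, ← Complex.exp_nat_mul]
      congr 2
      push_cast; ring

theorem a1_hasSum {a1 : ℕ → ℤ}
    (ha1 : ∀ z : ℂ, 0 < z.im →
      dedekindEta z ^ (-2 : ℤ) * dedekindEta (2 * z) ^ (11 : ℤ) * dedekindEta (4 * z) ^ (-3 : ℤ) * dedekindEta (8 * z) ^ (2 : ℤ)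
        = ∑' m : ℕ, (a1 (m + 1) : ℂ) * Complex.exp (2 * Real.pi * Complex.I * z) ^ (m + 1))
    (h0 : 0 < q) (h1 : q < 1) : HasSum (fun m : ℕ => (a1 (m + 1) : ℝ) * q ^ (m + 1)) (eQ1 q) := by
  obtain ⟨z, w, hz, hw, hwq, hexp, heta⟩ := eta_value h0 h1
  have H := ha1 z hz
  have k1 := heta 1 (by norm_num)
  have k2 := heta 2 (by norm_num)
  have k4 := heta 4 (by norm_num)
  have k8 := heta 8 (by norm_num)
  push_cast at k1 k2 k4 k8
  rw [one_mul, pow_one, pow_one] at k1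
  rw [k1, k2, k4, k8, hexp] at H
  have h2 := pk h0 h1 (k := 2) (by norm_num)
  have h4 := pk h0 h1 (k := 4) (by norm_num)
  have h8 := pk h0 h1 (k := 8) (by norm_num)
  have e1 := eP_pos h0 h1
  have e2 := eP_pos h2.1 h2.2
  have e4 := eP_pos h4.1 h4.2
  have e8 := eP_pos h8.1 h8.2
  have hval : (w * eP q) ^ (-2 : ℤ) * (w ^ 2 * eP (q ^ 2)) ^ (11 : ℤ) * (w ^ 4 * eP (q ^ 4)) ^ (-3 : ℤ)
      * (w ^ 8 * eP (q ^ 8)) ^ (2 : ℤ) = eQ1 q := by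
    unfold eQ1
    nth_rewrite 5 [← hwq]
    rw [zpow_neg, zpow_neg]
    norm_cast
    field_simp
  have hsum : ((eQ1 q : ℝ) : ℂ) = ((∑' m : ℕ, (a1 (m + 1) : ℝ) * q ^ (m + 1) : ℝ) : ℂ) := by
    rw [← hval]
    push_cast
    exact H
  have hs : eQ1 q = ∑' m : ℕ, (a1 (m + 1) : ℝ) * q ^ (m + 1) := by exact_mod_cast hsum
  have hsm : Summable (fun m : ℕ => (a1 (m + 1) : ℝ) * q ^ (m + 1)) := by
    by_contra hns
    rw [tsum_eq_zero_of_not_summable hns] at hs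
    exact (eQ_pos h0 h1).1.ne' hs
  rw [hs]
  exact hsm.hasSum

theorem a2_hasSum {a2 : ℕ → ℤ}
    (ha2 : ∀ z : ℂ, 0 < z.im →
      dedekindEta z ^ (2 : ℤ) * dedekindEta (2 * z) ^ (-3 : ℤ) * dedekindEta (4 * z) ^ (11 : ℤ) * dedekindEta (8 * z) ^ (-2 : ℤ)
        = ∑' m : ℕ, (a2 (m + 1) : ℂ) * Complex.exp (2 * Real.pi * Complex.I * z) ^ (m + 1))
    (h0 : 0 < q) (h1 : q < 1) : HasSum (fun m : ℕ => (a2 (m + 1) : ℝ) * q ^ (m + 1)) (eQ2 q) := by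
  obtain ⟨z, w, hz, hw, hwq, hexp, heta⟩ := eta_value h0 h1
  have H := ha2 z hz
  have k1 := heta 1 (by norm_num)
  have k2 := heta 2 (by norm_num)
  have k4 := heta 4 (by norm_num)
  have k8 := heta 8 (by norm_num)
  push_cast at k1 k2 k4 k8
  rw [one_mul, pow_one, pow_one] at k1
  rw [k1, k2, k4, k8, hexp] at H
  have h2 := pk h0 h1 (k := 2) (by norm_num)
  have h4 := pk h0 h1 (k := 4) (by norm_num)
  have h8 := pk h0 h1 (k := 8) (by norm_num)
  have e1 := eP_pos h0 h1
  have e2 := eP_pos h2.1 h2.2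
  have e4 := eP_pos h4.1 h4.2
  have e8 := eP_pos h8.1 h8.2
  have hval : (w * eP q) ^ (2 : ℤ) * (w ^ 2 * eP (q ^ 2)) ^ (-3 : ℤ) * (w ^ 4 * eP (q ^ 4)) ^ (11 : ℤ)
      * (w ^ 8 * eP (q ^ 8)) ^ (-2 : ℤ) = eQ2 q := by
    unfold eQ2
    nth_rewrite 5 [← hwq]
    rw [zpow_neg, zpow_neg]
    norm_cast
    field_simp
  have hsum : ((eQ2 q : ℝ) : ℂ) = ((∑' m : ℕ, (a2 (m + 1) : ℝ) * q ^ (m + 1) : ℝ) : ℂ) := by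
    rw [← hval]
    push_cast
    exact H
  have hs : eQ2 q = ∑' m : ℕ, (a2 (m + 1) : ℝ) * q ^ (m + 1) := by exact_mod_cast hsum
  have hsm : Summable (fun m : ℕ => (a2 (m + 1) : ℝ) * q ^ (m + 1)) := by
    by_contra hns
    rw [tsum_eq_zero_of_not_summable hns] at hs
    exact (eQ_pos h0 h1).2.ne' hs
  rw [hs]
  exact hsm.hasSum

end RF5

namespace RF5
variable {q : ℝ}





theorem hasSum_mul_real {X Y : Type*} {f : X → ℝ} {g : Y → ℝ} {s t : ℝ} (hf : HasSum f s)
    (hg : HasSum g t) : HasSum (fun x : X × Y => f x.1 * g x.2) (s * t) :=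
  HasSum.mul hf hg (summable_mul_of_summable_norm (f := f) (g := g) hf.summable.norm hg.summable.norm)

/-- products of theta series -/
theorem theta_prod (h0 : 0 < q) (h1 : q < 1) (n : ℕ) (a : Fin n → ℕ) (ha : ∀ i, a i ≠ 0) :
    HasSum (fun x : Fin n → ℤ => ∏ i, (q ^ a i) ^ (x i ^ 2)) (∏ i, th (q ^ a i)) := by
  induction n with
  | zero =>
    refine hsc (hasSum_unique _) (fun _ => rfl) (by simp)
  | succ n ih =>
    have h2 := ih (fun i => a i.succ) (fun i => ha _)
    obtain ⟨p0, p1⟩ := pk h0 h1 (ha 0)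
    have h3 := th_pos_hasSum p0 p1
    have h4 := hasSum_mul_real h3 h2
    rw [← (Fin.consEquiv (fun _ => ℤ)).hasSum_iff, Fin.prod_univ_succ]
    refine hsc h4 (fun x => ?_) rfl
    simp [Fin.consEquiv, Fin.prod_univ_succ]

theorem fiber_count {X : Type*} (h0 : 0 < q) (e : X → ℕ) {s : ℝ} (h : HasSum (fun x => q ^ e x) s) :
    HasSum (fun n : ℕ => (Nat.card {x // e x = n} : ℝ) * q ^ n) s := by
  rw [← (Equiv.sigmaFiberEquiv e).hasSum_iff] at h
  refine h.sigma fun n => ?_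
  have hs := h.summable.sigma_factor n
  have e1 : ∀ c : {x // e x = n}, ((fun x => q ^ e x) ∘ (Equiv.sigmaFiberEquiv e)) ⟨n, c⟩ = q ^ n := by
    intro c; simp [Equiv.sigmaFiberEquiv, c.2]
  have hs' : Summable (fun _ : {x // e x = n} => q ^ n) := hs.congr fun c => (e1 c)
  have hfin : Finite {x // e x = n} := by
    by_contra hinf
    rw [not_finite_iff_infinite] at hinf
    have := summable_const_iff (q ^ n) |>.1 hs'
    have h5 : 0 < q ^ n := by positivity
    exact h5.ne' this
  haveI := Fintype.ofFinite {x // e x = n}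
  refine hsc (hasSum_fintype (fun _ : {x // e x = n} => q ^ n)) e1 ?_
  simp [Nat.card_eq_fintype_card]

theorem rep_hasSum (h0 : 0 < q) (h1 : q < 1) (a : Fin 8 → ℕ) (ha : ∀ i, a i ≠ 0) :
    HasSum (fun n : ℕ => (repCount a n : ℝ) * q ^ n) (∏ i, th (q ^ a i)) := by
  have h := fiber_count h0 (fun x : Fin 8 → ℤ => ∑ i, a i * (x i).natAbs ^ 2)
    (s := ∏ i, th (q ^ a i)) (by
      refine hsc (theta_prod h0 h1 8 a ha) (fun x => ?_) rfl
      rw [← prod_pow_eq_pow_sum]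
      refine prod_congr rfl fun i _ => ?_
      rw [pow_mul, ← zpow_natCast]
      congr 1
      simp)
  refine hsc h (fun n => ?_) rfl
  congr 2
  unfold repCount
  refine Nat.card_congr (Equiv.subtypeEquivRight fun x => ?_)
  rw [← Nat.cast_inj (R := ℤ)]
  push_cast
  simp

/-- pairs of positive integers sorted by product -/
def pairEquiv : ℕ × ℕ ≃ (Σ n : ℕ, n.divisorsAntidiagonal) where
  toFun x := ⟨(x.1 + 1) * (x.2 + 1), ⟨(x.1 + 1, x.2 + 1), by simp⟩⟩
  invFun y := (y.2.1.1 - 1, y.2.1.2 - 1)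
  left_inv x := by simp
  right_inv := by
    rintro ⟨n, ⟨k, l⟩, h⟩
    have h' := Nat.mem_divisorsAntidiagonal.1 h
    simp only at h'
    obtain ⟨h1, h2⟩ := h'
    subst h1
    obtain ⟨k, rfl⟩ := Nat.exists_eq_succ_of_ne_zero (left_ne_zero_of_mul h2)
    obtain ⟨l, rfl⟩ := Nat.exists_eq_succ_of_ne_zero (right_ne_zero_of_mul h2)
    rfl

theorem double_to_single {α β : ℕ → ℝ} {s : ℝ}
    (h : HasSum (fun x : ℕ × ℕ => α (x.1 + 1) * β (x.2 + 1) * q ^ ((x.1 + 1) * (x.2 + 1))) s) :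
    HasSum (fun n : ℕ => (∑ x ∈ n.divisorsAntidiagonal, α x.1 * β x.2) * q ^ n) s := by
  have h2 : HasSum (fun y : (Σ n : ℕ, n.divisorsAntidiagonal) => α y.2.1.1 * β y.2.1.2 * q ^ y.1) s := by
    rw [← pairEquiv.hasSum_iff]
    exact h
  refine h2.sigma fun n => ?_
  refine hsc (hasSum_fintype _) (fun _ => rfl) ?_
  rw [sum_mul]
  exact (Finset.sum_coe_sort n.divisorsAntidiagonal (fun x => α x.1 * β x.2 * q ^ n)).symm

theorem c8_chi (n : ℕ) : ((ZMod.χ₈ (n : ZMod 8) : ℤ) : ℝ) = c8 n := by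
  rw [ZMod.χ₈_nat_eq_if_mod_eight]
  unfold c8 rc
  split_ifs <;> first | omega | norm_num

theorem sig1_eq (n : ℕ) : ∑ x ∈ n.divisorsAntidiagonal, c8 x.1 * (x.2 : ℝ) ^ 3 = (sigmaChi8One n : ℝ) := by
  unfold sigmaChi8One
  push_cast
  rw [Nat.sum_divisorsAntidiagonal' (f := fun a b => c8 a * (b : ℝ) ^ 3)]
  exact sum_congr rfl fun d _ => by rw [c8_chi]

theorem sig2_eq (n : ℕ) : ∑ x ∈ n.divisorsAntidiagonal, (c8 x.1 * (x.1 : ℝ) ^ 3) * (if x.2 = 0 then (0 : ℝ) else 1)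
    = (sigmaOneChi8 n : ℝ) := by
  unfold sigmaOneChi8
  push_cast
  rw [← Nat.sum_divisorsAntidiagonal (f := fun a b => ((ZMod.χ₈ (a : ZMod 8) : ℤ) : ℝ) * (a : ℝ) ^ 3)]
  refine sum_congr rfl fun x hx => ?_
  have h' := Nat.mem_divisorsAntidiagonal.1 hx
  have : x.2 ≠ 0 := by
    intro h; rw [h] at h'; simp at h'; exact h'.2 h'.1.symm
  rw [if_neg this, c8_chi, mul_one]

theorem poly_summable {α : ℕ → ℝ} {p : ℕ} (hα : ∀ n, |α n| ≤ (n : ℝ) ^ p) (x : ℝ) (h0 : 0 < x) (h1 : x < 1) :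
    Summable (fun n => α (n + 1) * x ^ (n + 1)) := by
  have h := (summable_nat_add_iff 1).2
    (summable_pow_mul_geometric_of_norm_lt_one (R := ℝ) p (r := x) (by rwa [Real.norm_of_nonneg h0.le]))
  refine Summable.of_norm_bounded h fun n => ?_
  rw [norm_mul, Real.norm_of_nonneg (show 0 ≤ x ^ (n + 1) by positivity), Real.norm_eq_abs]
  gcongr
  exact hα _

theorem sig1_hasSum (h0 : 0 < q) (h1 : q < 1) : HasSum (fun n : ℕ => (sigmaChi8One n : ℝ) * q ^ n)
      (th (q ^ 4) * tb q * (th q * th (q ^ 2)) / 2 *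
        (3 / 4 * (th (q ^ 4) ^ 2 + tb q ^ 2) ^ 2 + 1 / 2 * (th (q ^ 4) + tb q) ^ 4
          - 1 / 4 * (th (q ^ 4) - tb q) ^ 4)) := by
  have hα : ∀ n, |c8 n| ≤ (n : ℝ) ^ 3 := fun n => abs_le_pow_of c8_zero (fun n => (chars_le n).1) n 3
  have hβ : ∀ n : ℕ, |(n : ℝ) ^ 3| ≤ (n : ℝ) ^ 3 := fun n => (abs_of_nonneg (by positivity)).le
  obtain ⟨s, k1, -, k3⟩ := lambert h0 h1 (α := c8) (β := fun n => (n : ℝ) ^ 3)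
    (A := fun x => (x - x ^ 3) / (1 + x ^ 4)) 3 hα hβ
    (fun x hx0 hx1 => c8_hasSum hx0 hx1) (fun x hx0 hx1 => (poly_summable hβ x hx0 hx1).hasSum)
  have k4 := hasSum_of_succ (by simp) (H_hasSum h0 h1)
  have := k4.unique (hsc k3 (fun n => by
    rw [mul_comm 3, mul_comm 4, pow_mul, pow_mul]) rfl)
  rw [this]
  refine hsc (double_to_single (α := c8) (β := fun n => (n : ℝ) ^ 3) k1) (fun n => ?_) rfl
  rw [sig1_eq]

theorem sig2_hasSum (h0 : 0 < q) (h1 : q < 1) {s : ℝ}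
    (hs : HasSum (fun n : ℕ => c8 n * ((n : ℝ) ^ 3 * (q ^ n / (1 - q ^ n)))) s) :
    HasSum (fun n : ℕ => (sigmaOneChi8 n : ℝ) * q ^ n) s := by
  have hα : ∀ n, |c8 n * (n : ℝ) ^ 3| ≤ (n : ℝ) ^ 3 := fun n => by
    rw [abs_mul, abs_of_nonneg (show (0 : ℝ) ≤ (n : ℝ) ^ 3 by positivity)]
    exact mul_le_of_le_one_left (by positivity) (chars_le n).1
  have hβ : ∀ n : ℕ, |(if n = 0 then (0 : ℝ) else 1)| ≤ (n : ℝ) ^ 3 := fun n =>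
    abs_le_pow_of (f := fun n => if n = 0 then (0 : ℝ) else 1) (by simp)
      (fun n => by split_ifs <;> simp) n 3
  obtain ⟨t, k1, k2, -⟩ := lambert h0 h1 (α := fun n => c8 n * (n : ℝ) ^ 3)
    (β := fun n => (if n = 0 then (0 : ℝ) else 1)) (B := fun x => x / (1 - x)) 3 hα hβ
    (fun x hx0 hx1 => (poly_summable hα x hx0 hx1).hasSum) (fun x hx0 hx1 => by simpa using hasSum_one hx0 hx1)
  have k4 := hasSum_of_succ (by simp) hs
  have := k4.unique (hsc k2 (fun n => by ring) rfl)
  rw [this]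
  refine hsc (double_to_single (α := fun n => c8 n * (n : ℝ) ^ 3)
    (β := fun n => (if n = 0 then (0 : ℝ) else 1)) k1) (fun n => ?_) rfl
  rw [sig2_eq]

theorem half_hasSum {f : ℕ → ℤ} (hf0 : f 0 = 0) {s : ℝ} (h : HasSum (fun n : ℕ => (f n : ℝ) * (q ^ 2) ^ n) s) :
    HasSum (fun n : ℕ => ((half f n : ℚ) : ℝ) * q ^ n) s := by
  have hinj : Function.Injective (fun k : ℕ => 2 * k) := by
    intro a b h; simp only at h; omega
  refine (hinj.hasSum_iff ?_).1 (hsc h (fun k => ?_) rfl)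
  · intro n hn
    rw [half, if_neg]
    · simp
    · rintro ⟨k, rfl⟩; exact hn ⟨k, rfl⟩
  · simp [half, pow_mul]

theorem coeff_zero_of {D : ℕ → ℝ} (h : ∀ x : ℝ, 0 < x → x < 1 → HasSum (fun n => D n * x ^ n) 0) (n : ℕ) :
    D n = 0 := by
  induction n using Nat.strong_induction_on with
  | _ n ih =>
  have h2 : ∀ x : ℝ, 0 < x → x < 1 → HasSum (fun k => D (k + n) * x ^ k) 0 := by
    intro x hx0 hx1
    have h3 := (hasSum_nat_add_iff' n).2 (h x hx0 hx1)
    rw [sum_eq_zero (fun i hi => by rw [ih i (mem_range.1 hi), zero_mul]), sub_zero] at h3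
    have h4 := h3.mul_right ((x ^ n)⁻¹)
    have : 0 < x ^ n := by positivity
    refine hsc h4 (fun k => ?_) (by simp)
    rw [pow_add]; field_simp
  have hM := ((h2 (1 / 2) (by norm_num) (by norm_num)).summable.abs)
  have hM1 := (summable_nat_add_iff 1).2 hM
  set M := ∑' k : ℕ, |D (k + 1 + n) * (1 / 2) ^ (k + 1)| with hMd
  have hb : ∀ x : ℝ, 0 < x → x ≤ 1 / 2 → |D n| ≤ 2 * x * M := by
    intro x hx0 hx1
    have h3 := h2 x hx0 (by linarith)
    have h4 := (hasSum_nat_add_iff' 1).2 h3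
    simp only [sum_range_one, zero_add, pow_zero, mul_one, zero_sub] at h4
    have h5 : |(-D n)| ≤ 2 * x * M := by
      rw [← h4.tsum_eq, ← Real.norm_eq_abs]
      refine tsum_of_norm_bounded (hM1.hasSum.mul_left (2 * x)) fun k => ?_
      rw [Real.norm_eq_abs, abs_mul, abs_mul, abs_of_pos (show 0 < x ^ (k + 1) by positivity),
        abs_of_pos (show (0 : ℝ) < (1 / 2) ^ (k + 1) by positivity)]
      have : x ^ (k + 1) ≤ 2 * x * (1 / 2) ^ (k + 1) := by
        rw [pow_succ, pow_succ]
        have : x ^ k ≤ (1 / 2) ^ k := by gcongr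
        nlinarith
      calc _ ≤ |D (k + 1 + n)| * (2 * x * (1 / 2) ^ (k + 1)) := by gcongr
        _ = _ := by ring
    rwa [abs_neg] at h5
  have hlim : Filter.Tendsto (fun x : ℝ => 2 * x * M) (nhdsWithin 0 (Set.Ioi 0)) (nhds (2 * 0 * M)) :=
    (Continuous.tendsto (by fun_prop) 0).mono_left nhdsWithin_le_nhds
  have hle : |D n| ≤ 2 * 0 * M := by
    refine ge_of_tendsto hlim ?_
    have : Set.Ioo (0 : ℝ) (1 / 2) ∈ nhdsWithin (0 : ℝ) (Set.Ioi 0) := Ioo_mem_nhdsGT (by norm_num)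
    filter_upwards [this] with x hx
    exact hb x hx.1 hx.2.le
  have : |D n| ≤ 0 := by linarith
  exact abs_nonpos_iff.1 this

theorem final
    (a1 a2 : ℕ → ℤ)
    (ha1 : ∀ z : ℂ, 0 < z.im →
      dedekindEta z ^ (-2 : ℤ) * dedekindEta (2 * z) ^ (11 : ℤ) * dedekindEta (4 * z) ^ (-3 : ℤ) * dedekindEta (8 * z) ^ (2 : ℤ)
        = ∑' m : ℕ, (a1 (m + 1) : ℂ) * Complex.exp (2 * Real.pi * Complex.I * z) ^ (m + 1))
    (ha2 : ∀ z : ℂ, 0 < z.im →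
      dedekindEta z ^ (2 : ℤ) * dedekindEta (2 * z) ^ (-3 : ℤ) * dedekindEta (4 * z) ^ (11 : ℤ) * dedekindEta (8 * z) ^ (-2 : ℤ)
        = ∑' m : ℕ, (a2 (m + 1) : ℂ) * Complex.exp (2 * Real.pi * Complex.I * z) ^ (m + 1))
    (n : ℕ) (hn : 0 < n) :
    (repCount ![1, 1, 2, 2, 2, 2, 2, 4] n : ℚ) =
    (((16 : ℚ) / 11) * (sigmaChi8One n : ℚ) + ((2 : ℚ) / 11) * half sigmaOneChi8 n
      + ((4 : ℚ) / 11) * (a1 n : ℚ) + ((24 : ℚ) / 11) * (a2 n : ℚ)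
      + ((48 : ℚ) / 11) * half a1 n + ((16 : ℚ) / 11) * half a2 n) := by
  set b1 : ℕ → ℤ := fun n => if n = 0 then 0 else a1 n with hb1
  set b2 : ℕ → ℤ := fun n => if n = 0 then 0 else a2 n with hb2
  have s1 : ∀ x : ℝ, 0 < x → x < 1 → HasSum (fun n => (b1 n : ℝ) * x ^ n) (eQ1 x) := fun x h0 h1 =>
    hasSum_succ (by simp [hb1]) (hsc (a1_hasSum ha1 h0 h1) (fun n => by simp [hb1]) rfl)
  have s2 : ∀ x : ℝ, 0 < x → x < 1 → HasSum (fun n => (b2 n : ℝ) * x ^ n) (eQ2 x) := fun x h0 h1 =>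
    hasSum_succ (by simp [hb2]) (hsc (a2_hasSum ha2 h0 h1) (fun n => by simp [hb2]) rfl)
  have key := coeff_zero_of (D := fun n => (repCount ![1, 1, 2, 2, 2, 2, 2, 4] n : ℝ) - (if n = 0 then 1 else 0)
    - ((16 / 11) * (sigmaChi8One n : ℝ) + (2 / 11) * ((half sigmaOneChi8 n : ℚ) : ℝ) + (4 / 11) * (b1 n : ℝ)
      + (24 / 11) * (b2 n : ℝ) + (48 / 11) * ((half b1 n : ℚ) : ℝ) + (16 / 11) * ((half b2 n : ℚ) : ℝ))) (by
    intro q h0 h1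
    have h2 := pk h0 h1 (k := 2) (by norm_num)
    have r := rep_hasSum h0 h1 ![1, 1, 2, 2, 2, 2, 2, 4] (by decide)
    have t1 := sig1_hasSum h0 h1
    have t2 := half_hasSum (by simp [sigmaOneChi8]) (sig2_hasSum h2.1 h2.2 (G2_hasSum h0 h1))
    have u1 := half_hasSum (by simp [hb1]) (s1 (q ^ 2) h2.1 h2.2)
    have u2 := half_hasSum (by simp [hb2]) (s2 (q ^ 2) h2.1 h2.2)
    refine hsc ((r.sub (hasSum_ite_eq (0 : ℕ) (1 : ℝ))).sub ((((((t1.mul_left (16 / 11)).add (t2.mul_left (2 / 11))).add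
      ((s1 q h0 h1).mul_left (4 / 11))).add ((s2 q h0 h1).mul_left (24 / 11))).add (u1.mul_left (48 / 11))).add
      (u2.mul_left (16 / 11)))) (fun n => ?_) ?_
    · by_cases h : n = 0
      · subst h; simp
      · simp only [h, if_false]; ring
    · obtain ⟨v1, v2, v3, v4⟩ := eQ_theta h0 h1
      rw [v1, v2, v3, v4]
      have e2 := th2_sq h0 h1
      have hr : ∏ i, th (q ^ (![1, 1, 2, 2, 2, 2, 2, 4] : Fin 8 → ℕ) i) =
          (th (q ^ 4) * th (q ^ 2)) * (th q ^ 2 * (th (q ^ 2) ^ 2) ^ 2) := by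
        simp [Fin.prod_univ_succ]; ring
      rw [hr, e2, th_p h0 h1]
      ring)
  have kn := key n
  have hn' : n ≠ 0 := hn.ne'
  have e1 : half b1 n = half a1 n := by
    unfold half
    split_ifs with h
    · have : n / 2 ≠ 0 := by omega
      simp [hb1, this]
    · rfl
  have e2 : half b2 n = half a2 n := by
    unfold half
    split_ifs with h
    · have : n / 2 ≠ 0 := by omega
      simp [hb2, this]
    · rfl
  rw [e1, e2] at kn
  simp only [hb1, hb2, hn', if_false] at kn
  have : ((repCount ![1, 1, 2, 2, 2, 2, 2, 4] n : ℚ) : ℝ) =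
    (((((16 : ℚ) / 11) * (sigmaChi8One n : ℚ) + ((2 : ℚ) / 11) * half sigmaOneChi8 n
      + ((4 : ℚ) / 11) * (a1 n : ℚ) + ((24 : ℚ) / 11) * (a2 n : ℚ)
      + ((48 : ℚ) / 11) * half a1 n + ((16 : ℚ) / 11) * half a2 n) : ℚ) : ℝ) := by
    push_cast
    linarith
  exact_mod_cast this

end RF5

theorem representation_formula_5
    (a1 a2 : ℕ → ℤ)
    (ha1 : ∀ z : ℂ, 0 < z.im →
      dedekindEta z ^ (-2 : ℤ) * dedekindEta (2 * z) ^ (11 : ℤ) * dedekindEta (4 * z) ^ (-3 : ℤ) * dedekindEta (8 * z) ^ (2 : ℤ)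
        = ∑' m : ℕ, (a1 (m + 1) : ℂ) * Complex.exp (2 * Real.pi * Complex.I * z) ^ (m + 1))
    (ha2 : ∀ z : ℂ, 0 < z.im →
      dedekindEta z ^ (2 : ℤ) * dedekindEta (2 * z) ^ (-3 : ℤ) * dedekindEta (4 * z) ^ (11 : ℤ) * dedekindEta (8 * z) ^ (-2 : ℤ)
        = ∑' m : ℕ, (a2 (m + 1) : ℂ) * Complex.exp (2 * Real.pi * Complex.I * z) ^ (m + 1))
    (n : ℕ) (hn : 0 < n) :
    (repCount ![1, 1, 2, 2, 2, 2, 2, 4] n : ℚ) =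
    (((16 : ℚ) / 11) * (sigmaChi8One n : ℚ) + ((2 : ℚ) / 11) * half sigmaOneChi8 n
      + ((4 : ℚ) / 11) * (a1 n : ℚ) + ((24 : ℚ) / 11) * (a2 n : ℚ)
      + ((48 : ℚ) / 11) * half a1 n + ((16 : ℚ) / 11) * half a2 n) := by
  exact RF5.final a1 a2 ha1 ha2 n hn
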